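/- Let δ > −1 and let Λ_n^{B,δ} := sup_{x∈B^d} a_κ^B ∫_{B^d} |K_n^δ(W_κ^B;x,y)| W_κ^B(y) dy, which is the operator norm of the Cesàro (C,δ) mean S_n^δ(W_κ^B) on L^∞(W_κ^B;B^d) (and on L¹(W_κ^B;B^d)). Then there exist constants c₁, c₂ > 0, depending only on d, κ and δ, such that for all integers n ≥ 2: if δ > σ_κ then c₁ ≤ Λ_n^{B,δ} ≤ c₂; if δ = σ_κ then c₁ log n ≤ Λ_n^{B,δ} ≤ c₂ log n; and if −1 < δ < σ_κ then c₁ n^{σ_κ−δ} ≤ Λ_n^{B,δ} ≤ c₂ n^{σ_κ−δ}. -/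

import Mathlib

open MeasureTheory Finset Real

/-- Generalized binomial coefficient `C(x, k) = x (x-1) ⋯ (x-k+1) / k!`. -/
noncomputable def genBinom (x : ℝ) (k : ℕ) : ℝ :=
  (∏ i ∈ Finset.range k, (x - i)) / (Nat.factorial k)

/-- Jacobi polynomial `P_n^{(a,b)}(t)`. -/
noncomputable def jacobiP (n : ℕ) (a b t : ℝ) : ℝ :=
  ∑ m ∈ Finset.range (n + 1),
    genBinom (n + a) (n - m) * genBinom (n + b) m * ((t - 1) / 2) ^ m * ((t + 1) / 2) ^ (n - m)

/-- Pochhammer symbol `(a)_n`. -/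
noncomputable def poch (a : ℝ) (n : ℕ) : ℝ := ∏ i ∈ Finset.range n, (a + i)

/-- Gegenbauer polynomial `C_n^λ(t)`. -/
noncomputable def gegenC (n : ℕ) (l t : ℝ) : ℝ :=
  (poch (2 * l) n / poch (l + 1 / 2) n) * jacobiP n (l - 1 / 2) (l - 1 / 2) t

/-- Cesàro coefficient `A_m^δ = C(m+δ, m)`. -/
noncomputable def cesA (δ : ℝ) (m : ℕ) : ℝ := genBinom (m + δ) m

/-- The cube `[-1,1]^m`. -/
def cube (m : ℕ) : Set (Fin m → ℝ) := Set.univ.pi fun _ => Set.Icc (-1) 1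

/-- The weight `∏ (1+t_i)(1-t_i²)^{κ_i-1}` on the cube. -/
noncomputable def wprod {m : ℕ} (κ : Fin m → ℝ) (t : Fin m → ℝ) : ℝ :=
  ∏ i, (1 + t i) * (1 - t i ^ 2) ^ (κ i - 1)

/-- `λ_κ = |κ| + (d-1)/2`. -/
noncomputable def lamK (d : ℕ) (κ : Fin (d + 1) → ℝ) : ℝ := (∑ i, κ i) + ((d : ℝ) - 1) / 2

/-- The reproducing kernel `P_n(h_κ²; x, y)` on the sphere. -/
noncomputable def hP (d : ℕ) (κ : Fin (d + 1) → ℝ) (n : ℕ)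
    (x y : EuclideanSpace ℝ (Fin (d + 1))) : ℝ :=
  (∫ t in cube (d + 1), wprod κ t)⁻¹ * ((n + lamK d κ) / lamK d κ) *
    ∫ t in cube (d + 1), gegenC n (lamK d κ) (∑ i, x i * y i * t i) * wprod κ t

/-- The Cesàro `(C,δ)` kernel `K_n^δ(h_κ²; x, y)` on the sphere. -/
noncomputable def hK (d : ℕ) (κ : Fin (d + 1) → ℝ) (δ : ℝ) (n : ℕ)
    (x y : EuclideanSpace ℝ (Fin (d + 1))) : ℝ :=
  (cesA δ n)⁻¹ * ∑ k ∈ Finset.range (n + 1), cesA δ (n - k) * hP d κ k x y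

/-- `z̄ = (|z_1|, …, |z_{d+1}|)`. -/
noncomputable def ebar {m : ℕ} (z : EuclideanSpace ℝ (Fin m)) : EuclideanSpace ℝ (Fin m) :=
  (EuclideanSpace.equiv (Fin m) ℝ).symm fun i => |z i|

/-- `h_κ²(y) = ∏ |y_i|^{2κ_i}`. -/
noncomputable def hsq {m : ℕ} (κ : Fin m → ℝ) (y : EuclideanSpace ℝ (Fin m)) : ℝ :=
  ∏ i, |y i| ^ (2 * κ i)

/-- `σ_κ = (d-1)/2 + |κ| - min_i κ_i`. -/
noncomputable def sigmaK (d : ℕ) (κ : Fin (d + 1) → ℝ) : ℝ :=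
  ((d : ℝ) - 1) / 2 + (∑ i, κ i) - Finset.univ.inf' (Finset.univ_nonempty) κ

/-- The surface measure `dω` on the unit sphere `S^d`. -/
noncomputable def sphereMeas (d : ℕ) :
    Measure (Metric.sphere (0 : EuclideanSpace ℝ (Fin (d + 1))) 1) :=
  (volume : Measure (EuclideanSpace ℝ (Fin (d + 1)))).toSphere

/-- Lift `x ∈ B^d` together with last coordinate `s` to a point of `ℝ^{d+1}`. -/
noncomputable def liftB (d : ℕ) (x : EuclideanSpace ℝ (Fin d)) (s : ℝ) :
    EuclideanSpace ℝ (Fin (d + 1)) :=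
  (EuclideanSpace.equiv (Fin (d + 1)) ℝ).symm fun i =>
    if h : (i : ℕ) < d then x ⟨i, h⟩ else s

/-- The weight `W_κ^B(x) = ∏_{i=1}^d |x_i|^{2κ_i} (1-‖x‖²)^{κ_{d+1}-1/2}` on the unit ball. -/
noncomputable def WB (d : ℕ) (κ : Fin (d + 1) → ℝ) (x : EuclideanSpace ℝ (Fin d)) : ℝ :=
  (∏ i : Fin d, |x i| ^ (2 * κ i.castSucc)) * (1 - ‖x‖ ^ 2) ^ (κ (Fin.last d) - 1 / 2)

/-- The Cesàro `(C,δ)` kernel `K_n^δ(W_κ^B; x, y)` on the unit ball. -/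
noncomputable def ballK (d : ℕ) (κ : Fin (d + 1) → ℝ) (δ : ℝ) (n : ℕ)
    (x y : EuclideanSpace ℝ (Fin d)) : ℝ :=
  (hK d κ δ n (liftB d x (Real.sqrt (1 - ‖x‖ ^ 2))) (liftB d y (Real.sqrt (1 - ‖y‖ ^ 2))) +
    hK d κ δ n (liftB d x (Real.sqrt (1 - ‖x‖ ^ 2))) (liftB d y (-Real.sqrt (1 - ‖y‖ ^ 2)))) / 2

/-- The projection kernel `P_n(W_κ^B; x, y)` on the unit ball. -/
noncomputable def ballP (d : ℕ) (κ : Fin (d + 1) → ℝ) (n : ℕ)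
    (x y : EuclideanSpace ℝ (Fin d)) : ℝ :=
  (hP d κ n (liftB d x (Real.sqrt (1 - ‖x‖ ^ 2))) (liftB d y (Real.sqrt (1 - ‖y‖ ^ 2))) +
    hP d κ n (liftB d x (Real.sqrt (1 - ‖x‖ ^ 2))) (liftB d y (-Real.sqrt (1 - ‖y‖ ^ 2)))) / 2

/-- The operator norm `Λ_n^{B,δ} = sup_{x∈B^d} a_κ^B ∫_{B^d} |K_n^δ(W_κ^B;x,y)| W_κ^B(y) dy`. -/
noncomputable def cesaroNormB (d : ℕ) (κ : Fin (d + 1) → ℝ) (δ : ℝ) (n : ℕ) : ℝ :=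
  ⨆ x : Metric.closedBall (0 : EuclideanSpace ℝ (Fin d)) 1,
    (∫ y in Metric.closedBall (0 : EuclideanSpace ℝ (Fin d)) 1, WB d κ y)⁻¹ *
      ∫ y in Metric.closedBall (0 : EuclideanSpace ℝ (Fin d)) 1, |ballK d κ δ n x y| * WB d κ y

theorem genBinom_zero (x : ℝ) : genBinom x 0 = 1 := by simp [genBinom]

theorem succ_mul_genBinom_succ (x : ℝ) (k : ℕ) :
    ((k : ℝ) + 1) * genBinom x (k + 1) = (x - k) * genBinom x k := by
  unfold genBinom
  rw [Finset.prod_range_succ, Nat.factorial_succ]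
  push_cast
  field_simp

theorem poch_zero (a : ℝ) : poch a 0 = 1 := by simp [poch]

theorem poch_succ (a : ℝ) (n : ℕ) : poch a (n + 1) = poch a n * (a + n) := by
  simp [poch, Finset.prod_range_succ]

theorem poch_succ' (a : ℝ) (n : ℕ) : poch a (n + 1) = a * poch (a + 1) n := by
  simp only [poch, Finset.prod_range_succ']
  push_cast
  rw [mul_comm]
  congr 1
  · ring
  · exact Finset.prod_congr rfl fun i _ => by ring

theorem poch_pos {a : ℝ} (ha : 0 < a) (n : ℕ) : 0 < poch a n :=
  Finset.prod_pos fun i _ => by positivity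

theorem poch_nonneg {a : ℝ} (ha : 0 ≤ a) (n : ℕ) : 0 ≤ poch a n :=
  Finset.prod_nonneg fun i _ => by positivity

theorem genBinom_eq_poch (x : ℝ) (n : ℕ) :
    genBinom (n + x) n = poch (x + 1) n / (Nat.factorial n) := by
  unfold genBinom poch
  congr 1
  rw [← Finset.prod_range_reflect]
  refine Finset.prod_congr rfl fun i hi => ?_
  have hi' := Finset.mem_range.1 hi
  have : ((n - 1 - i : ℕ) : ℝ) = n - 1 - i := by
    rw [Nat.sub_sub, Nat.cast_sub (by omega)]; push_cast; ring
  rw [this]; ring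

theorem cesA_eq_poch (δ : ℝ) (n : ℕ) : cesA δ n = poch (δ + 1) n / (Nat.factorial n) :=
  genBinom_eq_poch δ n

theorem hasDerivAt_jacobiP (n : ℕ) (a b t : ℝ) :
    HasDerivAt (jacobiP (n + 1) a b)
      ((n + a + b + 2) / 2 * jacobiP n (a + 1) (b + 1) t) t := by
  have hx : HasDerivAt (fun t : ℝ => (t - 1) / 2) (1 / 2) t :=
    ((hasDerivAt_id t).sub_const 1).div_const 2
  have hy : HasDerivAt (fun t : ℝ => (t + 1) / 2) (1 / 2) t :=
    ((hasDerivAt_id t).add_const 1).div_const 2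
  set x := (t - 1) / 2
  set y := (t + 1) / 2
  set c : ℕ → ℝ := fun m =>
    genBinom ((n + 1 : ℕ) + a) (n + 1 - m) * genBinom ((n + 1 : ℕ) + b) m with hc
  have h1 : HasDerivAt (jacobiP (n + 1) a b)
      (∑ m ∈ Finset.range (n + 1 + 1),
        (c m * (m * x ^ (m - 1) * (1 / 2)) * y ^ (n + 1 - m) +
          c m * x ^ m * (((n + 1 - m : ℕ) : ℝ) * y ^ (n + 1 - m - 1) * (1 / 2)))) t := by
    unfold jacobiP
    refine HasDerivAt.fun_sum fun m _ => ?_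
    exact ((hx.fun_pow m).const_mul (c m)).mul (hy.fun_pow (n + 1 - m))
  refine h1.congr_deriv (Eq.symm ?_)
  rw [Finset.sum_add_distrib, Finset.sum_range_succ', Finset.sum_range_succ _ (n + 1)]
  simp only [Nat.sub_self, Nat.cast_zero, zero_mul, mul_zero, add_zero]
  rw [← Finset.sum_add_distrib, jacobiP, Finset.mul_sum]
  refine Finset.sum_congr rfl fun m hm => ?_
  have hm' : m ≤ n := Nat.lt_succ_iff.1 (Finset.mem_range.1 hm)
  obtain ⟨k, rfl⟩ := Nat.exists_eq_add_of_le hm'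
  have e1 : m + k + 1 - (m + 1) = k := by omega
  have e2 : m + k + 1 - m = k + 1 := by omega
  have e3 : m + k - m = k := by omega
  simp only [hc, e1, e2, e3, Nat.add_sub_cancel]
  have i1 := succ_mul_genBinom_succ (((m + k + 1 : ℕ) : ℝ) + b) m
  have i2 := succ_mul_genBinom_succ (((m + k + 1 : ℕ) : ℝ) + a) k
  push_cast at i1 i2 ⊢
  have j1 : (m : ℝ) + k + (a + 1) = m + k + 1 + a := by ring
  have j2 : (m : ℝ) + k + (b + 1) = m + k + 1 + b := by ring
  rw [j1, j2]
  set B1 := genBinom ((m : ℝ) + k + 1 + b) m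
  set B2 := genBinom ((m : ℝ) + k + 1 + b) (m + 1)
  set D1 := genBinom ((m : ℝ) + k + 1 + a) k
  set D2 := genBinom ((m : ℝ) + k + 1 + a) (k + 1)
  linear_combination (-(x ^ m * y ^ k) * D1 / 2) * i1 - (x ^ m * y ^ k) * B1 / 2 * i2

theorem hasDerivAt_gegenC (n : ℕ) {l : ℝ} (hl : 0 < l) (t : ℝ) :
    HasDerivAt (gegenC (n + 1) l) (2 * l * gegenC n (l + 1) t) t := by
  have h := (hasDerivAt_jacobiP n (l - 1 / 2) (l - 1 / 2) t).const_mul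
    (poch (2 * l) (n + 1) / poch (l + 1 / 2) (n + 1))
  refine h.congr_deriv ?_
  unfold gegenC
  have e : l + 1 - 1 / 2 = l - 1 / 2 + 1 := by ring
  have e2 : 2 * (l + 1) = 2 * l + 1 + 1 := by ring
  have e3 : l + 1 + 1 / 2 = l + 1 / 2 + 1 := by ring
  rw [e, e2, e3, poch_succ' (l + 1 / 2)]
  have hp : poch (2 * l) (n + 1 + 1) = 2 * l * ((2 * l + 1) * poch (2 * l + 1 + 1) n) := by
    rw [poch_succ', poch_succ']
  have hq := poch_succ (2 * l) (n + 1)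
  rw [hp] at hq
  have h1 := poch_pos (show 0 < l + 1 / 2 + 1 by linarith) n
  have h2 : l + 1 / 2 ≠ 0 := by positivity
  push_cast at hq
  generalize jacobiP n (l - 1 / 2 + 1) (l - 1 / 2 + 1) t = J at *
  generalize poch (l + 1 / 2 + 1) n = p at *
  field_simp
  linear_combination (-(2 * J)) * hq

theorem gegenC_one (n : ℕ) {l : ℝ} (hl : 0 < l) :
    gegenC n l 1 = poch (2 * l) n / (Nat.factorial n) := by
  unfold gegenC jacobiP
  rw [Finset.sum_range_succ', Finset.sum_eq_zero]
  · have := genBinom_eq_poch (l - 1 / 2) n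
    have h1 := poch_pos (show 0 < l + 1 / 2 by linarith) n
    rw [show l - 1 / 2 + 1 = l + 1 / 2 by ring] at this
    simp only [Nat.sub_zero, genBinom_zero, this]
    rw [sub_self, zero_div, pow_zero, show ((1 : ℝ) + 1) / 2 = 1 by norm_num, one_pow]
    generalize poch (l + 1 / 2) n = p at *
    field_simp
    ring
  · intro m _
    simp

theorem gegenC_zero (l t : ℝ) : gegenC 0 l t = 1 := by
  simp [gegenC, jacobiP, poch_zero, genBinom_zero]

theorem gegenC_one_left {l : ℝ} (hl : 0 < l) (t : ℝ) : gegenC 1 l t = 2 * l * t := by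
  simp [gegenC, jacobiP, poch, genBinom, Finset.sum_range_succ]
  field_simp
  ring

theorem eq_of_hasDerivAt_of_eq {f g f' : ℝ → ℝ} (hf : ∀ t, HasDerivAt f (f' t) t)
    (hg : ∀ t, HasDerivAt g (f' t) t) {c : ℝ} (h : f c = g c) : f = g := by
  have h0 : ∀ t, HasDerivAt (fun t => f t - g t) 0 t := fun t =>
    ((hf t).fun_sub (hg t)).congr_deriv (sub_self _)
  funext t
  have := is_const_of_deriv_eq_zero (fun t => (h0 t).differentiableAt)
    (fun t => (h0 t).deriv) t c
  simp only [h, sub_self] at this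
  linarith

/-- `(n+2+λ) C_{n+2}^λ = λ (C_{n+2}^{λ+1} - C_n^{λ+1})`. -/
theorem gegenC_succ_order (n : ℕ) {l : ℝ} (hl : 0 < l) (t : ℝ) :
    (n + 2 + l) * gegenC (n + 2) l t = l * (gegenC (n + 2) (l + 1) t - gegenC n (l + 1) t) := by
  have hval : ∀ n : ℕ, (n + 2 + l) * gegenC (n + 2) l 1 =
      l * (gegenC (n + 2) (l + 1) 1 - gegenC n (l + 1) 1) := by
    intro n
    rw [gegenC_one _ hl, gegenC_one _ (by linarith), gegenC_one _ (by linarith)]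
    rw [poch_succ' (2 * l), poch_succ' (2 * l + 1), poch_succ (2 * (l + 1)) (n + 1),
      poch_succ (2 * (l + 1)) n, show 2 * l + 1 + 1 = 2 * (l + 1) by ring, Nat.factorial_succ,
      Nat.factorial_succ]
    push_cast
    field_simp
    ring
  induction n generalizing l t with
  | zero =>
    refine congrFun (eq_of_hasDerivAt_of_eq (c := 1)
      (fun t => (hasDerivAt_gegenC 1 hl t).const_mul _) (f' := _)
      (g := fun t => l * (gegenC 2 (l + 1) t - gegenC 0 (l + 1) t)) (fun t => ?_)
      (by simpa using hval 0)) t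
    have h1 := ((hasDerivAt_gegenC 1 (l := l + 1) (by linarith) t).sub
        (hasDerivAt_const t (1 : ℝ))).const_mul l
    simp only [gegenC_zero]
    refine h1.congr_deriv ?_
    rw [gegenC_one_left (by linarith), gegenC_one_left (by linarith)]
    push_cast; ring
  | succ n ih =>
    refine congrFun (eq_of_hasDerivAt_of_eq (c := 1)
      (fun t => (hasDerivAt_gegenC (n + 2) hl t).const_mul _) (f' := _)
      (g := fun t => l * (gegenC (n + 3) (l + 1) t - gegenC (n + 1) (l + 1) t))
      (fun t => ?_) (by simpa using hval (n + 1))) t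
    have h1 := ((hasDerivAt_gegenC (n + 2) (l := l + 1) (by linarith) t).sub
      (hasDerivAt_gegenC n (l := l + 1) (by linarith) t)).const_mul l
    refine h1.congr_deriv ?_
    have := ih (l := l + 1) (by linarith) t (fun n => by
      rw [gegenC_one _ (by linarith), gegenC_one _ (by linarith), gegenC_one _ (by linarith)]
      rw [poch_succ' (2 * (l + 1)), poch_succ' (2 * (l + 1) + 1),
        poch_succ (2 * (l + 1 + 1)) (n + 1), poch_succ (2 * (l + 1 + 1)) n,
        show 2 * (l + 1) + 1 + 1 = 2 * (l + 1 + 1) by ring, Nat.factorial_succ, Nat.factorial_succ]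
      push_cast
      field_simp
      ring)
    push_cast
    linear_combination (-2 * l) * this

/-- Three-term recurrence of the Gegenbauer polynomials. -/
theorem gegenC_recurrence (n : ℕ) {l : ℝ} (hl : 0 < l) (t : ℝ) :
    (n + 2) * gegenC (n + 2) l t =
      2 * (n + 1 + l) * (t * gegenC (n + 1) l t) - (n + 2 * l) * gegenC n l t := by
  induction n generalizing l t with
  | zero =>
    refine congrFun (eq_of_hasDerivAt_of_eq (c := 1)
      (fun t => (hasDerivAt_gegenC 1 hl t).const_mul _) (f' := _)
      (g := fun t => 2 * ((0 : ℕ) + 1 + l) * (t * gegenC 1 l t) - ((0 : ℕ) + 2 * l) * gegenC 0 l t)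
      (fun t => ?_) ?_) t
    · have h1 := (((hasDerivAt_id t).fun_mul (hasDerivAt_gegenC 0 hl t)).const_mul
        (2 * ((0 : ℕ) + 1 + l))).fun_sub (hasDerivAt_const t ((((0 : ℕ) : ℝ) + 2 * l) * 1))
      simp only [gegenC_zero] at h1 ⊢
      refine h1.congr_deriv ?_
      rw [gegenC_one_left (by linarith), gegenC_one_left (by linarith)]
      simp only [id]
      push_cast; ring
    · simp only [gegenC_zero]
      rw [gegenC_one_left hl, gegenC_one _ hl]
      simp [poch, Finset.prod_range_succ]; ring
  | succ n ih =>
    refine congrFun (eq_of_hasDerivAt_of_eq (c := 1)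
      (fun t => (hasDerivAt_gegenC (n + 2) hl t).const_mul _) (f' := _)
      (g := fun t => 2 * ((n + 1 : ℕ) + 1 + l) * (t * gegenC (n + 2) l t) -
        ((n + 1 : ℕ) + 2 * l) * gegenC (n + 1) l t)
      (fun t => ?_) ?_) t
    · have h1 := (((hasDerivAt_id t).fun_mul (hasDerivAt_gegenC (n + 1) hl t)).const_mul
        (2 * ((n + 1 : ℕ) + 1 + l))).fun_sub
        ((hasDerivAt_gegenC n hl t).const_mul (((n + 1 : ℕ) : ℝ) + 2 * l))
      refine h1.congr_deriv ?_
      have i1 := ih (l := l + 1) (by linarith) t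
      have i2 := gegenC_succ_order n hl t
      simp only [id]
      push_cast
      linear_combination 2 * i2 - 2 * l * i1
    · rw [gegenC_one _ hl, gegenC_one _ hl, gegenC_one _ hl, poch_succ (2 * l) (n + 1 + 1),
        poch_succ (2 * l) (n + 1), Nat.factorial_succ, Nat.factorial_succ]
      push_cast
      field_simp
      ring

/-- The formal power series of `(1 - x X)^{-a}`. -/
noncomputable def binSer (a : ℝ) (x : ℂ) : PowerSeries ℂ :=
  PowerSeries.mk fun n => ((poch a n / (Nat.factorial n) : ℝ) : ℂ) * x ^ n

theorem coeff_binSer (a : ℝ) (x : ℂ) (n : ℕ) :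
    PowerSeries.coeff n (binSer a x) = ((poch a n / (Nat.factorial n) : ℝ) : ℂ) * x ^ n :=
  PowerSeries.coeff_mk _ _

theorem poch_div_factorial_succ (a : ℝ) (n : ℕ) :
    ((n : ℝ) + 1) * (poch a (n + 1) / (Nat.factorial (n + 1))) =
      (a + n) * (poch a n / (Nat.factorial n)) := by
  rw [poch_succ, Nat.factorial_succ]; push_cast; field_simp

theorem derivative_binSer (a : ℝ) (x : ℂ) :
    (1 - PowerSeries.C x * PowerSeries.X) * PowerSeries.derivative ℂ (binSer a x) =
      PowerSeries.C (a * x) * binSer a x := by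
  have key : ∀ n : ℕ, PowerSeries.coeff n (PowerSeries.derivative ℂ (binSer a x)) =
      ((a : ℂ) + n) * (x * PowerSeries.coeff n (binSer a x)) := fun n => by
    have h := congrArg (fun r : ℝ => (r : ℂ)) (poch_div_factorial_succ a n)
    rw [PowerSeries.coeff_derivative, coeff_binSer, coeff_binSer]
    simp only [Complex.ofReal_mul, Complex.ofReal_add, Complex.ofReal_natCast,
      Complex.ofReal_one] at h
    rw [pow_succ]
    linear_combination x ^ n * x * h
  ext n
  rw [sub_mul, one_mul, map_sub, mul_assoc, PowerSeries.coeff_C_mul, PowerSeries.coeff_C_mul, key]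
  cases n with
  | zero => simp [mul_assoc]
  | succ n =>
    rw [PowerSeries.coeff_succ_X_mul, key, coeff_binSer, coeff_binSer]
    have h := congrArg (fun r : ℝ => (r : ℂ)) (poch_div_factorial_succ a n)
    simp only [Complex.ofReal_mul, Complex.ofReal_add, Complex.ofReal_natCast,
      Complex.ofReal_one] at h
    rw [pow_succ]
    push_cast at h ⊢
    linear_combination (x ^ n * x * x) * h

/-- Vandermonde's identity for the coefficients of `(1 - X)^{-a}`. -/
theorem sum_poch_mul_poch (a b : ℝ) (n : ℕ) :
    ∑ p ∈ HasAntidiagonal.antidiagonal n,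
      (poch a p.1 / (Nat.factorial p.1)) * (poch b p.2 / (Nat.factorial p.2)) =
      poch (a + b) n / (Nat.factorial n) := by
  have hprod : ∀ n : ℕ, PowerSeries.coeff n (binSer a 1 * binSer b 1) =
      ((∑ p ∈ HasAntidiagonal.antidiagonal n, (poch a p.1 / (Nat.factorial p.1)) *
        (poch b p.2 / (Nat.factorial p.2)) : ℝ) : ℂ) := fun n => by
    rw [PowerSeries.coeff_mul]
    simp [coeff_binSer]
  have hder : (1 - PowerSeries.X) * PowerSeries.derivative ℂ (binSer a 1 * binSer b 1) =
      PowerSeries.C ((a + b : ℝ) : ℂ) * (binSer a 1 * binSer b 1) := by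
    have h1 := derivative_binSer a 1
    have h2 := derivative_binSer b 1
    simp only [map_one, one_mul, mul_one] at h1 h2
    rw [Derivation.leibniz, smul_eq_mul, smul_eq_mul, Complex.ofReal_add, map_add]
    linear_combination (binSer a 1) * h2 + (binSer b 1) * h1
  set F := binSer a 1 * binSer b 1
  have hrec : ∀ n : ℕ, (n + 1 : ℂ) * PowerSeries.coeff (n + 1) F =
      ((a + b : ℝ) + n) * PowerSeries.coeff n F := fun n => by
    have h := congrArg (PowerSeries.coeff n) hder
    rw [sub_mul, one_mul, map_sub, PowerSeries.coeff_C_mul, PowerSeries.coeff_derivative] at h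
    cases n with
    | zero => simp at h ⊢; linear_combination h
    | succ n =>
      rw [PowerSeries.coeff_succ_X_mul, PowerSeries.coeff_derivative] at h
      push_cast at h ⊢
      linear_combination h
  have : PowerSeries.coeff n F = ((poch (a + b) n / (Nat.factorial n) : ℝ) : ℂ) := by
    induction n with
    | zero => rw [hprod]; simp [poch_zero]
    | succ n ih =>
      have h := hrec n
      rw [ih] at h
      have h' := congrArg (fun r : ℝ => (r : ℂ)) (poch_div_factorial_succ (a + b) n)
      simp only [Complex.ofReal_mul, Complex.ofReal_add, Complex.ofReal_natCast,
        Complex.ofReal_one] at h' h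
      have hn : (n + 1 : ℂ) ≠ 0 := by exact_mod_cast Nat.succ_ne_zero n
      exact mul_left_cancel₀ hn (h.trans h'.symm)
  rw [hprod] at this
  exact_mod_cast this

/-- Generating function of the Gegenbauer polynomials, as a product of two binomial series. -/
theorem coeff_binSer_mul_binSer {l : ℝ} (hl : 0 < l) {x y : ℂ} {u : ℝ}
    (hxy : x * y = 1) (hu : x + y = 2 * (u : ℂ)) (n : ℕ) :
    PowerSeries.coeff n (binSer l x * binSer l y) = (gegenC n l u : ℂ) := by
  have hder : (1 - PowerSeries.C (2 * (u : ℂ)) * PowerSeries.X + PowerSeries.X * PowerSeries.X) *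
      PowerSeries.derivative ℂ (binSer l x * binSer l y) =
      (PowerSeries.C (2 * l * u : ℂ) - PowerSeries.C (2 * l : ℂ) * PowerSeries.X) *
        (binSer l x * binSer l y) := by
    have h1 := derivative_binSer l x
    have h2 := derivative_binSer l y
    have e1 : PowerSeries.C (2 * (u : ℂ)) = PowerSeries.C x + PowerSeries.C y := by
      rw [← hu, map_add]
    have e2 : PowerSeries.C (2 * l * u : ℂ) =
        PowerSeries.C (l : ℂ) * (PowerSeries.C x + PowerSeries.C y) := by
      rw [← e1, ← map_mul]; ring_nf
    have e3 : PowerSeries.C x * PowerSeries.C y = 1 := by rw [← map_mul, hxy, map_one]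
    have e4 : PowerSeries.C (2 * l : ℂ) = 2 * PowerSeries.C (l : ℂ) := by
      rw [map_mul, show (2 : ℂ) = ((2 : ℕ) : ℂ) by norm_num, map_natCast]; norm_num
    rw [Derivation.leibniz, smul_eq_mul, smul_eq_mul, e1, e2, e4]
    rw [map_mul] at h1 h2
    set a := PowerSeries.C x
    set b := PowerSeries.C y
    set L := PowerSeries.C (l : ℂ)
    set A := binSer l x
    set B := binSer l y
    set A' := PowerSeries.derivative ℂ A
    set B' := PowerSeries.derivative ℂ B
    linear_combination (A * (1 - a * PowerSeries.X)) * h2 + (B * (1 - b * PowerSeries.X)) * h1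
      - ((A * B' + B * A') * PowerSeries.X * PowerSeries.X + 2 * L * A * B * PowerSeries.X) * e3
  set F := binSer l x * binSer l y with hF
  have hrec : ∀ n : ℕ, (n + 2 : ℂ) * PowerSeries.coeff (n + 2) F =
      2 * (n + 1 + l) * (u * PowerSeries.coeff (n + 1) F) -
        (n + 2 * l) * PowerSeries.coeff n F := fun n => by
    have h := congrArg (PowerSeries.coeff (n + 1)) hder
    rw [add_mul, sub_mul, sub_mul, one_mul, mul_assoc, mul_assoc, mul_assoc (PowerSeries.C (2 *
      l : ℂ)), map_add, map_sub,
      map_sub, PowerSeries.coeff_C_mul, PowerSeries.coeff_C_mul, PowerSeries.coeff_C_mul,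
      PowerSeries.coeff_succ_X_mul, PowerSeries.coeff_succ_X_mul, PowerSeries.coeff_succ_X_mul,
      PowerSeries.coeff_derivative, PowerSeries.coeff_derivative] at h
    cases n with
    | zero => simp at h ⊢; linear_combination h
    | succ n =>
      rw [PowerSeries.coeff_succ_X_mul, PowerSeries.coeff_derivative] at h
      push_cast at h ⊢
      linear_combination h
  have h0 : PowerSeries.coeff 0 F = 1 := by
    rw [hF, PowerSeries.coeff_mul]; simp [coeff_binSer, poch_zero]
  have h1 : PowerSeries.coeff 1 F = 2 * l * u := by
    rw [hF, PowerSeries.coeff_mul, Finset.Nat.antidiagonal_succ]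
    simp [coeff_binSer, poch]
    linear_combination l * hu
  induction n using Nat.twoStepInduction with
  | zero => rw [h0, gegenC_zero]; simp
  | one => rw [h1, gegenC_one_left hl]; push_cast; ring
  | more n i1 i2 =>
    have h := hrec n
    rw [i1, i2] at h
    have h' := congrArg (fun r : ℝ => (r : ℂ)) (gegenC_recurrence n hl u)
    push_cast at h'
    have hn : (n + 2 : ℂ) ≠ 0 := by exact_mod_cast Nat.succ_ne_zero (n + 1)
    exact mul_left_cancel₀ hn (h.trans h'.symm)

/-- Fourier expansion of the Gegenbauer polynomials. -/
theorem gegenC_cos {l : ℝ} (hl : 0 < l) (n : ℕ) (θ : ℝ) :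
    gegenC n l (cos θ) = ∑ p ∈ HasAntidiagonal.antidiagonal n,
      (poch l p.1 / (Nat.factorial p.1)) * (poch l p.2 / (Nat.factorial p.2)) *
        cos (((p.1 : ℝ) - p.2) * θ) := by
  have hxy : Complex.exp (θ * Complex.I) * Complex.exp (-θ * Complex.I) = 1 := by
    rw [← Complex.exp_add]; simp
  have hu : Complex.exp (θ * Complex.I) + Complex.exp (-θ * Complex.I) = 2 * ((cos θ : ℝ) : ℂ) := by
    rw [Complex.ofReal_cos, Complex.cos]; ring
  have h := congrArg Complex.re (coeff_binSer_mul_binSer hl hxy hu n)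
  rw [Complex.ofReal_re, PowerSeries.coeff_mul, Complex.re_sum] at h
  rw [← h]
  refine Finset.sum_congr rfl fun p _ => ?_
  rw [coeff_binSer, coeff_binSer, ← Complex.exp_nat_mul, ← Complex.exp_nat_mul,
    mul_mul_mul_comm, ← Complex.exp_add, ← Complex.ofReal_mul, Complex.re_ofReal_mul]
  congr 1
  rw [show (p.1 : ℂ) * (θ * Complex.I) + p.2 * (-θ * Complex.I) =
    ((((p.1 : ℝ) - p.2) * θ : ℝ) : ℂ) * Complex.I by push_cast; ring, Complex.exp_ofReal_mul_I_re]

theorem Complex.ringChoose_eq_poch (a : ℝ) (n : ℕ) :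
    Ring.choose ((a : ℂ) + n - 1) n = ((poch a n / (Nat.factorial n) : ℝ) : ℂ) := by
  have : (a : ℂ) + n - 1 = ((a + n - 1 : ℝ) : ℂ) := by push_cast; ring
  rw [this, ← Complex.ofReal_choose, ← Ring.multichoose_eq]
  congr 1
  have h := Ring.factorial_nsmul_multichoose_eq_ascPochhammer a n
  rw [nsmul_eq_mul] at h
  rw [eq_div_iff (by positivity), mul_comm, h]
  clear h
  induction n with
  | zero => simp [poch_zero]
  | succ n ih =>
    rw [Polynomial.ascPochhammer_smeval_eq_eval] at ih ⊢
    rw [poch_succ, ← ih (by push_cast; ring), ascPochhammer_succ_right]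
    simp

theorem hasSum_one_sub_cpow (a : ℝ) {w : ℂ} (hw : ‖w‖ < 1) :
    HasSum (fun n => ((poch a n / (Nat.factorial n) : ℝ) : ℂ) * w ^ n) ((1 - w) ^ (-a : ℂ)) ∧
    Summable (fun n => ‖((poch a n / (Nat.factorial n) : ℝ) : ℂ) * w ^ n‖) := by
  have h := Complex.one_div_one_sub_cpow_hasFPowerSeriesOnBall_zero (a : ℂ)
  have hw' : w ∈ Metric.eball (0 : ℂ) 1 := by simpa [Metric.mem_eball, edist_eq_enorm_sub,
      enorm] using mod_cast hw
  have hs := h.hasSum hw'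
  have hn := FormalMultilinearSeries.summable_norm_apply _ (Metric.eball_subset_eball h.r_le hw')
  simp only [FormalMultilinearSeries.ofScalars_apply_eq, smul_eq_mul,
    Complex.ringChoose_eq_poch, zero_add] at hs hn
  refine ⟨?_, hn⟩
  rw [Complex.cpow_neg, ← one_div]
  exact hs

/-- The kernel `∑ A_{n-k}^δ (k+l)/l C_k^l(u)`. -/
noncomputable def qker (l δ : ℝ) (n : ℕ) (u : ℝ) : ℝ :=
  ∑ k ∈ Finset.range (n + 1), cesA δ (n - k) * (((k : ℝ) + l) / l * gegenC k l u)

theorem mk_gegenC_eq {l : ℝ} (hl : 0 < l) {x y : ℂ} {u : ℝ}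
    (hxy : x * y = 1) (hu : x + y = 2 * (u : ℂ)) :
    PowerSeries.mk (fun k => ((((k : ℝ) + l) / l * gegenC k l u : ℝ) : ℂ)) =
      (1 - PowerSeries.X ^ 2) * (binSer (l + 1) x * binSer (l + 1) y) := by
  have hl1 : 0 < l + 1 := by linarith
  ext n
  rw [sub_mul, one_mul, map_sub, coeff_binSer_mul_binSer hl1 hxy hu, PowerSeries.coeff_mk]
  match n with
  | 0 =>
    rw [PowerSeries.coeff_X_pow_mul']
    simp [gegenC_zero, hl.ne']
  | 1 =>
    rw [PowerSeries.coeff_X_pow_mul']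
    simp only [gegenC_one_left hl, gegenC_one_left hl1]
    norm_num
    have : (l : ℂ) ≠ 0 := by exact_mod_cast hl.ne'
    field_simp
    ring
  | n + 2 =>
    rw [PowerSeries.coeff_X_pow_mul, coeff_binSer_mul_binSer hl1 hxy hu]
    rw [← Complex.ofReal_sub]
    congr 1
    have := gegenC_succ_order n hl u
    push_cast
    rw [div_mul_eq_mul_div, this]
    field_simp

theorem one_sub_X_mul_binSer (δ : ℝ) :
    (1 - PowerSeries.X) * binSer (δ + 1) 1 = binSer δ 1 := by
  ext n
  rw [sub_mul, one_mul, map_sub]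
  cases n with
  | zero => simp [coeff_binSer, poch_zero]
  | succ n =>
    rw [PowerSeries.coeff_succ_X_mul]
    simp only [coeff_binSer, one_pow, mul_one]
    rw [← Complex.ofReal_sub]
    congr 1
    rw [poch_succ, poch_succ' δ, Nat.factorial_succ]
    push_cast
    field_simp
    ring

theorem qker_eq_coeff {l : ℝ} (hl : 0 < l) (δ : ℝ) {x y : ℂ} {u : ℝ}
    (hxy : x * y = 1) (hu : x + y = 2 * (u : ℂ)) (n : ℕ) :
    (qker l δ n u : ℂ) = PowerSeries.coeff n
      ((1 + PowerSeries.X) * (binSer δ 1 * (binSer (l + 1) x * binSer (l + 1) y))) := by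
  have h1 : (1 + PowerSeries.X) * (binSer δ 1 * (binSer (l + 1) x * binSer (l + 1) y)) =
      PowerSeries.mk (fun k => ((((k : ℝ) + l) / l * gegenC k l u : ℝ) : ℂ)) *
        binSer (δ + 1) 1 := by
    rw [mk_gegenC_eq hl hxy hu, ← one_sub_X_mul_binSer]; ring
  rw [h1, PowerSeries.coeff_mul, Finset.Nat.sum_antidiagonal_eq_sum_range_succ_mk, qker]
  push_cast
  refine Finset.sum_congr rfl fun k _ => ?_
  simp only [PowerSeries.coeff_mk, coeff_binSer, cesA_eq_poch]
  push_cast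
  ring

/-- `F` converges absolutely on the circle of radius `r`, with sum `g`. -/
def HasGen (F : PowerSeries ℂ) (g : ℂ → ℂ) (r : ℝ) : Prop :=
  ∀ z : ℂ, ‖z‖ = r → Summable (fun n => ‖PowerSeries.coeff n F * z ^ n‖) ∧
    HasSum (fun n => PowerSeries.coeff n F * z ^ n) (g z)

theorem HasGen.mul {F G : PowerSeries ℂ} {f g : ℂ → ℂ} {r : ℝ}
    (hF : HasGen F f r) (hG : HasGen G g r) : HasGen (F * G) (fun z => f z * g z) r := by
  intro z hz
  obtain ⟨sF, tF⟩ := hF z hz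
  obtain ⟨sG, tG⟩ := hG z hz
  have e : ∀ n, PowerSeries.coeff n (F * G) * z ^ n = ∑ p ∈ HasAntidiagonal.antidiagonal n,
      (PowerSeries.coeff p.1 F * z ^ p.1) * (PowerSeries.coeff p.2 G * z ^ p.2) := by
    intro n
    rw [PowerSeries.coeff_mul, Finset.sum_mul]
    refine Finset.sum_congr rfl fun p hp => ?_
    rw [← HasAntidiagonal.mem_antidiagonal.1 hp, pow_add]; ring
  have s := summable_norm_sum_mul_antidiagonal_of_summable_norm sF sG
  have t := tsum_mul_tsum_eq_tsum_sum_antidiagonal_of_summable_norm sF sG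
  simp only [← e] at s t
  refine ⟨s, ?_⟩
  rw [tF.tsum_eq, tG.tsum_eq] at t
  show HasSum _ (f z * g z)
  rw [t]
  exact s.of_norm.hasSum

theorem hasGen_binSer (a : ℝ) {x : ℂ} {r : ℝ} (hx : ‖x‖ = 1) (hr : r < 1) :
    HasGen (binSer a x) (fun z => (1 - x * z) ^ (-a : ℂ)) r := by
  intro z hz
  have h := hasSum_one_sub_cpow a (w := x * z) (by simpa [hx, hz] using hr)
  simp only [coeff_binSer]
  simp only [mul_pow, ← mul_assoc] at h
  exact ⟨h.2, h.1⟩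

theorem hasGen_one_add_X (r : ℝ) : HasGen (1 + PowerSeries.X) (fun z => 1 + z) r := by
  intro z _
  have h0 : ∀ n ∉ Finset.range 2, PowerSeries.coeff n (1 + PowerSeries.X : PowerSeries ℂ) = 0 := by
    intro n hn
    simp only [Finset.mem_range, not_lt] at hn
    simp [PowerSeries.coeff_one, PowerSeries.coeff_X, show n ≠ 0 by lia, show n ≠ 1 by lia]
  have h1 : ∀ n ∉ Finset.range 2,
      PowerSeries.coeff n (1 + PowerSeries.X : PowerSeries ℂ) * z ^ n = 0 :=
    fun n hn => by rw [h0 n hn, zero_mul]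
  constructor
  · have h2 : HasSum (fun n => ‖PowerSeries.coeff n (1 + PowerSeries.X : PowerSeries ℂ) * z ^ n‖)
        _ := hasSum_sum_of_ne_finset_zero (s := Finset.range 2) fun n hn => by rw [h1 n hn,
          norm_zero]
    exact h2.summable
  · have h2 : HasSum (fun n => PowerSeries.coeff n (1 + PowerSeries.X : PowerSeries ℂ) * z ^ n)
        _ := hasSum_sum_of_ne_finset_zero (s := Finset.range 2) h1
    convert h2 using 1
    simp [Finset.sum_range_succ, PowerSeries.coeff_one, PowerSeries.coeff_X]

/-- The point `r e^{-iφ}`. -/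
noncomputable def zc (r φ : ℝ) : ℂ := r * Complex.exp (-(φ * Complex.I))

theorem norm_zc {r : ℝ} (hr : 0 ≤ r) (φ : ℝ) : ‖zc r φ‖ = r := by
  have : -((φ : ℂ) * Complex.I) = ((-φ : ℝ) : ℂ) * Complex.I := by push_cast; ring
  rw [zc, norm_mul, this, Complex.norm_exp_ofReal_mul_I, Complex.norm_real, norm_of_nonneg hr,
    mul_one]

theorem continuous_zc (r : ℝ) : Continuous (zc r) := by unfold zc; fun_prop

theorem zc_ne_zero {r : ℝ} (hr : 0 < r) (φ : ℝ) : zc r φ ≠ 0 := by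
  rw [← norm_pos_iff, norm_zc hr.le]; exact hr

theorem zc_neg (r φ : ℝ) : zc r (-φ) = (starRingEnd ℂ) (zc r φ) := by
  simp [zc, ← Complex.exp_conj]

theorem integral_exp_int (k : ℤ) :
    ∫ φ in Set.Ioc (-π) π, Complex.exp (k * (φ * Complex.I)) = if k = 0 then (2 * π : ℂ) else 0 :=
        by
  rw [← intervalIntegral.integral_of_le (by linarith [pi_pos])]
  split_ifs with h
  · simp [h]; ring
  · have hk : (k : ℂ) * Complex.I ≠ 0 := by simp [h]
    have := integral_exp_mul_complex (a := -π) (b := π) hk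
    have e : ∀ φ : ℝ, (k : ℂ) * (φ * Complex.I) = k * Complex.I * φ := fun φ => by ring
    simp only [e]
    rw [this]
    have e2 : Complex.exp (k * Complex.I * (π : ℝ)) = Complex.exp (k * Complex.I * (-π : ℝ)) := by
      rw [Complex.exp_eq_exp_iff_exists_int]
      exact ⟨k, by push_cast; ring⟩
    simp [e2]

theorem HasGen.integral_eq {F : PowerSeries ℂ} {g : ℂ → ℂ} {r : ℝ} (h : HasGen F g r)
    (hr : 0 < r) (n : ℕ) :
    ∫ φ in Set.Ioc (-π) π, g (zc r φ) * (zc r φ)⁻¹ ^ n = 2 * π * PowerSeries.coeff n F := by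
  have hn : ∀ φ, ‖zc r φ‖ = r := norm_zc hr.le
  have key := hasSum_integral_of_summable_integral_norm (μ := volume.restrict (Set.Ioc (-π) π))
    (F := fun m φ => PowerSeries.coeff m F * zc r φ ^ m * (zc r φ)⁻¹ ^ n) (fun m => ?_) ?_
  · have e : ∀ m : ℕ, ∫ φ in Set.Ioc (-π) π, PowerSeries.coeff m F * zc r φ ^ m * (zc r φ)⁻¹ ^ n =
        if m = n then 2 * π * PowerSeries.coeff n F else 0 := by
      intro m
      have : ∀ φ, PowerSeries.coeff m F * zc r φ ^ m * (zc r φ)⁻¹ ^ n =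
          (PowerSeries.coeff m F * (r : ℂ) ^ m * (r : ℂ)⁻¹ ^ n) *
            Complex.exp (((n - m : ℤ) : ℂ) * (φ * Complex.I)) := by
        intro φ
        rw [zc, mul_inv, ← Complex.exp_neg, mul_pow, mul_pow, ← Complex.exp_nat_mul,
          ← Complex.exp_nat_mul]
        have : Complex.exp (((n - m : ℤ) : ℂ) * (φ * Complex.I)) =
          Complex.exp (m * -(φ * Complex.I)) * Complex.exp (n * -(-(φ * Complex.I))) := by
          rw [← Complex.exp_add]; congr 1; push_cast; ring
        rw [this]; ring
      simp only [this]
      rw [integral_const_mul, integral_exp_int]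
      by_cases hmn : m = n
      · subst hmn
        have : (r : ℂ) ≠ 0 := by exact_mod_cast hr.ne'
        simp; field_simp
      · rw [if_neg (by lia), if_neg hmn, mul_zero]
    simp only [e] at key
    have e3 : ∀ φ, ∑' m, PowerSeries.coeff m F * zc r φ ^ m * (zc r φ)⁻¹ ^ n =
        g (zc r φ) * (zc r φ)⁻¹ ^ n := by
      intro φ
      rw [tsum_mul_right, (h _ (hn φ)).2.tsum_eq]
    simp only [e3] at key
    rw [← key.tsum_eq, tsum_ite_eq]
  · refine Continuous.integrableOn_Ioc ?_
    have := continuous_zc r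
    have h0 := zc_ne_zero hr
    fun_prop (disch := simpa using h0)
  · have : ∀ m φ, ‖PowerSeries.coeff m F * zc r φ ^ m * (zc r φ)⁻¹ ^ n‖ =
        ‖PowerSeries.coeff m F‖ * r ^ m * r⁻¹ ^ n := by
      intro m φ; simp [hn]
    simp only [this]
    have s := (h (zc r 0) (hn 0)).1
    simp only [norm_mul, norm_pow, hn] at s
    simpa using (s.mul_right (r⁻¹ ^ n)).mul_left _

/-- The image of `zc r φ` under the Joukowski map. -/
noncomputable def zA (r φ : ℝ) : ℂ := (zc r φ + (zc r φ)⁻¹) / 2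

theorem zc_eq (r φ : ℝ) : zc r φ = ((r * cos φ : ℝ) : ℂ) - ((r * sin φ : ℝ) : ℂ) * Complex.I := by
  have : -((φ : ℂ) * Complex.I) = ((-φ : ℝ) : ℂ) * Complex.I := by push_cast; ring
  rw [zc, this, Complex.exp_mul_I, ← Complex.ofReal_cos, ← Complex.ofReal_sin]
  push_cast
  simp; ring

theorem zc_inv_eq (r φ : ℝ) :
    (zc r φ)⁻¹ = ((r⁻¹ * cos φ : ℝ) : ℂ) + ((r⁻¹ * sin φ : ℝ) : ℂ) * Complex.I := by
  rw [zc, mul_inv, ← Complex.exp_neg, neg_neg, Complex.exp_mul_I, ← Complex.ofReal_cos,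
    ← Complex.ofReal_sin]
  push_cast
  ring

theorem zA_im {r φ : ℝ} : (zA r φ).im = (r⁻¹ - r) * sin φ / 2 := by
  have : (2 : ℂ) = ((2 : ℝ) : ℂ) := by norm_num
  rw [zA, zc_inv_eq, zc_eq, this, Complex.div_ofReal_im]
  simp [Complex.sin_ofReal_re, Complex.cos_ofReal_re]; ring

theorem zA_im_pos {r φ : ℝ} (hr : 0 < r) (hr1 : r < 1) (hφ : φ ∈ Set.Ioo 0 π) :
    0 < (zA r φ).im := by
  rw [zA_im]
  have h1 : r < r⁻¹ := hr1.trans ((one_lt_inv₀ hr).2 hr1)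
  have := sin_pos_of_mem_Ioo hφ
  have : 0 < (r⁻¹ - r) := by linarith
  positivity

/-- The boundary factor `(1 - e^{iθ}z)^{-a}(1 - e^{-iθ}z)^{-a}` with `u = cos θ`. -/
noncomputable def genH (a u : ℝ) (z : ℂ) : ℂ :=
  (1 - Complex.exp (arccos u * Complex.I) * z) ^ (-a : ℂ) *
    (1 - Complex.exp (-(arccos u * Complex.I)) * z) ^ (-a : ℂ)

theorem norm_exp_arccos (u : ℝ) : ‖Complex.exp (arccos u * Complex.I)‖ = 1 ∧
    ‖Complex.exp (-(arccos u * Complex.I))‖ = 1 := by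
  have : -((arccos u : ℂ) * Complex.I) = ((-arccos u : ℝ) : ℂ) * Complex.I := by push_cast; ring
  exact ⟨Complex.norm_exp_ofReal_mul_I _, by rw [this, Complex.norm_exp_ofReal_mul_I]⟩

theorem exp_arccos_add {u : ℝ} (hu : u ∈ Set.Icc (-1) 1) :
    Complex.exp (arccos u * Complex.I) + Complex.exp (-(arccos u * Complex.I)) = 2 * (u : ℂ) := by
  have := Complex.two_cos (arccos u : ℂ)
  rw [← Complex.ofReal_cos, cos_arccos hu.1 hu.2, neg_mul] at this
  exact this.symm

theorem exp_arccos_mul (u : ℝ) :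
    Complex.exp (arccos u * Complex.I) * Complex.exp (-(arccos u * Complex.I)) = 1 := by
  rw [← Complex.exp_add]; simp

theorem one_sub_le_re {x z : ℂ} {r : ℝ} (hx : ‖x‖ = 1) (hz : ‖z‖ = r) :
    1 - r ≤ (1 - x * z).re := by
  have h : (x * z).re ≤ ‖x * z‖ := Complex.re_le_norm _
  rw [norm_mul, hx, hz, one_mul] at h
  simp only [Complex.sub_re, Complex.one_re]
  linarith

theorem qker_eq_integral {l : ℝ} (hl : 0 < l) (δ : ℝ) {u : ℝ} (hu : u ∈ Set.Icc (-1) 1) {r : ℝ}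
    (hr : 0 < r) (hr1 : r < 1) (n : ℕ) :
    2 * π * (qker l δ n u : ℂ) = ∫ φ in Set.Ioc (-π) π,
      ((1 + zc r φ) * (1 - zc r φ) ^ (-δ : ℂ) * (zc r φ)⁻¹ ^ n) * genH (l + 1) u (zc r φ) := by
  rw [qker_eq_coeff hl δ (exp_arccos_mul u) (exp_arccos_add hu)]
  have h := (hasGen_one_add_X r).mul ((hasGen_binSer δ (x := 1) (by simp) hr1).mul
    ((hasGen_binSer (l + 1) (norm_exp_arccos u).1 hr1).mul
      (hasGen_binSer (l + 1) (norm_exp_arccos u).2 hr1)))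
  rw [← h.integral_eq hr n]
  refine integral_congr_ae (ae_of_all _ fun φ => ?_)
  simp only [genH, one_mul]
  ring

theorem norm_cpow_le_of_re {w : ℂ} {s a : ℝ} (hs : 0 < s) (h : s ≤ w.re) (ha : 0 ≤ a) :
    ‖w ^ (-a : ℂ)‖ ≤ s ^ (-a) := by
  rw [← Complex.ofReal_neg, Complex.norm_cpow_real]
  exact rpow_le_rpow_of_nonpos hs (h.trans (Complex.re_le_norm w)) (by linarith)

theorem genH_eq {a u r φ : ℝ} (hu : u ∈ Set.Icc (-1) 1) (hr : 0 < r)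
    (hr1 : r < 1) (hφ : φ ∈ Set.Ioo 0 π) :
    genH a u (zc r φ) = (2 * zc r φ) ^ (-a : ℂ) * (zA r φ - u) ^ (-a : ℂ) := by
  set z := zc r φ with hzd
  have hz := norm_zc hr.le φ
  have hz0 := zc_ne_zero hr φ
  rw [← hzd] at hz hz0
  have mulc : ∀ {x y : ℂ}, x ≠ 0 → y ≠ 0 → x.arg + y.arg ∈ Set.Ioc (-π) π →
      x ^ (-a : ℂ) * y ^ (-a : ℂ) = (x * y) ^ (-a : ℂ) := by
    intro x y hx hy h
    rw [Complex.cpow_def_of_ne_zero hx, Complex.cpow_def_of_ne_zero hy,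
      Complex.cpow_def_of_ne_zero (mul_ne_zero hx hy), (Complex.log_mul_eq_add_log_iff hx hy).2 h,
      ← Complex.exp_add]
    ring_nf
  have r1 := one_sub_le_re (norm_exp_arccos u).1 hz
  have r2 := one_sub_le_re (norm_exp_arccos u).2 hz
  have aux : ∀ {w : ℂ}, 1 - r ≤ w.re → w ≠ 0 ∧ |w.arg| < π / 2 := by
    intro w hw
    have : 0 < w.re := by linarith
    exact ⟨fun h => by simp [h] at this, Complex.abs_arg_lt_pi_div_two_iff.2 (Or.inl this)⟩
  obtain ⟨n1, a1⟩ := aux r1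
  obtain ⟨n2, a2⟩ := aux r2
  rw [abs_lt] at a1 a2
  have him := zA_im_pos hr hr1 hφ
  have hA : (zA r φ - u).im = (zA r φ).im := by simp
  have n3 : zA r φ - u ≠ 0 := fun h => by rw [h] at hA; simp at hA; linarith
  have hzim : (2 * z).im < 0 := by
    have := sin_pos_of_mem_Ioo hφ
    have h2 : (2 * z).im = - (2 * (r * sin φ)) := by
      rw [hzd, zc_eq]; simp [Complex.sin_ofReal_re]
    rw [h2]; have : 0 < r * sin φ := by positivity
    linarith
  have a3 := Complex.arg_neg_iff.2 hzim
  have a4 := Complex.neg_pi_lt_arg (2 * z)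
  have a5 : 0 ≤ (zA r φ - u).arg := Complex.arg_nonneg_iff.2 (by rw [hA]; exact him.le)
  have a6 := Complex.arg_le_pi (zA r φ - u)
  rw [genH, mulc n1 n2 ⟨by linarith, by linarith⟩, mulc (by simpa using hz0) n3
    ⟨by linarith, by linarith⟩]
  congr 1
  have e1 := exp_arccos_add hu
  have e2 := exp_arccos_mul u
  rw [zA, ← hzd]
  field_simp
  linear_combination (-z) * e1 + z ^ 2 * e2

theorem arccos_neg_arg {a u : ℝ} {z : ℂ} {r : ℝ} (hz : ‖z‖ = r) (hr1 : r < 1) :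
    genH a u ((starRingEnd ℂ) z) = (starRingEnd ℂ) (genH a u z) := by
  have aux : ∀ {w : ℂ}, 1 - r ≤ w.re →
      ((starRingEnd ℂ) w) ^ (-a : ℂ) = (starRingEnd ℂ) (w ^ (-a : ℂ)) := by
    intro w hw
    have h2 := Complex.abs_arg_lt_pi_div_two_iff.2 (Or.inl (show 0 < w.re by linarith))
    rw [abs_lt] at h2
    rw [Complex.conj_cpow _ _ (by linarith [pi_pos] : w.arg < π).ne]
    simp
  have r1 := one_sub_le_re (norm_exp_arccos u).1 hz
  have r2 := one_sub_le_re (norm_exp_arccos u).2 hz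
  have e1 : (1 - Complex.exp (arccos u * Complex.I) * (starRingEnd ℂ) z) =
      (starRingEnd ℂ) (1 - Complex.exp (-(arccos u * Complex.I)) * z) := by
    simp [← Complex.exp_conj]
  have e2 : (1 - Complex.exp (-(arccos u * Complex.I)) * (starRingEnd ℂ) z) =
      (starRingEnd ℂ) (1 - Complex.exp (arccos u * Complex.I) * z) := by
    simp [← Complex.exp_conj]
  rw [genH, e1, e2, aux r1, aux r2, genH, map_mul, mul_comm]

theorem genH_zc_bound {a : ℝ} (ha : 0 ≤ a) (u φ : ℝ) {r : ℝ} (hr : 0 < r) (hr1 : r < 1) :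
    ‖genH a u (zc r φ)‖ ≤ (1 - r) ^ (-a) * (1 - r) ^ (-a) := by
  have hz := norm_zc hr.le φ
  have h0 : 0 < 1 - r := by linarith
  rw [genH, norm_mul]
  exact mul_le_mul (norm_cpow_le_of_re h0 (one_sub_le_re (norm_exp_arccos u).1 hz) ha)
    (norm_cpow_le_of_re h0 (one_sub_le_re (norm_exp_arccos u).2 hz) ha) (norm_nonneg _)
    (by positivity)

theorem continuous_genH_zc (a : ℝ) {r : ℝ} (hr : 0 < r) (hr1 : r < 1) :
    Continuous fun p : ℝ × ℝ => genH a p.1 (zc r p.2) := by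
  have h0 : 0 < 1 - r := by linarith
  have hc := continuous_zc r
  unfold genH
  refine Continuous.mul (Continuous.cpow (by fun_prop) continuous_const fun p => ?_)
    (Continuous.cpow (by fun_prop) continuous_const fun p => ?_)
  · exact Or.inl (h0.trans_le (one_sub_le_re (norm_exp_arccos _).1 (norm_zc hr.le _)))
  · exact Or.inl (h0.trans_le (one_sub_le_re (norm_exp_arccos _).2 (norm_zc hr.le _)))

theorem continuous_boundary (δ : ℝ) {r : ℝ} (hr : 0 < r) (hr1 : r < 1) (n : ℕ) :
    Continuous fun φ => (1 + zc r φ) * (1 - zc r φ) ^ (-δ : ℂ) * (zc r φ)⁻¹ ^ n := by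
  have hc := continuous_zc r
  have h0 : 0 < 1 - r := by linarith
  refine ((continuous_const.add hc).mul (Continuous.cpow (by fun_prop) continuous_const
    fun φ => Or.inl ?_)).mul ((hc.inv₀ (zc_ne_zero hr)).pow n)
  have := one_sub_le_re (x := 1) (by simp) (norm_zc hr.le φ)
  rw [one_mul] at this
  linarith

theorem integral_integral_swap_of_bound {S T : Type*} [MeasurableSpace S] [MeasurableSpace T]
    (Ω : Measure S) [IsFiniteMeasure Ω] (ν : Measure T) [IsFiniteMeasure ν] {f : S → T → ℂ}
    (hf : Measurable (Function.uncurry f)) {C : ℝ} (h : ∀ s, ∀ᵐ t ∂ν, ‖f s t‖ ≤ C) :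
    ∫ s, (∫ t, f s t ∂ν) ∂Ω = ∫ t, (∫ s, f s t ∂Ω) ∂ν := by
  refine integral_integral_swap (Integrable.of_bound hf.aestronglyMeasurable C ?_)
  exact (Measure.ae_prod_iff_ae_ae (measurableSet_le hf.norm measurable_const)).2 (ae_of_all _ h)

theorem integral_setIntegral_mul_swap {T : Type*} [MeasurableSpace T] (Ω : Measure T)
    [IsFiniteMeasure Ω] {U : T → ℝ} (hU : Measurable U) {b : ℝ → ℂ} (hb : Continuous b)
    {h : ℝ → ℝ → ℂ} (hh : Measurable (Function.uncurry h)) {C : ℝ} (hC : ∀ u φ, ‖h u φ‖ ≤ C)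
    (x y : ℝ) :
    ∫ t, (∫ φ in Set.Ioc x y, b φ * h (U t) φ) ∂Ω =
      ∫ φ in Set.Ioc x y, b φ * ∫ t, h (U t) φ ∂Ω := by
  obtain ⟨M, hM⟩ := isCompact_Icc.exists_bound_of_continuousOn (s := Set.Icc x y) hb.continuousOn
  have hm : Measurable (Function.uncurry fun (t : T) (φ : ℝ) => b φ * h (U t) φ) :=
    (hb.measurable.comp measurable_snd).mul
      (hh.comp ((hU.comp measurable_fst).prodMk measurable_snd))
  rw [integral_integral_swap_of_bound Ω _ hm (C := M * C) fun t => ?_]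
  · simp only [integral_const_mul]
  · filter_upwards [ae_restrict_mem measurableSet_Ioc] with φ hp
    rw [norm_mul]
    have := hM φ ⟨hp.1.le, hp.2⟩
    exact mul_le_mul this (hC _ _) (norm_nonneg _) ((norm_nonneg _).trans this)

theorem enorm_integral_qker_le {T : Type*} [MeasurableSpace T] (Ω : Measure T) [IsFiniteMeasure Ω]
    {U : T → ℝ} (hU : Measurable U) (hU1 : ∀ᵐ t ∂Ω, U t ∈ Set.Icc (-1) 1) {l : ℝ} (hl : 0 < l)
    (δ : ℝ) {r : ℝ} (hr : 0 < r) (hr1 : r < 1) (n : ℕ) :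
    ‖∫ t, qker l δ n (U t) ∂Ω‖ₑ ≤ ∫⁻ φ in Set.Ioo 0 π,
      ‖(1 + zc r φ) * (1 - zc r φ) ^ (-δ : ℂ) * (zc r φ)⁻¹ ^ n * (2 * zc r φ) ^ (-(l +
          1 : ℝ) : ℂ)‖ₑ *
        ‖∫ t, (zA r φ - U t) ^ (-(l + 1 : ℝ) : ℂ) ∂Ω‖ₑ := by
  obtain ⟨b, hb⟩ : ∃ b : ℝ → ℂ, b = fun φ =>
    (1 + zc r φ) * (1 - zc r φ) ^ (-δ : ℂ) * (zc r φ)⁻¹ ^ n := ⟨_, rfl⟩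
  have hbc : Continuous b := hb ▸ continuous_boundary δ hr hr1 n
  set J : ℝ → ℂ := fun φ => ∫ t, genH (l + 1) (U t) (zc r φ) ∂Ω with hJ
  have l1 : 0 ≤ l + 1 := by linarith
  have swap : 2 * π * (∫ t, qker l δ n (U t) ∂Ω : ℝ) = ∫ φ in Set.Ioc (-π) π, b φ * J φ := by
    rw [← integral_complex_ofReal, ← integral_const_mul]
    calc _ = ∫ t, (∫ φ in Set.Ioc (-π) π, b φ * genH (l + 1) (U t) (zc r φ)) ∂Ω :=
          integral_congr_ae (hU1.mono fun t ht =>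
              (qker_eq_integral hl δ ht hr hr1 n).trans (by rw [hb]))
      _ = _ := integral_setIntegral_mul_swap Ω hU hbc (h := fun u φ => genH (l + 1) u (zc r φ))
          (continuous_genH_zc (l + 1) hr hr1).measurable
          (fun u φ => genH_zc_bound l1 u φ hr hr1) _ _
  have hJn : ∀ φ, ‖b (-φ) * J (-φ)‖ₑ = ‖b φ * J φ‖ₑ := by
    intro φ
    have hz := norm_zc hr.le φ
    have e1 : J (-φ) = (starRingEnd ℂ) (J φ) := by
      simp only [hJ, zc_neg, arccos_neg_arg hz hr1]
      exact integral_conj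
    have e2 : b (-φ) = (starRingEnd ℂ) (b φ) := by
      simp only [hb, zc_neg]
      have h1 := one_sub_le_re (x := 1) (by simp) hz
      rw [one_mul] at h1
      have h2 := Complex.abs_arg_lt_pi_div_two_iff.2
        (Or.inl (show 0 < (1 - zc r φ).re by linarith))
      rw [abs_lt] at h2
      have h3 := Complex.conj_cpow (1 - zc r φ) (-δ : ℂ) (by linarith [pi_pos] : _ < π).ne
      simp only [map_sub, map_one, map_neg, Complex.conj_ofReal] at h3
      simp [h3]
    rw [e1, e2, ← map_mul, ← ofReal_norm, ← ofReal_norm, RCLike.norm_conj]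
  have hmain : ∀ φ ∈ Set.Ioo 0 π, b φ * J φ = (b φ * (2 * zc r φ) ^ (-(l + 1 : ℝ) : ℂ)) *
      ∫ t, (zA r φ - U t) ^ (-(l + 1 : ℝ) : ℂ) ∂Ω := by
    intro φ hφ
    rw [mul_assoc, ← integral_const_mul ((2 * zc r φ) ^ (-(l + 1 : ℝ) : ℂ))]
    refine congrArg (b φ * ·) ?_
    exact integral_congr_ae (hU1.mono fun t ht => genH_eq ht hr hr1 hφ)
  have hsplit : ∫⁻ φ in Set.Ioc (-π) π, ‖b φ * J φ‖ₑ =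
      2 * ∫⁻ φ in Set.Ioo 0 π, ‖b φ * J φ‖ₑ := by
    have : Set.Ioc (-π) π = Set.Ioc (-π) 0 ∪ Set.Ioc 0 π :=
      (Set.Ioc_union_Ioc_eq_Ioc (by linarith [pi_pos]) pi_pos.le).symm
    rw [this, lintegral_union measurableSet_Ioc
      (Set.Ioc_disjoint_Ioc_of_le le_rfl), two_mul]
    congr 1
    · have hmp := (Measure.measurePreserving_neg (volume : Measure ℝ))
      have := hmp.setLIntegral_comp_preimage_emb (MeasurableEquiv.neg ℝ).measurableEmbedding
        (fun φ => ‖b φ * J φ‖ₑ) (Set.Ioo (-π) 0)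
      rw [← restrict_Ioo_eq_restrict_Ioc, ← this]
      simp only [hJn]
      congr 2
      ext x; simp
    · rw [restrict_Ioo_eq_restrict_Ioc]
  have h1 : ENNReal.ofReal (2 * π) * ‖∫ t, qker l δ n (U t) ∂Ω‖ₑ ≤
      2 * ∫⁻ φ in Set.Ioo 0 π, ‖b φ * J φ‖ₑ := by
    rw [← hsplit]
    refine le_trans (le_of_eq ?_) (enorm_integral_le_lintegral_enorm _)
    rw [← swap, enorm_mul]
    congr 1
    · rw [← ofReal_norm]; simp [abs_of_pos pi_pos]
    · rw [← ofReal_norm, ← ofReal_norm, Complex.norm_real]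
  have h2 : 2 * ‖∫ t, qker l δ n (U t) ∂Ω‖ₑ ≤ 2 * ∫⁻ φ in Set.Ioo 0 π, ‖b φ * J φ‖ₑ := by
    refine le_trans ?_ h1
    gcongr
    rw [show (2 : ENNReal) = ENNReal.ofReal 2 by simp]
    exact ENNReal.ofReal_le_ofReal (by linarith [pi_gt_three])
  have h3 := (ENNReal.mul_le_mul_iff_right (by simp) (by simp)).1 h2
  refine h3.trans (le_of_eq (setLIntegral_congr_fun measurableSet_Ioo fun φ hφ => ?_))
  rw [hmain φ hφ, enorm_mul, hb]

theorem lintegral_Ioc_rpow {c k : ℝ} (hc : 0 ≤ c) (hk : 0 < k) :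
    ∫⁻ τ in Set.Ioc 0 c, ENNReal.ofReal (τ ^ (k - 1)) = ENNReal.ofReal (c ^ k / k) := by
  have hi : IntervalIntegrable (fun τ : ℝ => τ ^ (k - 1)) volume 0 c :=
    intervalIntegral.intervalIntegrable_rpow' (by linarith)
  rw [← ofReal_integral_eq_lintegral_ofReal
    ((intervalIntegrable_iff_integrableOn_Ioc_of_le hc).1 hi), ← intervalIntegral.integral_of_le hc,
    integral_rpow (Or.inl (by linarith))]
  · rw [sub_add_cancel, zero_rpow hk.ne', sub_zero]
  · filter_upwards [ae_restrict_mem measurableSet_Ioc] with τ hτ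
    exact rpow_nonneg hτ.1.le _

theorem lintegral_Ioi_rpow {c a : ℝ} (hc : 0 < c) (ha : 0 < a) :
    ∫⁻ τ in Set.Ioi c, ENNReal.ofReal (τ ^ (-a - 1)) = ENNReal.ofReal (c ^ (-a) / a) := by
  have h1 : -a - 1 < -1 := by linarith
  rw [← ofReal_integral_eq_lintegral_ofReal (integrableOn_Ioi_rpow_of_lt h1 hc),
    integral_Ioi_rpow_of_lt h1 hc]
  · congr 1; rw [sub_add_cancel, neg_div_neg_eq]
  · filter_upwards [ae_restrict_mem measurableSet_Ioi] with τ hτ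
    exact rpow_nonneg (hc.trans hτ).le _

theorem lintegral_Ioi_le_of_bounds {w a k m : ℝ} (hw : 0 < w) (ha : 0 < a) (hk : 0 < k)
    (hkm : k < m) {f : ℝ → ENNReal}
    (h1 : ∀ τ > 0, f τ ≤ ENNReal.ofReal (w ^ (-m) * τ ^ (k - 1)))
    (h2 : ∀ τ > 0, f τ ≤ ENNReal.ofReal ((a * τ) ^ (-m) * τ ^ (k - 1))) :
    ∫⁻ τ in Set.Ioi 0, f τ ≤ ENNReal.ofReal ((1 / k + 1 / (m - k)) * (a ^ (-k) * w ^ (k - m))) := by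
  have hmk : 0 < m - k := by linarith
  have hc : 0 < w / a := by positivity
  rw [← Set.Ioc_union_Ioi_eq_Ioi hc.le, lintegral_union measurableSet_Ioi
    (Set.Ioc_disjoint_Ioi le_rfl), add_mul, ENNReal.ofReal_add (by positivity) (by positivity)]
  gcongr
  · calc _ ≤ ∫⁻ τ in Set.Ioc 0 (w / a), ENNReal.ofReal (w ^ (-m)) * ENNReal.ofReal (τ ^ (k - 1)) :=
          setLIntegral_mono' measurableSet_Ioc fun τ hτ => by
            rw [← ENNReal.ofReal_mul (by positivity)]; exact h1 τ hτ.1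
      _ = _ := by
          rw [lintegral_const_mul' _ _ ENNReal.ofReal_ne_top, lintegral_Ioc_rpow hc.le hk,
            ← ENNReal.ofReal_mul (by positivity)]
          congr 1
          rw [div_rpow hw.le ha.le, rpow_neg ha.le, sub_eq_add_neg, rpow_add hw]
          field_simp
  · calc _ ≤ ∫⁻ τ in Set.Ioi (w / a), ENNReal.ofReal (a ^ (-m)) *
            ENNReal.ofReal (τ ^ (-(m - k) - 1)) :=
          setLIntegral_mono' measurableSet_Ioi fun τ hτ => by
            have hτ0 : 0 < τ := hc.trans hτ
            rw [← ENNReal.ofReal_mul (by positivity)]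
            refine (h2 τ hτ0).trans (le_of_eq ?_)
            rw [mul_rpow ha.le hτ0.le, mul_assoc, ← rpow_add hτ0]
            ring_nf
      _ = _ := by
          rw [lintegral_const_mul' _ _ ENNReal.ofReal_ne_top, lintegral_Ioi_rpow hc hmk,
            ← ENNReal.ofReal_mul (by positivity)]
          congr 1
          rw [div_rpow hw.le ha.le, neg_sub, sub_eq_add_neg k m, rpow_add ha, rpow_add hw,
            rpow_neg ha.le k]
          field_simp

/-- The analytic continuation of the weight `(1+st)(1-t²)^{k-1}`. -/
noncomputable def cwt (s k : ℝ) (t : ℂ) : ℂ :=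
  (1 + s * t) * ((1 - t) ^ ((k - 1 : ℝ) : ℂ) * (1 + t) ^ ((k - 1 : ℝ) : ℂ))

theorem norm_cwt (s k : ℝ) (t : ℂ) :
    ‖cwt s k t‖ = ‖1 + s * t‖ * (‖1 - t‖ ^ (k - 1) * ‖1 + t‖ ^ (k - 1)) := by
  simp only [cwt, norm_mul, Complex.norm_cpow_real]

theorem rpow_le_add_of_mem {a x y e : ℝ} (ha : 0 < a) (h1 : a ≤ x) (h2 : x ≤ y) :
    x ^ e ≤ a ^ e + y ^ e := by
  have hx := ha.trans_le h1
  rcases le_total 0 e with h | h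
  · have := rpow_le_rpow hx.le h2 h
    have := rpow_nonneg ha.le e
    linarith
  · have := rpow_le_rpow_of_nonpos ha h1 h
    have := rpow_nonneg (hx.le.trans h2) e
    linarith

theorem norm_le_three {s : ℝ} (hs : |s| ≤ 1) {t : ℂ} (ht : ‖t‖ ≤ 2) :
    ‖1 + s * t‖ ≤ 3 ∧ ‖1 - t‖ ≤ 3 ∧ ‖1 + t‖ ≤ 3 := by
  have h0 : ‖(1 : ℂ)‖ = 1 := norm_one
  refine ⟨?_, ?_, ?_⟩
  · have := norm_add_le (1 : ℂ) (s * t)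
    rw [norm_mul, Complex.norm_real, norm_eq_abs] at this
    nlinarith [norm_nonneg t, abs_nonneg s]
  · linarith [norm_sub_le (1 : ℂ) t]
  · linarith [norm_add_le (1 : ℂ) t]

theorem two_le_norm_add (t : ℂ) : 2 ≤ ‖1 - t‖ + ‖1 + t‖ := by
  have := norm_add_le (1 - t) (1 + t)
  have h : (1 - t) + (1 + t) = 2 := by ring
  rw [h] at this
  simpa using this

theorem norm_cwt_le {s k : ℝ} (hs : |s| ≤ 1) {t : ℂ} (ht : ‖t‖ ≤ 2) :
    ‖cwt s k t‖ ≤ 3 * (1 + 3 ^ (k - 1)) * (‖1 - t‖ ^ (k - 1) + ‖1 + t‖ ^ (k - 1)) := by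
  obtain ⟨h1, h2, h3⟩ := norm_le_three hs ht
  have h4 := two_le_norm_add t
  rw [norm_cwt, mul_assoc 3]
  refine mul_le_mul h1 ?_ (by positivity) (by norm_num)
  have p1 : 0 ≤ ‖1 - t‖ ^ (k - 1) := by positivity
  have p2 : 0 ≤ ‖1 + t‖ ^ (k - 1) := by positivity
  have p3 : (0 : ℝ) ≤ 3 ^ (k - 1) := by positivity
  rcases le_total 1 ‖1 - t‖ with h | h
  · have := rpow_le_add_of_mem (e := k - 1) one_pos h h2
    rw [one_rpow] at this
    nlinarith [mul_nonneg p3 p1]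
  · have := rpow_le_add_of_mem (e := k - 1) one_pos (by linarith : 1 ≤ ‖1 + t‖) h3
    rw [one_rpow] at this
    nlinarith [mul_nonneg p3 p2]

theorem integral_rect_eq {s k m a η : ℝ} {B : ℂ} (hB : 0 < B.im) (ha : 0 < a)
    (hη : 0 < η) :
    ∫ u : ℝ in (-1)..1, (B - a * (u - η * Complex.I)) ^ (-m : ℂ) * cwt s k (u - η * Complex.I) =
      (∫ u : ℝ in (-1)..1, (B - a * (u - Complex.I)) ^ (-m : ℂ) * cwt s k (u - Complex.I)) +
      Complex.I * (∫ τ : ℝ in η..1,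
        (B - a * (1 - τ * Complex.I)) ^ (-m : ℂ) * cwt s k (1 - τ * Complex.I)) -
      Complex.I * (∫ τ : ℝ in η..1,
        (B - a * (-1 - τ * Complex.I)) ^ (-m : ℂ) * cwt s k (-1 - τ * Complex.I)) := by
  have H := Complex.integral_boundary_rect_eq_zero_of_differentiableOn
    (fun t : ℂ => (B - a * t) ^ (-m : ℂ) * cwt s k t) (-1 - Complex.I) (1 - η * Complex.I) ?_
  · simp only [Complex.sub_re, Complex.sub_im, Complex.neg_re, Complex.neg_im, Complex.one_re,
      Complex.one_im, Complex.I_re, Complex.I_im, Complex.mul_re, Complex.mul_im,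
      Complex.ofReal_re, Complex.ofReal_im, smul_eq_mul] at H
    norm_num at H
    rw [intervalIntegral.integral_symm] at H
    have e1 := intervalIntegral.integral_comp_neg (a := η) (b := 1) (fun y : ℝ =>
      (B - a * (1 + y * Complex.I)) ^ (-m : ℂ) * cwt s k (1 + y * Complex.I))
    have e2 := intervalIntegral.integral_comp_neg (a := η) (b := 1) (fun y : ℝ =>
      (B - a * (-1 + y * Complex.I)) ^ (-m : ℂ) * cwt s k (-1 + y * Complex.I))
    rw [← e1, ← e2] at H
    simp only [Complex.ofReal_neg, neg_mul, ← sub_eq_add_neg] at H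
    rw [← intervalIntegral.integral_symm] at H
    linear_combination -H
  · intro t ht
    have him : t.im < 0 := by
      have := ht.2
      simp only [Set.mem_preimage, Complex.sub_im, Complex.neg_im, Complex.one_im,
        Complex.I_im, Complex.mul_im, Complex.ofReal_re, Complex.ofReal_im, Complex.I_re] at this
      norm_num at this
      rw [Set.mem_uIcc] at this
      rcases this with h | h <;> linarith
    unfold cwt
    refine DifferentiableAt.differentiableWithinAt ?_
    refine DifferentiableAt.mul (DifferentiableAt.cpow_const (by fun_prop) (Or.inr ?_))
      (DifferentiableAt.mul (by fun_prop) (DifferentiableAt.mul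
        (DifferentiableAt.cpow_const (by fun_prop) (Or.inr ?_))
        (DifferentiableAt.cpow_const (by fun_prop) (Or.inr ?_))))
    · simp; nlinarith
    · simp; exact him.ne
    · simp; exact him.ne

theorem norm_add_mul_I_ge {w : ℂ} (hw : 0 ≤ w.im) {x : ℝ} (hx : 0 ≤ x) :
    ‖w‖ ≤ ‖w + x * Complex.I‖ ∧ x ≤ ‖w + x * Complex.I‖ := by
  constructor
  · rw [Complex.norm_def, Complex.norm_def]
    apply Real.sqrt_le_sqrt
    simp only [Complex.normSq_apply]
    simp
    nlinarith
  · have := Complex.abs_im_le_norm (w + x * Complex.I)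
    simp at this
    rw [abs_of_nonneg (by positivity)] at this
    linarith

theorem norm_side_le {s k m a η : ℝ} (hs : |s| ≤ 1) (hk : 0 < k) (hkm : k < m) (ha : 0 < a)
    (hη : 0 < η) (hη1 : η ≤ 1) {B : ℂ} (hB : 0 < B.im) {e : ℝ} (he : e = 1 ∨ e = -1) :
    ‖∫ τ : ℝ in η..1, (B - a * (e - τ * Complex.I)) ^ (-m : ℂ) * cwt s k (e - τ * Complex.I)‖ ≤
      3 * (1 + 3 ^ (k - 1)) * (1 / k + 1 / (m - k)) * (a ^ (-k) * ‖B - a * e‖ ^ (k - m)) := by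
  have hmk : 0 < m - k := by linarith
  have hwim : 0 < (B - a * e).im := by simpa using hB
  have hw : 0 < ‖B - a * e‖ := norm_pos_iff.2 fun h => by rw [h] at hwim; simp at hwim
  set K : ℝ := 3 * (1 + 3 ^ (k - 1)) with hK
  have hK0 : 0 < K := by positivity
  have hcw : ∀ τ ∈ Set.Ioc η 1, ‖cwt s k (e - τ * Complex.I)‖ ≤ K * τ ^ (k - 1) := by
    intro τ hτ
    have hτ0 : 0 < τ := hη.trans hτ.1
    have hn : ‖(e - τ * Complex.I : ℂ)‖ ≤ 2 := by
      have := norm_sub_le (e : ℂ) (τ * Complex.I)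
      have h1 : ‖(e : ℂ)‖ = 1 := by rcases he with h | h <;> simp [h]
      have h2 : ‖(τ * Complex.I : ℂ)‖ = τ := by simp [abs_of_pos hτ0]
      linarith [hτ.2]
    obtain ⟨h1, h2, h3⟩ := norm_le_three hs hn
    have h4 := two_le_norm_add (e - τ * Complex.I : ℂ)
    have hτn : ‖(τ * Complex.I : ℂ)‖ = τ := by simp [abs_of_pos hτ0]
    have key : ∀ y : ℝ, 1 ≤ y → y ≤ 3 → τ ^ (k - 1) * y ^ (k - 1) ≤ (1 + 3 ^ (k - 1)) *
        τ ^ (k - 1) := by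
      intro y hy1 hy2
      have := rpow_le_add_of_mem (e := k - 1) one_pos hy1 hy2
      rw [one_rpow] at this
      rw [mul_comm]
      exact mul_le_mul_of_nonneg_right this (by positivity)
    rw [norm_cwt, hK, mul_assoc 3]
    refine mul_le_mul h1 ?_ (by positivity) (by norm_num)
    rcases he with h | h
    · have e1 : ‖(1 - (e - τ * Complex.I) : ℂ)‖ = τ := by rw [h]; simp [abs_of_pos hτ0]
      rw [e1] at h4 ⊢
      exact key _ (by linarith [hτ.2]) h3
    · have e1 : ‖(1 + (e - τ * Complex.I) : ℂ)‖ = τ := by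
        have : (1 + (e - τ * Complex.I) : ℂ) = -(τ * Complex.I) := by rw [h]; push_cast; ring
        rw [this, norm_neg, hτn]
      rw [e1] at h4 ⊢
      rw [mul_comm]
      exact key _ (by linarith [hτ.2]) h2
  have hbase : ∀ τ : ℝ, 0 < τ → ‖B - a * e‖ ≤ ‖B - a * (e - τ * Complex.I)‖ ∧
      a * τ ≤ ‖B - a * (e - τ * Complex.I)‖ := by
    intro τ hτ
    have := norm_add_mul_I_ge hwim.le (x := a * τ) (by positivity)
    have e1 : B - a * (e - τ * Complex.I) = B - a * e + (a * τ : ℝ) * Complex.I := by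
      push_cast; ring
    rw [e1]; exact this
  rw [← ENNReal.ofReal_le_ofReal_iff (by positivity), ofReal_norm,
    intervalIntegral.integral_of_le hη1]
  refine (enorm_integral_le_lintegral_enorm _).trans ?_
  rw [mul_assoc K, ENNReal.ofReal_mul hK0.le]
  have hle : ∀ τ ∈ Set.Ioc η 1, ‖(B - a * (e - τ * Complex.I)) ^ (-m : ℂ) *
      cwt s k (e - τ * Complex.I)‖ₑ ≤ ENNReal.ofReal K * (Set.Ioc η 1).indicator (fun τ =>
        ENNReal.ofReal (‖B - a * (e - τ * Complex.I)‖ ^ (-m) * τ ^ (k - 1))) τ := by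
    intro τ hτ
    rw [Set.indicator_of_mem hτ, ← ENNReal.ofReal_mul hK0.le, ← ofReal_norm, norm_mul,
      ← Complex.ofReal_neg, Complex.norm_cpow_real]
    refine ENNReal.ofReal_le_ofReal ?_
    have := mul_le_mul_of_nonneg_left (hcw τ hτ)
      (by positivity : 0 ≤ ‖B - a * (e - τ * Complex.I)‖ ^ (-m))
    linarith
  refine (setLIntegral_mono' measurableSet_Ioc hle).trans ?_
  rw [lintegral_const_mul' _ _ ENNReal.ofReal_ne_top]
  gcongr
  refine (lintegral_mono_set (fun τ hτ => hη.trans hτ.1)).trans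
    (lintegral_Ioi_le_of_bounds hw ha hk hkm (fun τ hτ => ?_) fun τ hτ => ?_)
  all_goals
    obtain ⟨b1, b2⟩ := hbase τ hτ
    have hτ' : 0 < τ := hτ
    refine (Set.indicator_le_self _ _ τ).trans (ENNReal.ofReal_le_ofReal ?_)
    gcongr ?_ * _
    refine rpow_le_rpow_of_nonpos (by positivity) (by assumption) (by linarith)

theorem norm_bottom_le {s k m a : ℝ} (hs : |s| ≤ 1) (hk : 0 < k) (hkm : k < m) (ha : 0 < a)
    {B : ℂ} (hB : 0 < B.im) :
    ‖∫ u : ℝ in (-1)..1, (B - a * (u - Complex.I)) ^ (-m : ℂ) * cwt s k (u - Complex.I)‖ ≤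
      (6 * (1 + 3 ^ (k - 1)) ^ 2 * 4 ^ (m - k)) * (a ^ (-k) * ‖B - a‖ ^ (k - m)) := by
  have hwim : 0 < (B - a).im := by simpa using hB
  have hw : 0 < ‖B - a‖ := norm_pos_iff.2 fun h => by rw [h] at hwim; simp at hwim
  have key := intervalIntegral.norm_integral_le_of_norm_le_const (a := -1) (b := 1)
    (f := fun u : ℝ => (B - a * (u - Complex.I)) ^ (-m : ℂ) * cwt s k (u - Complex.I))
    (C := (3 * (1 + 3 ^ (k - 1)) ^ 2 * 4 ^ (m - k)) * (a ^ (-k) * ‖B - a‖ ^ (k - m))) ?_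
  · refine key.trans (le_of_eq ?_)
    norm_num; ring
  intro u hu
  rw [Set.uIoc_of_le (by norm_num)] at hu
  have hu1 : |u| ≤ 1 := abs_le.2 ⟨hu.1.le, hu.2⟩
  have hn : ‖(u - Complex.I : ℂ)‖ ≤ 2 := by
    have := norm_sub_le (u : ℂ) Complex.I
    rw [Complex.norm_I, Complex.norm_real, norm_eq_abs] at this
    linarith
  obtain ⟨h1, h2, h3⟩ := norm_le_three hs hn
  have i1 : 1 ≤ ‖(1 - (u - Complex.I) : ℂ)‖ := by
    have := Complex.abs_im_le_norm (1 - (u - Complex.I) : ℂ); simpa using this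
  have i2 : 1 ≤ ‖(1 + (u - Complex.I) : ℂ)‖ := by
    have := Complex.abs_im_le_norm (1 + (u - Complex.I) : ℂ); simpa using this
  have j1 := rpow_le_add_of_mem (e := k - 1) one_pos i1 h2
  have j2 := rpow_le_add_of_mem (e := k - 1) one_pos i2 h3
  rw [one_rpow] at j1 j2
  have hc : ‖cwt s k (u - Complex.I)‖ ≤ 3 * (1 + 3 ^ (k - 1)) ^ 2 := by
    rw [norm_cwt, sq]
    exact mul_le_mul h1 (mul_le_mul j1 j2 (by positivity) (by positivity)) (by positivity)
      (by norm_num)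
  set D := B - a * (u - Complex.I) with hD
  have e1 : D = (B - a * u) + (a : ℝ) * Complex.I := by rw [hD]; ring
  have haD : a ≤ ‖D‖ := by
    rw [e1]; exact (norm_add_mul_I_ge (by simpa using hB.le) ha.le).2
  have hD0 : 0 < ‖D‖ := ha.trans_le haD
  have hwD : ‖B - a‖ ≤ 4 * ‖D‖ := by
    have e2 : B - a = D + a * ((u - Complex.I) - 1) := by rw [hD]; ring
    have e3 := norm_add_le D (a * ((u - Complex.I) - 1))
    rw [norm_mul, Complex.norm_real, norm_of_nonneg ha.le, norm_sub_rev _ (1 : ℂ)] at e3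
    rw [e2]
    nlinarith
  rw [norm_mul, ← Complex.ofReal_neg, Complex.norm_cpow_real]
  have hpow : ‖D‖ ^ (-m) ≤ 4 ^ (m - k) * (a ^ (-k) * ‖B - a‖ ^ (k - m)) := by
    have : ‖D‖ ^ (-m) = ‖D‖ ^ (-k) * ‖D‖ ^ (k - m) := by rw [← rpow_add hD0]; ring_nf
    rw [this, mul_left_comm]
    refine mul_le_mul (rpow_le_rpow_of_nonpos ha haD (by linarith)) ?_ (by positivity)
      (by positivity)
    have h5 : ‖D‖ ^ (k - m) ≤ (‖B - a‖ / 4) ^ (k - m) :=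
      rpow_le_rpow_of_nonpos (by positivity) (by linarith) (by linarith)
    refine h5.trans (le_of_eq ?_)
    rw [div_rpow hw.le (by norm_num), div_eq_mul_inv, ← rpow_neg (by norm_num), neg_sub, mul_comm]
  calc _ ≤ (4 ^ (m - k) * (a ^ (-k) * ‖B - a‖ ^ (k - m))) * (3 * (1 + 3 ^ (k - 1)) ^ 2) :=
        mul_le_mul hpow hc (norm_nonneg _) (by positivity)
    _ = _ := by ring

theorem intervalIntegrable_one_sub_add {k : ℝ} (hk : 0 < k) (C c : ℝ) :
    IntervalIntegrable (fun u : ℝ => C * ((1 - u) ^ (k - 1) + (1 + u) ^ (k - 1) +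
        c)) volume (-1) 1 := by
  have h : ∀ a b, IntervalIntegrable (fun u : ℝ => u ^ (k - 1)) volume a b :=
    fun a b => intervalIntegral.intervalIntegrable_rpow' (by linarith)
  have h1 := (h 2 0).comp_sub_left 1
  have h2 := (h 0 2).comp_add_left 1
  norm_num at h1 h2
  exact ((h1.add h2).add intervalIntegrable_const).const_mul C

/-- Deforming the contour gains `k` powers. -/
theorem exists_norm_integral_cpow_le {k m : ℝ} (hk : 0 < k) (hkm : k < m) :
    ∃ C : ℝ, 0 < C ∧ ∀ s : ℝ, |s| ≤ 1 → ∀ a : ℝ, 0 < a → ∀ B : ℂ, 0 < B.im →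
      ‖∫ u : ℝ in (-1)..1, (B - a * u) ^ (-m : ℂ) * cwt s k u‖ ≤
        C * (a ^ (-k) * (‖B - a‖ ^ (k - m) + ‖B + a‖ ^ (k - m))) := by
  have hmk : 0 < m - k := by linarith
  set C1 : ℝ := 3 * (1 + 3 ^ (k - 1)) * (1 / k + 1 / (m - k)) with hC1
  set C2 : ℝ := 6 * (1 + 3 ^ (k - 1)) ^ 2 * 4 ^ (m - k) with hC2
  have hC1p : 0 < C1 := by positivity
  have hC2p : 0 < C2 := by positivity
  refine ⟨C1 + C2, by positivity, fun s hs a ha B hB => ?_⟩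
  have hbound : ∀ η ∈ Set.Ioc (0 : ℝ) 1,
      ‖∫ u : ℝ in (-1)..1, (B - a * (u - η * Complex.I)) ^ (-m : ℂ) *
        cwt s k (u - η * Complex.I)‖ ≤
        (C1 + C2) * (a ^ (-k) * (‖B - a‖ ^ (k - m) + ‖B + a‖ ^ (k - m))) := by
    intro η hη
    rw [integral_rect_eq hB ha hη.1]
    have n1 := norm_bottom_le hs hk hkm ha hB
    have n2 := norm_side_le hs hk hkm ha hη.1 hη.2 hB (e := 1) (Or.inl rfl)
    have n3 := norm_side_le hs hk hkm ha hη.1 hη.2 hB (e := -1) (Or.inr rfl)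
    simp only [Complex.ofReal_one, Complex.ofReal_neg, mul_one, mul_neg, sub_neg_eq_add] at n2 n3
    refine (norm_sub_le _ _).trans ((add_le_add (norm_add_le _ _) le_rfl).trans ?_)
    rw [norm_mul, norm_mul, Complex.norm_I, one_mul, one_mul]
    refine (add_le_add (add_le_add n1 n2) n3).trans ?_
    have p1 : 0 ≤ a ^ (-k) * ‖B + a‖ ^ (k - m) := by positivity
    rw [← hC1, ← hC2]
    nlinarith [mul_nonneg hC2p.le p1]
  have hlim : Filter.Tendsto (fun η : ℝ => ∫ u : ℝ in (-1)..1,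
      (B - a * (u - η * Complex.I)) ^ (-m : ℂ) * cwt s k (u - η * Complex.I))
      (nhdsWithin 0 (Set.Ioi 0)) (nhds (∫ u : ℝ in (-1)..1, (B - a * u) ^ (-m : ℂ) * cwt s k u)) :=
          by
    have h_cont := intervalIntegrable_one_sub_add hk
      (B.im ^ (-m) * (3 * (1 + 3 ^ (k - 1)))) (2 * 3 ^ (k - 1))
    refine intervalIntegral.tendsto_integral_filter_of_dominated_convergence _ ?_ ?_ h_cont ?_
    · refine Filter.Eventually.of_forall fun η => Measurable.aestronglyMeasurable ?_
      unfold cwt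
      fun_prop
    · filter_upwards [Ioc_mem_nhdsGT (zero_lt_one' ℝ)] with η hη
      have : ∀ᵐ u : ℝ, u ≠ 1 := Measure.ae_ne volume 1
      filter_upwards [this] with u hu1 hu
      rw [Set.uIoc_of_le (by norm_num)] at hu
      have hu2 : u < 1 := lt_of_le_of_ne hu.2 hu1
      have hn : ‖(u - η * Complex.I : ℂ)‖ ≤ 2 := by
        have := norm_sub_le (u : ℂ) (η * Complex.I)
        rw [norm_mul, Complex.norm_I, Complex.norm_real, Complex.norm_real, norm_eq_abs,
          norm_of_nonneg hη.1.le] at this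
        have hu1 : |u| ≤ 1 := abs_le.2 ⟨hu.1.le, hu.2⟩
        linarith [hη.2]
      obtain ⟨-, h2, h3⟩ := norm_le_three hs hn
      have i1 : 1 - u ≤ ‖(1 - (u - η * Complex.I) : ℂ)‖ := by
        have := Complex.re_le_norm (1 - (u - η * Complex.I) : ℂ); simpa using this
      have i2 : 1 + u ≤ ‖(1 + (u - η * Complex.I) : ℂ)‖ := by
        have := Complex.re_le_norm (1 + (u - η * Complex.I) : ℂ); simpa using this
      have j1 := rpow_le_add_of_mem (e := k - 1) (by linarith) i1 h2
      have j2 := rpow_le_add_of_mem (e := k - 1) (by linarith [hu.1]) i2 h3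
      have hD : B.im ≤ ‖B - a * (u - η * Complex.I)‖ := by
        have := Complex.im_le_norm (B - a * (u - η * Complex.I))
        simp at this
        nlinarith [hη.1]
      rw [norm_mul, ← Complex.ofReal_neg, Complex.norm_cpow_real, mul_assoc (B.im ^ (-m))]
      refine mul_le_mul (rpow_le_rpow_of_nonpos hB hD (by linarith)) ?_ (norm_nonneg _)
        (by positivity)
      refine (norm_cwt_le hs hn).trans ?_
      refine mul_le_mul_of_nonneg_left (by linarith) (by positivity)
    · have : ∀ᵐ u : ℝ, u ≠ 1 := Measure.ae_ne volume 1
      filter_upwards [this] with u hu1 hu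
      rw [Set.uIoc_of_le (by norm_num)] at hu
      have hu2 : u < 1 := lt_of_le_of_ne hu.2 hu1
      have hcont : ContinuousAt (fun η : ℝ => (B - a * (u - η * Complex.I)) ^ (-m : ℂ) *
          cwt s k (u - η * Complex.I)) 0 := by
        unfold cwt
        refine ContinuousAt.mul (ContinuousAt.cpow (by fun_prop) (by fun_prop) (Or.inr ?_))
          (ContinuousAt.mul (by fun_prop) (ContinuousAt.mul
            (ContinuousAt.cpow (by fun_prop) (by fun_prop) (Or.inl ?_))
            (ContinuousAt.cpow (by fun_prop) (by fun_prop) (Or.inl ?_))))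
        · simpa using hB.ne'
        · simpa using hu2
        · simp; linarith [hu.1]
      have := hcont.tendsto.mono_left (nhdsWithin_le_nhds (s := Set.Ioi 0))
      simpa using this
  refine le_of_tendsto hlim.norm ?_
  filter_upwards [Ioc_mem_nhdsGT (zero_lt_one' ℝ)] with η hη
  exact hbound η hη

theorem lintegral_fin_prod {m : ℕ} {α : Type*} [MeasurableSpace α] (μ : Fin m → Measure α)
    [∀ i, SigmaFinite (μ i)] (f : Fin m → α → ENNReal) (hf : ∀ i, Measurable (f i)) :
    ∫⁻ x, ∏ i, f i (x i) ∂Measure.pi μ = ∏ i, ∫⁻ x, f i x ∂μ i := by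
  induction m with
  | zero => simp
  | succ m ih =>
    have h := ((measurePreserving_piFinSuccAbove μ 0).symm).lintegral_comp
      (f := fun x => ∏ i, f i (x i)) (by fun_prop)
    rw [← h, Fin.prod_univ_succ, ← ih (fun i => μ i.succ) (fun i => f i.succ) (fun i => hf _)]
    have hm : Measurable fun x : Fin m → α => ∏ i : Fin m, f i.succ (x i) :=
      Finset.measurable_prod _ fun i _ => (hf i.succ).comp (measurable_pi_apply i)
    rw [← lintegral_prod_mul (hf 0).aemeasurable hm.aemeasurable]
    refine lintegral_congr fun z => ?_
    rw [Fin.prod_univ_succ]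
    simp [MeasurableEquiv.piFinSuccAbove_symm_apply, Fin.insertNthEquiv]

theorem pi_withDensity {m : ℕ} {α : Type*} [MeasurableSpace α] (μ : Fin m → Measure α)
    [∀ i, SigmaFinite (μ i)] (f : Fin m → α → ENNReal) (hf : ∀ i, Measurable (f i))
    [∀ i, SigmaFinite ((μ i).withDensity (f i))] :
    Measure.pi (fun i => (μ i).withDensity (f i)) =
      (Measure.pi μ).withDensity fun x => ∏ i, f i (x i) := by
  refine Measure.pi_eq fun s hs => ?_
  rw [withDensity_apply _ (MeasurableSet.univ_pi hs), Measure.restrict_pi_pi,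
    lintegral_fin_prod _ f hf]
  exact Finset.prod_congr rfl fun i _ => by rw [withDensity_apply _ (hs i)]

theorem lintegral_pi_insertNth {m : ℕ} {α : Type*} [MeasurableSpace α] (μ : Fin (m + 1) → Measure α)
    [∀ i, SigmaFinite (μ i)] (i : Fin (m + 1)) {f : (Fin (m + 1) → α) → ENNReal}
    (hf : Measurable f) :
    ∫⁻ x, f x ∂Measure.pi μ =
      ∫⁻ a, ∫⁻ y, f (i.insertNth a y) ∂Measure.pi (fun j => μ (i.succAbove j)) ∂μ i := by
  rw [← ((measurePreserving_piFinSuccAbove μ i).symm).lintegral_comp hf, lintegral_prod]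
  · rfl
  · exact (hf.comp (MeasurableEquiv.measurable _)).aemeasurable

theorem lintegral_eq_ofReal_mul_comp_mul {c : ℝ} (hc : c ≠ 0) {f : ℝ → ENNReal}
    (hf : Measurable f) : ∫⁻ x, f x = ENNReal.ofReal |c| * ∫⁻ x, f (c * x) := by
  conv_lhs => rw [← Real.smul_map_volume_mul_left hc]
  rw [lintegral_smul_measure, lintegral_map hf (by fun_prop)]
  rfl

theorem lintegral_eq_Ioi_add_neg (f : ℝ → ENNReal) (hf : Measurable f) :
    ∫⁻ x, f x = ∫⁻ x in Set.Ioi 0, (f x + f (-x)) := by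
  rw [lintegral_add_left hf, ← lintegral_add_compl f (measurableSet_Ioi (a := (0:ℝ))),
    Set.compl_Ioi]
  congr 1
  have h := (Measure.measurePreserving_neg (volume : Measure ℝ)).setLIntegral_comp_preimage
    (measurableSet_Iio (a := (0:ℝ))) hf
  rw [Measure.restrict_congr_set Iio_ae_eq_Iic.symm, ← h]
  congr 2
  ext x; simp

/-- The density `v^{a-1}` on `(0, ∞)`. -/
noncomputable def gw (a v : ℝ) : ℝ := if 0 < v then v ^ (a - 1) else 0

/-- The density `(1+t)(1-t²)^{κ-1}` on `(-1, 1)`. -/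
noncomputable def ow (κ t : ℝ) : ℝ :=
  if -1 < t ∧ t < 1 then (1 + t) * (1 - t ^ 2) ^ (κ - 1) else 0

@[fun_prop] theorem measurable_gw (a : ℝ) : Measurable (gw a) :=
  Measurable.ite measurableSet_Ioi (by fun_prop) (by fun_prop)

@[fun_prop] theorem measurable_ow (a : ℝ) : Measurable (ow a) :=
  Measurable.ite measurableSet_Ioo (by fun_prop) (by fun_prop)

theorem gw_nonneg (a v : ℝ) : 0 ≤ gw a v := by
  unfold gw; split_ifs <;> positivity

theorem ow_nonneg (a t : ℝ) : 0 ≤ ow a t := by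
  unfold ow; split_ifs with h
  · have : 0 < 1 - t ^ 2 := by nlinarith
    have : 0 < 1 + t := by linarith
    positivity
  · rfl

theorem lintegral_gw_mul (a : ℝ) (F : ℝ → ENNReal) :
    ∫⁻ v, ENNReal.ofReal (gw a v) * F v =
      ∫⁻ v in Set.Ioi 0, ENNReal.ofReal (v ^ (a - 1)) * F v := by
  rw [← lintegral_indicator measurableSet_Ioi]
  refine lintegral_congr fun v => ?_
  by_cases h : 0 < v <;> simp [gw, Set.indicator, h]

theorem lintegral_gw_mul_gw {a b : ℝ} (ha : 0 < a) (hb : 0 < b) :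
    ∃ B : ENNReal, B ≠ 0 ∧ B ≠ ⊤ ∧ ∀ w, ∫⁻ u, ENNReal.ofReal (gw a u) *
        ENNReal.ofReal (gw b (w - u))
      = B * ENNReal.ofReal (gw (a + b) w) := by
  have hβ := ProbabilityTheory.beta_pos ha hb
  refine ⟨ENNReal.ofReal (ProbabilityTheory.beta a b), by simpa using hβ, by simp, fun w => ?_⟩
  by_cases hw : 0 < w
  · rw [lintegral_eq_ofReal_mul_comp_mul hw.ne' (by fun_prop), abs_of_pos hw]
    have e : ∀ s, ENNReal.ofReal (gw a (w * s)) * ENNReal.ofReal (gw b (w - w * s)) =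
        ENNReal.ofReal (w ^ (a + b - 2) * ProbabilityTheory.beta a b) *
          ProbabilityTheory.betaPDF a b s := by
      intro s
      rw [ProbabilityTheory.betaPDF_eq, ← ENNReal.ofReal_mul (gw_nonneg _ _),
        ← ENNReal.ofReal_mul (by positivity)]
      congr 1
      have h2 : w - w * s = w * (1 - s) := by ring
      unfold gw
      rw [h2]
      simp only [mul_pos_iff_of_pos_left hw, sub_pos]
      by_cases h0 : 0 < s
      · by_cases h1 : s < 1
        · rw [if_pos h0, if_pos h1, if_pos ⟨h0, h1⟩, mul_rpow hw.le h0.le,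
            mul_rpow hw.le (by linarith), show a + b - 2 = (a - 1) + (b - 1) by ring, rpow_add hw]
          field_simp
        · simp [h1]
      · simp [h0]
    simp_rw [e]
    rw [lintegral_const_mul _ (by unfold ProbabilityTheory.betaPDF; exact
      (ProbabilityTheory.measurable_betaPDFReal a b).ennreal_ofReal),
      ProbabilityTheory.lintegral_betaPDF_eq_one ha hb, mul_one,
      ← ENNReal.ofReal_mul hw.le, ← ENNReal.ofReal_mul hβ.le]
    congr 1
    rw [gw, if_pos hw, show a + b - 1 = 1 + (a + b - 2) by ring, rpow_add hw, rpow_one]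
    ring
  · rw [gw, if_neg hw, ENNReal.ofReal_zero, mul_zero, lintegral_eq_zero_iff (by fun_prop)]
    refine Filter.Eventually.of_forall fun u => ?_
    by_cases h : 0 < u
    · have : ¬ (0 < w - u) := by linarith
      simp [gw, this]
    · simp [gw, h]

/-- The measure with density `v^{a-1}` on `(0, ∞)`, completed by the point mass at `0`
for `a = 0`. -/
noncomputable def gam (a : ℝ) : Measure ℝ :=
  if a = 0 then Measure.dirac 0 else volume.withDensity fun v => ENNReal.ofReal (gw a v)

instance (a : ℝ) : SigmaFinite (gam a) := by
  unfold gam; split_ifs <;> infer_instance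

theorem lintegral_gam {a : ℝ} (ha : 0 < a) {F : ℝ → ENNReal} (hF : Measurable F) :
    ∫⁻ v, F v ∂gam a = ∫⁻ v, ENNReal.ofReal (gw a v) * F v := by
  rw [gam, if_neg ha.ne', lintegral_withDensity_eq_lintegral_mul _ (by fun_prop) hF]
  rfl

theorem gam_conv {a b : ℝ} (ha : 0 ≤ a) (hb : 0 < b) :
    ∃ B : ENNReal, B ≠ 0 ∧ B ≠ ⊤ ∧ ∀ F : ℝ → ENNReal, Measurable F →
      ∫⁻ u, ∫⁻ v, F (u + v) ∂gam b ∂gam a = B * ∫⁻ w, F w ∂gam (a + b) := by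
  rcases ha.eq_or_lt with rfl | ha
  · refine ⟨1, by simp, by simp, fun F hF => ?_⟩
    simp [gam]
  · obtain ⟨B, h0, h1, hB⟩ := lintegral_gw_mul_gw ha hb
    refine ⟨B, h0, h1, fun F hF => ?_⟩
    rw [lintegral_gam ha (by fun_prop), lintegral_gam (add_pos ha hb) hF]
    have e : ∀ u, ENNReal.ofReal (gw a u) * ∫⁻ v, F (u + v) ∂gam b =
        ∫⁻ w, ENNReal.ofReal (gw a u) * ENNReal.ofReal (gw b (w - u)) * F w := by
      intro u
      rw [lintegral_gam hb (by fun_prop), ← lintegral_const_mul _ (by fun_prop),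
        ← lintegral_sub_right_eq_self _ u]
      refine lintegral_congr fun w => ?_
      rw [mul_assoc]; congr 3; ring
    simp_rw [e]
    rw [lintegral_lintegral_swap (by fun_prop), ← lintegral_const_mul _ (by fun_prop)]
    refine lintegral_congr fun w => ?_
    rw [lintegral_mul_const _ (by fun_prop), hB, mul_assoc]

theorem lintegral_Ioi_sq {c : ℝ} (hc : 0 ≤ c) (F : ℝ → ENNReal) :
    ∫⁻ q in Set.Ioi c, ENNReal.ofReal (2 * q) * F (q ^ 2 - c ^ 2) = ∫⁻ v in Set.Ioi 0, F v := by
  have h := lintegral_image_eq_lintegral_abs_deriv_mul (s := Set.Ioi c)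
    (f := fun q => q ^ 2 - c ^ 2) (f' := fun q => 2 * q) measurableSet_Ioi
    (fun x hx => by simpa using ((hasDerivAt_pow 2 x).sub_const (c^2)).hasDerivWithinAt)
    (fun x hx y hy h => by
      have hx' : c < x := hx
      have hy' : c < y := hy
      have : (x - y) * (x + y) = 0 := by simp only at h; linarith
      rcases mul_eq_zero.1 this with h | h <;> linarith) F
  have him : (fun q : ℝ => q ^ 2 - c ^ 2) '' Set.Ioi c = Set.Ioi 0 := by
    ext v
    simp only [Set.mem_image, Set.mem_Ioi]
    constructor
    · rintro ⟨q, hq, rfl⟩; nlinarith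
    · intro hv
      refine ⟨√(v + c ^ 2), ?_, ?_⟩
      · exact Real.lt_sqrt_of_sq_lt (by linarith)
      · rw [Real.sq_sqrt (by positivity)]; ring
  rw [him] at h
  rw [h]
  refine setLIntegral_congr_fun measurableSet_Ioi fun q hq => ?_
  have : c < q := hq
  rw [abs_of_pos (by linarith)]

theorem lintegral_comp_sq {F : ℝ → ENNReal} (hF : Measurable F) :
    ∫⁻ q, F (q ^ 2) = ∫⁻ v, F v ∂gam (1 / 2) := by
  rw [lintegral_gam (by norm_num) hF, lintegral_gw_mul, ← lintegral_Ioi_sq le_rfl,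
    lintegral_eq_Ioi_add_neg _ (by fun_prop)]
  refine setLIntegral_congr_fun measurableSet_Ioi fun q (hq : 0 < q) => ?_
  rw [neg_sq, zero_pow two_ne_zero, sub_zero]
  rw [← mul_assoc, ← ENNReal.ofReal_mul (by positivity), ← two_mul]
  congr 1
  have : (q ^ 2) ^ ((1:ℝ) / 2 - 1) = q⁻¹ := by
    rw [← rpow_natCast, ← rpow_mul hq.le, ← rpow_neg_one]; norm_num
  rw [this, mul_assoc, mul_inv_cancel₀ hq.ne']; simp

theorem lintegral_Y_omega {κ : ℝ} {G : ℝ → ℝ → ENNReal}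
    (hG : Measurable (Function.uncurry G)) :
    ∫⁻ Y : ℝ, ENNReal.ofReal (|Y| ^ (2 * κ)) * ∫⁻ t, ENNReal.ofReal (ow κ t) * G (Y * t) (Y ^ 2) =
      ∫⁻ p, ∫⁻ v, ENNReal.ofReal (gw κ v) * G p (p ^ 2 + v) := by
  rw [lintegral_eq_Ioi_add_neg _ (by fun_prop)]
  have key : ∀ Y ∈ Set.Ioi (0:ℝ), ENNReal.ofReal (|Y| ^ (2 * κ)) *
        (∫⁻ t, ENNReal.ofReal (ow κ t) * G (Y * t) (Y ^ 2)) +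
      ENNReal.ofReal (|-Y| ^ (2 * κ)) *
        (∫⁻ t, ENNReal.ofReal (ow κ t) * G (-Y * t) ((-Y) ^ 2)) =
      ∫⁻ p, (Set.Ioi |p|).indicator
        (fun Y => ENNReal.ofReal (2 * Y) * (ENNReal.ofReal (gw κ (Y ^ 2 - |p| ^ 2)) *
          G p (p ^ 2 + (Y ^ 2 - |p| ^ 2)))) Y := by
    intro Y hY
    have hY : 0 < Y := hY
    rw [abs_neg, abs_of_pos hY, neg_sq]
    have h1 : ∫⁻ t, ENNReal.ofReal (ow κ t) * G (-Y * t) (Y ^ 2) =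
        ∫⁻ t, ENNReal.ofReal (ow κ (-t)) * G (Y * t) (Y ^ 2) := by
      rw [← (Measure.measurePreserving_neg (volume : Measure ℝ)).lintegral_comp
        (f := fun t => ENNReal.ofReal (ow κ t) * G (-Y * t) (Y ^ 2)) (by fun_prop)]
      simp
    have hm : Measurable fun p : ℝ => (Set.Ioi |p|).indicator
        (fun Y => ENNReal.ofReal (2 * Y) * (ENNReal.ofReal (gw κ (Y ^ 2 - |p| ^ 2)) *
          G p (p ^ 2 + (Y ^ 2 - |p| ^ 2)))) Y := by
      simp only [Set.indicator]
      exact Measurable.ite (measurableSet_lt (f := fun p : ℝ => |p|) (g := fun _ => Y)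
        (by fun_prop) (by fun_prop)) (by fun_prop) (by fun_prop)
    have hm2 := hm.comp (measurable_const_mul Y : Measurable fun t => Y * t)
    simp only [Function.comp_def] at hm2
    rw [h1, ← mul_add, ← lintegral_add_left (by fun_prop),
      lintegral_eq_ofReal_mul_comp_mul hY.ne' hm,
      ← lintegral_const_mul _ (by fun_prop), ← lintegral_const_mul _ hm2]
    refine lintegral_congr fun t => ?_
    rw [← add_mul, ← ENNReal.ofReal_add (ow_nonneg _ _) (ow_nonneg _ _), abs_of_pos hY]
    by_cases ht : -1 < t ∧ t < 1
    · have hlt : |Y * t| < Y := by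
        rw [abs_mul, abs_of_pos hY]
        have : |t| < 1 := abs_lt.2 ht
        nlinarith
      have h3 : 0 < 1 - t ^ 2 := by nlinarith
      rw [Set.indicator_of_mem (by exact hlt), ← mul_assoc, ← mul_assoc, ← mul_assoc,
        ← ENNReal.ofReal_mul (by positivity), ← ENNReal.ofReal_mul (by positivity),
        ← ENNReal.ofReal_mul (by positivity)]
      have e1 : Y ^ 2 - |Y * t| ^ 2 = Y ^ 2 * (1 - t ^ 2) := by rw [sq_abs]; ring
      have e2 : (Y * t) ^ 2 + Y ^ 2 * (1 - t ^ 2) = Y ^ 2 := by ring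
      rw [e1, e2]
      congr 2
      have e3 : -1 < -t ∧ -t < 1 := ⟨by linarith, by linarith⟩
      rw [ow, ow, if_pos ht, if_pos e3, gw, if_pos (by positivity), neg_sq,
        mul_rpow (by positivity) h3.le]
      have e4 : (Y ^ 2) ^ (κ - 1) * Y ^ 2 = Y ^ (2 * κ) := by
        rw [← rpow_natCast, ← rpow_mul hY.le, ← rpow_add hY]; congr 1; push_cast; ring
      rw [← e4]; ring
    · have e3 : ¬ (-1 < -t ∧ -t < 1) := fun h => ht ⟨by linarith [h.2], by linarith [h.1]⟩
      have hlt : ¬ (|Y * t| < Y) := by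
        rw [abs_mul, abs_of_pos hY]
        intro h
        exact ht (abs_lt.1 (by nlinarith [abs_nonneg t]))
      rw [Set.indicator_of_notMem (by exact hlt), ow, ow, if_neg ht, if_neg e3]; simp
  rw [setLIntegral_congr_fun measurableSet_Ioi key, lintegral_lintegral_swap]
  · refine lintegral_congr fun p => ?_
    rw [lintegral_indicator measurableSet_Ioi, Measure.restrict_restrict measurableSet_Ioi,
      Set.inter_eq_left.2 (Set.Ioi_subset_Ioi (abs_nonneg p)),
      lintegral_Ioi_sq (abs_nonneg p) (fun v => ENNReal.ofReal (gw κ v) * G p (p ^ 2 + v)),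
      ← lintegral_indicator measurableSet_Ioi]
    refine lintegral_congr fun v => ?_
    by_cases h : 0 < v <;> simp [gw, Set.indicator, h]
  · refine Measurable.aemeasurable ?_
    simp only [Set.indicator]
    refine Measurable.ite (measurableSet_lt (f := fun x : ℝ × ℝ => |x.2|) (g := fun x => x.1)
      (by fun_prop) (by fun_prop)) (by fun_prop) (by fun_prop)

theorem lintegral_rotate (a b : ℝ) {H : ℝ → ℝ → ENNReal} (hH : Measurable (Function.uncurry H)) :
    ∫⁻ p : ℝ, ∫⁻ q : ℝ, H (a * p + b * q) (p ^ 2 + q ^ 2) =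
      ∫⁻ p : ℝ, ∫⁻ q : ℝ, H (√(a ^ 2 + b ^ 2) * p) (p ^ 2 + q ^ 2) := by
  have h : ∀ a b : ℝ, ∫⁻ p : ℝ, ∫⁻ q : ℝ, H (a * p + b * q) (p ^ 2 + q ^ 2) =
      ∫⁻ z : ℂ, H (a * z.re + b * z.im) (z.re ^ 2 + z.im ^ 2) := by
    intro a b
    rw [← lintegral_prod (f := fun x : ℝ × ℝ => H (a * x.1 + b * x.2) (x.1 ^ 2 + x.2 ^ 2))
      (by fun_prop)]
    exact (Complex.volume_preserving_equiv_real_prod.lintegral_comp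
      (f := fun x : ℝ × ℝ => H (a * x.1 + b * x.2) (x.1 ^ 2 + x.2 ^ 2)) (by fun_prop)).symm
  by_cases hw : (⟨a, b⟩ : ℂ) = 0
  · obtain ⟨ha, hb⟩ : a = 0 ∧ b = 0 := by simpa [Complex.ext_iff] using hw
    simp [ha, hb]
  have hn : ‖(⟨a, b⟩ : ℂ)‖ = √(a ^ 2 + b ^ 2) := by
    rw [Complex.norm_def, Complex.normSq_mk]; congr 1; ring
  have hn0 : 0 < √(a ^ 2 + b ^ 2) := hn ▸ norm_pos_iff.2 hw
  have h2 := h (√(a ^ 2 + b ^ 2)) 0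
  simp only [zero_mul, add_zero] at h2
  rw [h, h2]
  obtain ⟨R, hR⟩ : ∃ R, R = √(a ^ 2 + b ^ 2) := ⟨_, rfl⟩
  have hR2 : R ^ 2 = a ^ 2 + b ^ 2 := by rw [hR, Real.sq_sqrt (by positivity)]
  rw [← hR] at hn hn0 ⊢
  have hu : ∃ u : Circle, (u : ℂ) = ⟨a / R, b / R⟩ := by
    refine ⟨⟨⟨a / R, b / R⟩, ?_⟩, rfl⟩
    change (⟨a / R, b / R⟩ : ℂ) ∈ Metric.sphere (0 : ℂ) 1
    rw [mem_sphere_zero_iff_norm, Complex.norm_def, Complex.normSq_mk, Real.sqrt_eq_one]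
    field_simp
    linarith
  obtain ⟨u, hu⟩ := hu
  rw [← ((rotation u).measurePreserving).lintegral_comp
    (f := fun z : ℂ => H (a * z.re + b * z.im) (z.re ^ 2 + z.im ^ 2)) (by fun_prop)]
  refine lintegral_congr fun z => ?_
  have e1 : (rotation u z).re = a / R * z.re - b / R * z.im := by
    rw [rotation_apply, hu]; simp
  have e2 : (rotation u z).im = a / R * z.im + b / R * z.re := by
    rw [rotation_apply, hu]; simp
  rw [e1, e2]
  congr 1
  · field_simp
    linear_combination (-z.re) * hR2
  · field_simp
    linear_combination (-(z.re ^ 2 + z.im ^ 2)) * hR2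

/-- The measure `(1+t)(1-t²)^{κ-1} dt` on `(-1,1)`. -/
noncomputable def om (κ : ℝ) : Measure ℝ := volume.withDensity fun t => ENNReal.ofReal (ow κ t)

/-- The measure `|Y|^{2κ} dY`. -/
noncomputable def mY (κ : ℝ) : Measure ℝ :=
  volume.withDensity fun Y => ENNReal.ofReal (|Y| ^ (2 * κ))

instance (κ : ℝ) : SigmaFinite (om κ) := by unfold om; infer_instance
instance (κ : ℝ) : SigmaFinite (mY κ) := by unfold mY; infer_instance

theorem lintegral_om (κ : ℝ) {F : ℝ → ENNReal} (hF : Measurable F) :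
    ∫⁻ v, F v ∂om κ = ∫⁻ v, ENNReal.ofReal (ow κ v) * F v := by
  rw [om, lintegral_withDensity_eq_lintegral_mul _ (by fun_prop) hF]; rfl

theorem lintegral_mY (κ : ℝ) {F : ℝ → ENNReal} (hF : Measurable F) :
    ∫⁻ v, F v ∂mY κ = ∫⁻ v, ENNReal.ofReal (|v| ^ (2 * κ)) * F v := by
  rw [mY, lintegral_withDensity_eq_lintegral_mul _ (by fun_prop) hF]; rfl

theorem lintegral_mY_prod_om {κ : ℝ} (hκ : 0 < κ) {G : ℝ → ℝ → ENNReal}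
    (hG : Measurable (Function.uncurry G)) :
    ∫⁻ z, G (z.1 * z.2) (z.1 ^ 2) ∂(mY κ).prod (om κ) = ∫⁻ p, ∫⁻ v, G p (p ^ 2 + v) ∂gam κ := by
  rw [lintegral_prod _ (by fun_prop), lintegral_mY _ (by fun_prop)]
  simp only
  have e1 : ∀ Y, ∫⁻ t, G (Y * t) (Y ^ 2) ∂om κ =
    ∫⁻ t, ENNReal.ofReal (ow κ t) * G (Y * t) (Y ^ 2) := fun Y => lintegral_om _ (by fun_prop)
  have e2 : ∀ p, ∫⁻ v, G p (p ^ 2 + v) ∂gam κ =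
    ∫⁻ v, ENNReal.ofReal (gw κ v) * G p (p ^ 2 + v) := fun Y => lintegral_gam hκ (by fun_prop)
  simp_rw [e1, e2]
  exact lintegral_Y_omega hG

theorem gam_conv_three {c κ : ℝ} (hc : 0 ≤ c) (hκ : 0 < κ) :
    ∃ B : ENNReal, B ≠ 0 ∧ B ≠ ⊤ ∧ ∀ F : ℝ → ENNReal, Measurable F →
      ∫⁻ q : ℝ, ∫⁻ v, ∫⁻ u, F (q ^ 2 + v + u) ∂gam κ ∂gam c =
        B * ∫⁻ w, F w ∂gam (κ + c + 1 / 2) := by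
  obtain ⟨B, hB0, hB1, hB⟩ := gam_conv hc hκ
  obtain ⟨D, hD0, hD1, hD⟩ := gam_conv (a := c + κ) (b := 1 / 2) (by linarith) (by norm_num)
  refine ⟨B * D, mul_ne_zero hB0 hD0, ENNReal.mul_ne_top hB1 hD1, fun F hF => ?_⟩
  have e : ∀ q : ℝ, ∫⁻ v, ∫⁻ u, F (q ^ 2 + v + u) ∂gam κ ∂gam c =
      B * ∫⁻ w, F (w + q ^ 2) ∂gam (c + κ) := by
    intro q
    rw [← hB (fun w => F (w + q ^ 2)) (by fun_prop)]
    simp only [add_comm, add_left_comm, add_assoc]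
  simp_rw [e]
  rw [lintegral_const_mul _ (by fun_prop),
    lintegral_comp_sq (F := fun s => ∫⁻ w, F (w + s) ∂gam (c + κ)) (by fun_prop),
    lintegral_lintegral_swap (by fun_prop), hD F hF, add_comm κ c, mul_assoc]

theorem exists_lintegral_pi_mY_om {d : ℕ} (κ : Fin d → ℝ) (hκ : ∀ i, 0 < κ i) :
    ∃ C : ENNReal, C ≠ 0 ∧ C ≠ ⊤ ∧ ∀ (x0 : ℝ) (x : Fin d → ℝ) (G : ℝ → ℝ → ENNReal),
      Measurable (Function.uncurry G) →
      ∫⁻ Y : ℝ, ∫⁻ z : Fin d → ℝ × ℝ, G (x0 * Y + ∑ j, x j * ((z j).1 * (z j).2))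
          (Y ^ 2 + ∑ j, (z j).1 ^ 2) ∂Measure.pi (fun j => (mY (κ j)).prod (om (κ j))) =
        C * ∫⁻ p, ∫⁻ v, G (√(x0 ^ 2 + ∑ j, x j ^ 2) * p) (p ^ 2 + v) ∂gam (∑ j, κ j + d / 2) := by
  induction d with
  | zero =>
    refine ⟨1, by simp, by simp, fun x0 x G hG => ?_⟩
    rw [Measure.pi_of_empty (fun j : Fin 0 => (mY (κ j)).prod (om (κ j)))]
    simp only [univ_eq_empty, sum_empty, add_zero, lintegral_const, measure_univ, mul_one,
      CharP.cast_eq_zero, zero_div, one_mul]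
    rw [gam, if_pos rfl]
    simp only [lintegral_dirac, add_zero, Real.sqrt_sq_eq_abs]
    rcases abs_choice x0 with h | h
    · rw [h]
    · rw [h, ← (Measure.measurePreserving_neg (volume : Measure ℝ)).lintegral_comp
        (f := fun p => G (x0 * p) (p ^ 2)) (by fun_prop)]
      simp
  | succ d ih =>
    obtain ⟨C, hC0, hC1, hC⟩ := ih (fun j => κ j.succ) (fun j => hκ _)
    have hc : 0 ≤ ∑ j : Fin d, κ j.succ + d / 2 :=
      add_nonneg (Finset.sum_nonneg fun j _ => (hκ _).le) (by positivity)
    obtain ⟨B, hB0, hB1, hB⟩ := gam_conv_three hc (hκ 0)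
    refine ⟨C * B, mul_ne_zero hC0 hB0, ENNReal.mul_ne_top hC1 hB1, fun x0 x G hG => ?_⟩
    have e0 : κ 0 + (∑ j : Fin d, κ j.succ + d / 2) + 1 / 2 =
        ∑ j, κ j + ((d + 1 : ℕ) : ℝ) / 2 := by
      rw [Fin.sum_univ_succ]; push_cast; ring
    rw [e0] at hB
    obtain ⟨R, hR⟩ : ∃ R, R = √(x0 ^ 2 + ∑ j : Fin d, x j.succ ^ 2) := ⟨_, rfl⟩
    have hR2 : √(R ^ 2 + x 0 ^ 2) = √(x0 ^ 2 + ∑ j, x j ^ 2) := by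
      rw [hR, Real.sq_sqrt (by positivity), Fin.sum_univ_succ]; congr 1; ring
    calc _ = ∫⁻ Y : ℝ, ∫⁻ a, ∫⁻ z : Fin d → ℝ × ℝ,
          G ((x0 * Y + ∑ j, x j.succ * ((z j).1 * (z j).2)) + x 0 * (a.1 * a.2))
            ((Y ^ 2 + ∑ j, (z j).1 ^ 2) + a.1 ^ 2)
            ∂Measure.pi (fun j : Fin d => (mY (κ j.succ)).prod (om (κ j.succ)))
            ∂(mY (κ 0)).prod (om (κ 0)) := by
          refine lintegral_congr fun Y => ?_
          rw [lintegral_pi_insertNth _ 0 (by fun_prop)]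
          refine lintegral_congr fun a => ?_
          simp only [Fin.succAbove_zero]
          refine lintegral_congr fun z => ?_
          rw [Fin.sum_univ_succ, Fin.sum_univ_succ]
          simp only [Fin.insertNth_zero', Fin.cons_zero, Fin.cons_succ]
          congr 1 <;> ring
      _ = ∫⁻ a, ∫⁻ Y : ℝ, ∫⁻ z : Fin d → ℝ × ℝ,
          G ((x0 * Y + ∑ j, x j.succ * ((z j).1 * (z j).2)) + x 0 * (a.1 * a.2))
            ((Y ^ 2 + ∑ j, (z j).1 ^ 2) + a.1 ^ 2)
            ∂Measure.pi (fun j : Fin d => (mY (κ j.succ)).prod (om (κ j.succ)))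
            ∂volume ∂(mY (κ 0)).prod (om (κ 0)) := by
          rw [lintegral_lintegral_swap (by fun_prop)]
      _ = ∫⁻ a, C * ∫⁻ p, ∫⁻ v, G (R * p + x 0 * (a.1 * a.2)) ((p ^ 2 + v) + a.1 ^ 2)
            ∂gam (∑ j : Fin d, κ j.succ + d / 2) ∂volume ∂(mY (κ 0)).prod (om (κ 0)) := by
          refine lintegral_congr fun a => ?_
          rw [hC x0 (fun j => x j.succ)
            (fun s w => G (s + x 0 * (a.1 * a.2)) (w + a.1 ^ 2)) (by fun_prop), ← hR]
      _ = C * ∫⁻ p, ∫⁻ v, ∫⁻ a, G (R * p + x 0 * (a.1 * a.2)) ((p ^ 2 + v) + a.1 ^ 2)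
            ∂(mY (κ 0)).prod (om (κ 0)) ∂gam (∑ j : Fin d, κ j.succ + d / 2) ∂volume := by
          rw [lintegral_const_mul _ (by fun_prop), lintegral_lintegral_swap (by fun_prop)]
          congr 1
          refine lintegral_congr fun p => ?_
          rw [lintegral_lintegral_swap (by fun_prop)]
      _ = C * ∫⁻ p, ∫⁻ v, ∫⁻ q, ∫⁻ u, G (R * p + x 0 * q) ((p ^ 2 + v) + (q ^ 2 + u))
            ∂gam (κ 0) ∂volume ∂gam (∑ j : Fin d, κ j.succ + d / 2) ∂volume := by
          congr 1
          refine lintegral_congr fun p => lintegral_congr fun v => ?_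
          exact lintegral_mY_prod_om (hκ 0) (G := fun q s => G (R * p + x 0 * q) ((p ^ 2 + v) + s))
            (by fun_prop)
      _ = C * ∫⁻ p, ∫⁻ q, ∫⁻ v, ∫⁻ u, G (R * p + x 0 * q) ((p ^ 2 + q ^ 2) + v + u)
            ∂gam (κ 0) ∂gam (∑ j : Fin d, κ j.succ + d / 2) := by
          congr 1
          refine lintegral_congr fun p => ?_
          rw [lintegral_lintegral_swap (by fun_prop)]
          refine lintegral_congr fun q => lintegral_congr fun v => lintegral_congr fun u => ?_
          congr 1; ring
      _ = C * ∫⁻ p, ∫⁻ q, ∫⁻ v, ∫⁻ u, G (√(x0 ^ 2 + ∑ j, x j ^ 2) * p) ((p ^ 2 + q ^ 2) + v + u)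
            ∂gam (κ 0) ∂gam (∑ j : Fin d, κ j.succ + d / 2) := by
          rw [← hR2]
          congr 1
          exact lintegral_rotate R (x 0)
            (H := fun s w => ∫⁻ v, ∫⁻ u, G s (w + v + u)
              ∂gam (κ 0) ∂gam (∑ j : Fin d, κ j.succ + d / 2)) (by fun_prop)
      _ = C * ∫⁻ p, B * ∫⁻ w, G (√(x0 ^ 2 + ∑ j, x j ^ 2) * p) (p ^ 2 + w)
            ∂gam (∑ j, κ j + ((d + 1 : ℕ) : ℝ) / 2) := by
          congr 1
          refine lintegral_congr fun p => ?_
          rw [← hB (fun w => G (√(x0 ^ 2 + ∑ j, x j ^ 2) * p) (p ^ 2 + w)) (by fun_prop)]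
          simp only [add_assoc]
      _ = _ := by
          rw [lintegral_const_mul _ (by fun_prop), mul_assoc]

theorem liftB_eq_insertNth {d : ℕ} (p : EuclideanSpace ℝ (Fin d)) (w : ℝ) :
    (fun i => liftB d p w i) = (Fin.last d).insertNth (α := fun _ => ℝ) w (fun i => p i) := by
  ext i
  refine Fin.lastCases ?_ (fun j => ?_) i
  · simp [liftB]
  · rw [← Fin.succAbove_last_apply, Fin.insertNth_apply_succAbove, Fin.succAbove_last_apply]
    simp [liftB]

theorem lintegral_liftB {d : ℕ} {H : (Fin (d + 1) → ℝ) → ENNReal} (hH : Measurable H) :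
    ∫⁻ Y, H Y = ∫⁻ p : EuclideanSpace ℝ (Fin d), ∫⁻ w, H fun i => liftB d p w i := by
  have h := lintegral_pi_insertNth (fun _ : Fin (d + 1) => (volume : Measure ℝ)) (Fin.last d) hH
  have hm : Measurable fun z : ℝ × (Fin d → ℝ) => H ((Fin.last d).insertNth (α := fun _ =>
      ℝ) z.1 z.2) :=
    hH.comp (MeasurableEquiv.piFinSuccAbove (fun _ => ℝ) (Fin.last d)).symm.measurable
  rw [volume_pi, h, lintegral_lintegral_swap hm.aemeasurable]
  have h2 := (PiLp.volume_preserving_ofLp (Fin d)).lintegral_comp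
    (f := fun p => ∫⁻ w, H ((Fin.last d).insertNth (α := fun _ => ℝ) w p))
    ((hm.comp measurable_swap).lintegral_prod_right')
  rw [volume_pi] at h2
  rw [← h2]
  refine lintegral_congr fun p => lintegral_congr fun w => ?_
  rw [liftB_eq_insertNth]

theorem lintegral_eq_gw_half {f : ℝ → ENNReal} (hf : Measurable f) :
    ∫⁻ w, f w = 2⁻¹ * ∫⁻ v, ENNReal.ofReal (gw (1 / 2) v) * (f (√v) + f (-√v)) := by
  rw [lintegral_gw_mul, ← lintegral_Ioi_sq le_rfl, lintegral_eq_Ioi_add_neg _ hf,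
    ← lintegral_const_mul _ (by fun_prop)]
  refine setLIntegral_congr_fun measurableSet_Ioi fun q (hq : 0 < q) => ?_
  simp only [zero_pow two_ne_zero, sub_zero]
  rw [Real.sqrt_sq hq.le, ← mul_assoc, ← mul_assoc, mul_assoc (2⁻¹),
    ← ENNReal.ofReal_mul (by positivity)]
  have : (q ^ 2) ^ ((1:ℝ) / 2 - 1) = q⁻¹ := by
    rw [← rpow_natCast, ← rpow_mul hq.le, ← rpow_neg_one]; norm_num
  rw [this, show 2 * q * q⁻¹ = 2 by field_simp, ENNReal.ofReal_ofNat,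
    ENNReal.inv_mul_cancel two_ne_zero (by simp), one_mul]

section polar

variable {E : Type*} [NormedAddCommGroup E] [InnerProductSpace ℝ E] [FiniteDimensional ℝ E]
  [MeasurableSpace E] [BorelSpace E]

theorem lintegral_eq_ofReal_mul_comp_smul {c : ℝ} (hc : 0 < c) {f : E → ENNReal}
    (hf : Measurable f) :
    ∫⁻ x, f x = ENNReal.ofReal (c ^ Module.finrank ℝ E) * ∫⁻ x, f (c • x) := by
  rw [← lintegral_map (f := f) hf (measurable_const_smul c),
    Measure.map_addHaar_smul _ hc.ne', lintegral_smul_measure, smul_eq_mul, ← mul_assoc,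
    ← ENNReal.ofReal_mul (by positivity), abs_of_pos (by positivity),
    mul_inv_cancel₀ (by positivity)]
  simp

theorem lintegral_polar {b : ℝ} (K : ℝ → ENNReal) (hK : Measurable K) (F : E → ENNReal)
    (hF : Measurable F) :
    ∫⁻ p : E, ∫⁻ v, ENNReal.ofReal (gw b v) *
        (K (‖p‖ ^ 2 + v) * F ((√(‖p‖ ^ 2 + v))⁻¹ • p)) =
      (∫⁻ ρ in Set.Ioi 0, ENNReal.ofReal (ρ ^ ((Module.finrank ℝ E : ℝ) / 2 + b - 1)) * K ρ) *
        ∫⁻ y : E, ENNReal.ofReal (gw b (1 - ‖y‖ ^ 2)) * F y := by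
  have h1 : ∀ p : E, ∫⁻ v, ENNReal.ofReal (gw b v) *
        (K (‖p‖ ^ 2 + v) * F ((√(‖p‖ ^ 2 + v))⁻¹ • p)) =
      ∫⁻ ρ in Set.Ioi 0, ENNReal.ofReal (gw b (ρ - ‖p‖ ^ 2)) * (K ρ * F ((√ρ)⁻¹ • p)) := by
    intro p
    rw [← lintegral_sub_right_eq_self _ (‖p‖ ^ 2), ← lintegral_indicator measurableSet_Ioi]
    refine lintegral_congr fun ρ => ?_
    rw [add_sub_cancel]
    by_cases h : 0 < ρ
    · rw [Set.indicator_of_mem (by exact h)]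
    · rw [Set.indicator_of_notMem (by exact h), gw, if_neg (by nlinarith [sq_nonneg ‖p‖])]
      simp
  simp_rw [h1]
  rw [lintegral_lintegral_swap (by fun_prop), ← lintegral_mul_const _ (by fun_prop)]
  refine setLIntegral_congr_fun measurableSet_Ioi fun ρ (hρ : 0 < ρ) => ?_
  have hs : 0 < √ρ := Real.sqrt_pos.2 hρ
  rw [lintegral_eq_ofReal_mul_comp_smul hs (by fun_prop), ← lintegral_const_mul _ (by fun_prop),
    ← lintegral_const_mul _ (by fun_prop)]
  refine lintegral_congr fun y => ?_
  rw [norm_smul, smul_smul, inv_mul_cancel₀ hs.ne', one_smul, mul_pow, Real.norm_of_nonneg hs.le,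
    Real.sq_sqrt hρ.le]
  have e : gw b (ρ - ρ * ‖y‖ ^ 2) = ρ ^ (b - 1) * gw b (1 - ‖y‖ ^ 2) := by
    rw [show ρ - ρ * ‖y‖ ^ 2 = ρ * (1 - ‖y‖ ^ 2) by ring]
    unfold gw
    simp only [mul_pos_iff_of_pos_left hρ]
    split_ifs with h
    · rw [mul_rpow hρ.le h.le]
    · simp
  have e2 : √ρ ^ Module.finrank ℝ E * ρ ^ (b - 1) =
      ρ ^ ((Module.finrank ℝ E : ℝ) / 2 + b - 1) := by
    rw [Real.sqrt_eq_rpow, ← rpow_natCast, ← rpow_mul hρ.le, ← rpow_add hρ]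
    congr 1; ring
  rw [e, ← e2, ENNReal.ofReal_mul (by positivity), ENNReal.ofReal_mul (by positivity)]
  ring

end polar

/-- The integrand of the Funk–Hecke type formula with distinguished coordinate `i`: the weight
`∏_{j ≠ i} |Y_j|^{2κ_j}` times the average of `g(X_i Y_i + ∑_{j ≠ i} X_j Y_j t_j)`. -/
noncomputable def fhInt {d : ℕ} (κ : Fin (d + 1) → ℝ) (i : Fin (d + 1)) (X : Fin (d + 1) → ℝ)
    (g : ℝ → ENNReal) (Y : Fin (d + 1) → ℝ) : ENNReal :=
  (∏ j, ENNReal.ofReal (|Y (i.succAbove j)| ^ (2 * κ (i.succAbove j)))) *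
    ∫⁻ t, g (X i * Y i + ∑ j, X (i.succAbove j) * (Y (i.succAbove j) * t j))
      ∂Measure.pi fun j => om (κ (i.succAbove j))

theorem measurable_fhInt {d : ℕ} (κ : Fin (d + 1) → ℝ) (i : Fin (d + 1)) (X : Fin (d + 1) → ℝ)
    {g : ℝ → ENNReal} (hg : Measurable g) : Measurable (fhInt κ i X g) := by
  unfold fhInt
  refine Measurable.mul ?_ ?_
  · exact Finset.measurable_prod _ fun j _ => by fun_prop
  · exact Measurable.lintegral_prod_right' (f := fun z : (Fin (d + 1) → ℝ) × (Fin d → ℝ) =>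
      g (X i * z.1 i + ∑ j, X (i.succAbove j) * (z.1 (i.succAbove j) * z.2 j))) (by fun_prop)

theorem lintegral_pi_mY_om_eq {d : ℕ} (κ : Fin (d + 1) → ℝ) (i : Fin (d + 1))
    (X : Fin (d + 1) → ℝ) {G : ℝ → ℝ → ENNReal} (hG : Measurable (Function.uncurry G)) :
    ∫⁻ Y : ℝ, ∫⁻ z : Fin d → ℝ × ℝ,
        G (X i * Y + ∑ j, X (i.succAbove j) * ((z j).1 * (z j).2)) (Y ^ 2 + ∑ j, (z j).1 ^ 2)
        ∂Measure.pi (fun j => (mY (κ (i.succAbove j))).prod (om (κ (i.succAbove j)))) =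
      ∫⁻ Y : Fin (d + 1) → ℝ, fhInt κ i X (fun u => G u (∑ j, Y j ^ 2)) Y := by
  have hm : Measurable fun Y : Fin (d + 1) → ℝ =>
      fhInt κ i X (fun u => G u (∑ j, Y j ^ 2)) Y := by
    unfold fhInt
    refine Measurable.mul ?_ ?_
    · exact Finset.measurable_prod _ fun j _ => by fun_prop
    · exact Measurable.lintegral_prod_right' (f := fun z : (Fin (d + 1) → ℝ) × (Fin d → ℝ) =>
        G (X i * z.1 i + ∑ j, X (i.succAbove j) * (z.1 (i.succAbove j) * z.2 j))
          (∑ j, z.1 j ^ 2)) (by fun_prop)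
  rw [volume_pi, lintegral_pi_insertNth _ i hm]
  refine lintegral_congr fun a => ?_
  have h1 := (measurePreserving_arrowProdEquivProdArrow ℝ ℝ (Fin d)
    (fun j => mY (κ (i.succAbove j))) (fun j => om (κ (i.succAbove j)))).lintegral_comp
    (f := fun q => G (X i * a + ∑ j, X (i.succAbove j) * (q.1 j * q.2 j))
      (a ^ 2 + ∑ j, q.1 j ^ 2)) (by fun_prop)
  have h2 : ∀ z : Fin d → ℝ × ℝ, MeasurableEquiv.arrowProdEquivProdArrow ℝ ℝ (Fin d) z =
    (fun j => (z j).1, fun j => (z j).2) := fun z => rfl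
  simp only [h2] at h1
  rw [h1, lintegral_prod _ (by fun_prop)]
  unfold mY
  rw [pi_withDensity _ _ (fun j => by fun_prop), lintegral_withDensity_eq_lintegral_mul _
    (Finset.measurable_prod _ fun j _ => by fun_prop) (by fun_prop)]
  refine lintegral_congr fun y => ?_
  simp only [fhInt, Pi.mul_apply, Fin.insertNth_apply_same, Fin.insertNth_apply_succAbove]
  congr 1
  refine lintegral_congr fun t => ?_
  rw [Fin.sum_univ_succAbove _ i]
  simp only [Fin.insertNth_apply_same, Fin.insertNth_apply_succAbove]

theorem lintegral_Ioi_indicator_rpow {a : ℝ} (ha : 0 < a) :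
    ∃ C : ENNReal, C ≠ 0 ∧ C ≠ ⊤ ∧
      ∫⁻ ρ in Set.Ioi 0, ENNReal.ofReal (ρ ^ (a - 1)) * (Set.Ioc 0 1).indicator 1 ρ = C := by
  refine ⟨ENNReal.ofReal (1 ^ a / a), ?_, by simp, ?_⟩
  · simpa using ha
  rw [← lintegral_Ioc_rpow zero_le_one ha, ← lintegral_indicator measurableSet_Ioc,
    ← lintegral_indicator measurableSet_Ioi]
  refine lintegral_congr fun ρ => ?_
  by_cases h : 0 < ρ <;> by_cases h' : ρ ≤ 1 <;> simp [Set.indicator, h, h']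

theorem sum_sq_liftB {d : ℕ} (p : EuclideanSpace ℝ (Fin d)) (w : ℝ) :
    ∑ i, liftB d p w i ^ 2 = ‖p‖ ^ 2 + w ^ 2 := by
  rw [Fin.sum_univ_castSucc, EuclideanSpace.norm_sq_eq]
  simp [liftB]

theorem liftB_smul {d : ℕ} (c : ℝ) (p : EuclideanSpace ℝ (Fin d)) (w : ℝ) (i : Fin (d + 1)) :
    liftB d (c • p) (c * w) i = c * liftB d p w i := by
  simp only [liftB]
  refine Fin.lastCases ?_ (fun j => ?_) i <;> simp

theorem fhInt_mul {d : ℕ} (κ : Fin (d + 1) → ℝ) (i : Fin (d + 1))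
    (X Y : Fin (d + 1) → ℝ) {c : ℝ} (hc : 0 < c) (g : ℝ → ENNReal) :
    fhInt κ i X g (fun j => c * Y j) =
      ENNReal.ofReal (c ^ (2 * ∑ j, κ (i.succAbove j))) * fhInt κ i X (fun u => g (c * u)) Y := by
  unfold fhInt
  rw [← mul_assoc (ENNReal.ofReal _)]
  congr 1
  · rw [mul_sum, Real.rpow_sum_of_pos hc, ENNReal.ofReal_prod_of_nonneg
      (fun j _ => by positivity), ← Finset.prod_mul_distrib]
    refine Finset.prod_congr rfl fun j _ => ?_
    rw [abs_mul, abs_of_pos hc, mul_rpow hc.le (abs_nonneg _), ENNReal.ofReal_mul (by positivity)]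
  · refine lintegral_congr fun t => ?_
    congr 1
    rw [mul_add, mul_sum]
    congr 1
    · ring
    · exact Finset.sum_congr rfl fun j _ => by ring

theorem fhInt_const_mul {d : ℕ} (κ : Fin (d + 1) → ℝ) (i : Fin (d + 1))
    (X Y : Fin (d + 1) → ℝ) (c : ENNReal) {g : ℝ → ENNReal} (hg : Measurable g) :
    fhInt κ i X (fun u => c * g u) Y = c * fhInt κ i X g Y := by
  unfold fhInt
  rw [lintegral_const_mul _ (by fun_prop)]
  ring

theorem measurable_liftB {α : Type*} [MeasurableSpace α] {d : ℕ}
    {p : α → EuclideanSpace ℝ (Fin d)} {w : α → ℝ}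
    (hw : Measurable w) (hp : Measurable p := by fun_prop) :
    Measurable fun (a : α) (j : Fin (d + 1)) => liftB d (p a) (w a) j := by
  refine measurable_pi_lambda _ fun j => ?_
  refine Fin.lastCases ?_ (fun j => ?_) j
  · simpa [liftB] using hw
  · simp only [liftB]
    simp
    fun_prop

theorem measurable_liftB_right {d : ℕ} (p : EuclideanSpace ℝ (Fin d)) :
    Measurable fun (w : ℝ) (j : Fin (d + 1)) => liftB d p w j :=
  measurable_liftB measurable_id

/-- Funk–Hecke type formula on the ball, with distinguished coordinate `i`. -/
theorem exists_lintegral_ball_fhInt {d : ℕ} (hd : 1 ≤ d) (κ : Fin (d + 1) → ℝ)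
    (hκ : ∀ i, 0 < κ i) (i : Fin (d + 1)) :
    ∃ C : ENNReal, C ≠ 0 ∧ C ≠ ⊤ ∧ ∀ (X : Fin (d + 1) → ℝ), ∑ j, X j ^ 2 = 1 →
      ∀ g : ℝ → ENNReal, Measurable g →
      ∫⁻ y : EuclideanSpace ℝ (Fin d), ENNReal.ofReal (gw (1 / 2) (1 - ‖y‖ ^ 2)) *
        (fhInt κ i X g (fun j => liftB d y (√(1 - ‖y‖ ^ 2)) j) +
         fhInt κ i X g (fun j => liftB d y (-√(1 - ‖y‖ ^ 2)) j)) =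
      C * ∫⁻ u : ℝ, ENNReal.ofReal (gw (∑ j, κ (i.succAbove j) + d / 2) (1 - u ^ 2)) * g u := by
  obtain ⟨C, hC0, hC1, hC⟩ := exists_lintegral_pi_mY_om (fun j => κ (i.succAbove j)) (fun j => hκ _)
  have hd' : (0:ℝ) < d := by exact_mod_cast hd
  obtain ⟨D, hD0, hD1, hD⟩ := lintegral_Ioi_indicator_rpow (a := (d:ℝ) / 2 + 1 / 2) (by positivity)
  obtain ⟨s, hs⟩ : ∃ s, s = ∑ j, κ (i.succAbove j) := ⟨_, rfl⟩
  have hs0 : 0 ≤ s := hs ▸ Finset.sum_nonneg fun j _ => (hκ _).le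
  refine ⟨2 * C, by simp [hC0], ENNReal.mul_ne_top (by simp) hC1, fun X hX g hg => ?_⟩
  obtain ⟨K, hK⟩ : ∃ K : ℝ → ENNReal, K = fun ρ =>
    (Set.Ioc 0 1).indicator 1 ρ * ENNReal.ofReal (ρ ^ (-s)) := ⟨_, rfl⟩
  have hind : Measurable ((Set.Ioc (0:ℝ) 1).indicator (1 : ℝ → ENNReal)) :=
    measurable_one.indicator measurableSet_Ioc
  have hKm : Measurable K := hK ▸ by fun_prop
  have hX' : √(X i ^ 2 + ∑ j, X (i.succAbove j) ^ 2) = 1 := by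
    rw [← Fin.sum_univ_succAbove (fun j => X j ^ 2) i, hX, Real.sqrt_one]
  have hlaw := hC (X i) (fun j => X (i.succAbove j)) (fun a b => K b * g ((√b)⁻¹ * a))
    (by fun_prop)
  simp only [hX', one_mul] at hlaw
  rw [lintegral_pi_mY_om_eq κ i X (G := fun a b => K b * g ((√b)⁻¹ * a)) (by fun_prop)] at hlaw
  -- the right-hand side
  have hc : 0 < s + (d:ℝ) / 2 := by positivity
  have hR : ∫⁻ p : ℝ, ∫⁻ v, K (p ^ 2 + v) * g ((√(p ^ 2 + v))⁻¹ * p)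
      ∂gam (∑ j, κ (i.succAbove j) + d / 2) =
      D * ∫⁻ u, ENNReal.ofReal (gw (s + d / 2) (1 - u ^ 2)) * g u := by
    rw [← hs]
    have h := lintegral_polar (E := ℝ) (b := s + d / 2) K hKm g hg
    simp only [Real.norm_eq_abs, sq_abs, smul_eq_mul, Module.finrank_self] at h
    have h2 : ∫⁻ p : ℝ, ∫⁻ v, K (p ^ 2 + v) * g ((√(p ^ 2 + v))⁻¹ * p) ∂gam (s + d / 2) =
        ∫⁻ p : ℝ, ∫⁻ v, ENNReal.ofReal (gw (s + d / 2) v) *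
          (K (p ^ 2 + v) * g ((√(p ^ 2 + v))⁻¹ * p)) :=
      lintegral_congr fun p => lintegral_gam hc (by fun_prop)
    rw [h2, h, ← hD]
    congr 1
    refine setLIntegral_congr_fun measurableSet_Ioi fun ρ (hρ : 0 < ρ) => ?_
    simp only [hK]
    rw [mul_left_comm, ← ENNReal.ofReal_mul (by positivity), ← rpow_add hρ, mul_comm]
    congr 3
    push_cast; ring
  -- the left-hand side
  have hL : ∫⁻ Y : Fin (d + 1) → ℝ, fhInt κ i X
        (fun u => K (∑ j, Y j ^ 2) * g ((√(∑ j, Y j ^ 2))⁻¹ * u)) Y =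
      2⁻¹ * (D * ∫⁻ y : EuclideanSpace ℝ (Fin d), ENNReal.ofReal (gw (1 / 2) (1 - ‖y‖ ^ 2)) *
        (fhInt κ i X g (fun j => liftB d y (√(1 - ‖y‖ ^ 2)) j) +
         fhInt κ i X g (fun j => liftB d y (-√(1 - ‖y‖ ^ 2)) j))) := by
    have hm : Measurable fun Y : Fin (d + 1) → ℝ =>
        fhInt κ i X (fun u => K (∑ j, Y j ^ 2) * g ((√(∑ j, Y j ^ 2))⁻¹ * u)) Y := by
      have e : (fun Y : Fin (d + 1) → ℝ =>
        fhInt κ i X (fun u => K (∑ j, Y j ^ 2) * g ((√(∑ j, Y j ^ 2))⁻¹ * u)) Y) = fun Y =>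
          (∏ j, ENNReal.ofReal (|Y (i.succAbove j)| ^ (2 * κ (i.succAbove j)))) *
          ∫⁻ t, K (∑ j, Y j ^ 2) * g ((√(∑ j, Y j ^ 2))⁻¹ *
            (X i * Y i + ∑ j, X (i.succAbove j) * (Y (i.succAbove j) * t j)))
          ∂Measure.pi fun j => om (κ (i.succAbove j)) := rfl
      rw [e]
      refine Measurable.mul (Finset.measurable_prod _ fun j _ => by fun_prop) ?_
      exact Measurable.lintegral_prod_right' (f := fun z : (Fin (d + 1) → ℝ) × (Fin d → ℝ) =>
        K (∑ j, z.1 j ^ 2) * g ((√(∑ j, z.1 j ^ 2))⁻¹ *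
            (X i * z.1 i + ∑ j, X (i.succAbove j) * (z.1 (i.succAbove j) * z.2 j)))) (by fun_prop)
    have hf := measurable_fhInt κ i X hg
    have hF1 : Measurable fun y : EuclideanSpace ℝ (Fin d) =>
        fhInt κ i X g (fun j => liftB d y (√(1 - ‖y‖ ^ 2)) j) :=
      hf.comp (measurable_liftB (by fun_prop))
    have hF2 : Measurable fun y : EuclideanSpace ℝ (Fin d) =>
        fhInt κ i X g (fun j => liftB d y (-√(1 - ‖y‖ ^ 2)) j) :=
      hf.comp (measurable_liftB (by fun_prop))
    have h := lintegral_polar (E := EuclideanSpace ℝ (Fin d)) (b := 1 / 2) _ hind _ (hF1.add hF2)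
    rw [finrank_euclideanSpace_fin, hD] at h
    refine Eq.trans ?_ (congrArg (fun x => 2⁻¹ * x) h)
    rw [lintegral_liftB hm]
    have h3 : ∀ p : EuclideanSpace ℝ (Fin d), ∫⁻ w, fhInt κ i X (fun u =>
        K (∑ j, liftB d p w j ^ 2) * g ((√(∑ j, liftB d p w j ^ 2))⁻¹ * u))
          (fun j => liftB d p w j) = 2⁻¹ * ∫⁻ v, ENNReal.ofReal (gw (1 / 2) v) *
        ((Set.Ioc (0:ℝ) 1).indicator 1 (‖p‖ ^ 2 + v) *
          ((fun y => fhInt κ i X g (fun j => liftB d y (√(1 - ‖y‖ ^ 2)) j)) +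
           fun y => fhInt κ i X g (fun j => liftB d y (-√(1 - ‖y‖ ^ 2)) j))
            ((√(‖p‖ ^ 2 + v))⁻¹ • p)) := by
      intro p
      have hmp := hm.comp (measurable_liftB_right p)
      simp only [Function.comp_def] at hmp
      rw [lintegral_eq_gw_half hmp]
      congr 1
      refine lintegral_congr fun v => ?_
      by_cases hv : 0 < v
      swap
      · simp [gw, hv]
      congr 1
      have hρ : 0 < ‖p‖ ^ 2 + v := by positivity
      obtain ⟨c, hc⟩ : ∃ c, c = √(‖p‖ ^ 2 + v) := ⟨_, rfl⟩
      have hc0 : 0 < c := hc ▸ Real.sqrt_pos.2 hρ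
      have hc2 : c ^ 2 = ‖p‖ ^ 2 + v := by rw [hc, Real.sq_sqrt hρ.le]
      have hv1 : √(1 - ‖c⁻¹ • p‖ ^ 2) = c⁻¹ * √v := by
        have : 1 - ‖c⁻¹ • p‖ ^ 2 = (c⁻¹ * √v) ^ 2 := by
          rw [norm_smul, mul_pow, mul_pow, Real.sq_sqrt hv.le, Real.norm_eq_abs, sq_abs]
          field_simp
          linarith
        rw [this, Real.sqrt_sq (by positivity)]
      have key : ∀ w : ℝ, w ^ 2 = v → fhInt κ i X (fun u =>
          K (∑ j, liftB d p w j ^ 2) * g ((√(∑ j, liftB d p w j ^ 2))⁻¹ * u))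
          (fun j => liftB d p w j) = (Set.Ioc (0:ℝ) 1).indicator 1 (‖p‖ ^ 2 + v) *
            fhInt κ i X g (fun j => liftB d (c⁻¹ • p) (c⁻¹ * w) j) := by
        intro w hw
        rw [fhInt_const_mul _ _ _ _ _ (by fun_prop), sum_sq_liftB, hw, ← hc]
        have e1 : (fun j => liftB d p w j) =
            fun j => c * liftB d (c⁻¹ • p) (c⁻¹ * w) j := by
          ext j
          rw [← liftB_smul, smul_smul, mul_inv_cancel₀ hc0.ne', one_smul, ← mul_assoc,
            mul_inv_cancel₀ hc0.ne', one_mul]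
        rw [e1, fhInt_mul κ i X _ hc0, ← mul_assoc]
        have e2 : (fun u => g (c⁻¹ * (c * u))) = g := by
          ext u; rw [← mul_assoc, inv_mul_cancel₀ hc0.ne', one_mul]
        rw [e2, hK]
        simp only
        rw [mul_assoc ((Set.Ioc (0:ℝ) 1).indicator 1 _), ← ENNReal.ofReal_mul (by positivity), ← hs,
          ← hc2]
        have e3 : (c ^ 2) ^ (-s) * c ^ (2 * s) = 1 := by
          rw [← rpow_natCast, ← rpow_mul hc0.le, ← rpow_add hc0]; norm_num
        rw [e3]; simp
      simp only [Pi.add_apply]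
      rw [key _ (Real.sq_sqrt hv.le), key _ (by rw [neg_sq, Real.sq_sqrt hv.le]), ← hc, hv1,
        mul_add, mul_neg]
    simp_rw [h3]
    rw [lintegral_const_mul']
    simp
  rw [hL, hR] at hlaw
  rw [← hs]
  generalize (∫⁻ y : EuclideanSpace ℝ (Fin d), ENNReal.ofReal (gw (1 / 2) (1 - ‖y‖ ^ 2)) *
        (fhInt κ i X g (fun j => liftB d y (√(1 - ‖y‖ ^ 2)) j) +
         fhInt κ i X g (fun j => liftB d y (-√(1 - ‖y‖ ^ 2)) j))) = L at hlaw ⊢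
  generalize (∫⁻ u : ℝ, ENNReal.ofReal (gw (s + d / 2) (1 - u ^ 2)) * g u) = R at hlaw ⊢
  have h5 : D * L = D * (2 * C * R) := by
    calc D * L = 2 * (2⁻¹ * (D * L)) := by
          rw [← mul_assoc, ENNReal.mul_inv_cancel two_ne_zero (by simp), one_mul]
      _ = _ := by rw [hlaw]; ring
  exact (ENNReal.mul_right_inj hD0 hD1).1 h5

lemma exists_bounds_of_tendsto_pos {u : ℕ → ℝ} {L : ℝ} (hu : ∀ n, 0 < u n) (hL : 0 < L)
    (h : Filter.Tendsto u Filter.atTop (nhds L)) :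
    ∃ c C : ℝ, 0 < c ∧ 0 < C ∧ ∀ n, c ≤ u n ∧ u n ≤ C := by
  obtain ⟨C, hC⟩ := h.bddAbove_range
  obtain ⟨D, hD⟩ := (h.inv₀ hL.ne').bddAbove_range
  have hD' : ∀ n, (u n)⁻¹ ≤ D := fun n => hD ⟨n, rfl⟩
  have hC' : ∀ n, u n ≤ C := fun n => hC ⟨n, rfl⟩
  have hD0 : 0 < D := (inv_pos.2 (hu 0)).trans_le (hD' 0)
  exact ⟨D⁻¹, C, inv_pos.2 hD0, (hu 0).trans_le (hC' 0), fun n =>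
    ⟨inv_le_of_inv_le₀ (hu n) (hD' n), hC' n⟩⟩

lemma cesA_pos {e : ℝ} (he : -1 < e) (n : ℕ) : 0 < cesA e n := by
  rw [cesA_eq_poch]
  have := poch_pos (by linarith : 0 < e + 1) n
  positivity

lemma exists_cesA_bounds {e : ℝ} (he : -1 < e) : ∃ c C : ℝ, 0 < c ∧ 0 < C ∧
    ∀ n : ℕ, c * ((n : ℝ) + 1) ^ e ≤ cesA e n ∧ cesA e n ≤ C * ((n : ℝ) + 1) ^ e := by
  have he1 : 0 < e + 1 := by linarith
  have hpos : ∀ n : ℕ, 0 < cesA e n / ((n : ℝ) + 1) ^ e := fun n =>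
    div_pos (cesA_pos he n) (by positivity)
  have hlim : Filter.Tendsto (fun n : ℕ => cesA e n / ((n : ℝ) + 1) ^ e) Filter.atTop
      (nhds (1 * 1 ^ e / Real.Gamma (e + 1))) := by
    have h1 : Filter.Tendsto (fun n : ℕ => (n : ℝ) / (n + (e + 1))) Filter.atTop (nhds 1) :=
      tendsto_natCast_div_add_atTop (e + 1)
    have h2 : Filter.Tendsto (fun n : ℕ => (n : ℝ) / (n + 1)) Filter.atTop (nhds 1) :=
      tendsto_natCast_div_add_atTop 1
    have h3 := (h1.mul (h2.rpow_const (p := e) (Or.inl one_ne_zero))).div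
      (Real.GammaSeq_tendsto_Gamma (e + 1)) (Real.Gamma_pos_of_pos he1).ne'
    refine h3.congr' ?_
    filter_upwards [Filter.eventually_ge_atTop 1] with n hn
    have hn0 : (0:ℝ) < n := by exact_mod_cast hn
    have hp := poch_pos he1 n
    have hs : ∏ j ∈ Finset.range (n + 1), (e + 1 + (j:ℝ)) = poch (e + 1) n * (e + 1 + n) := by
      rw [Finset.prod_range_succ]; rfl
    simp only [Pi.div_apply, Real.GammaSeq]
    rw [hs, cesA_eq_poch, div_rpow hn0.le (by positivity), rpow_add hn0, rpow_one]
    have : (0:ℝ) < n ^ e := by positivity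
    have : (0:ℝ) < ((n:ℝ) + 1) ^ e := by positivity
    have : (0:ℝ) < e + 1 + n := by positivity
    have : (0:ℝ) < n.factorial := by positivity
    generalize (n.factorial : ℝ) = f at *
    generalize (n : ℝ) ^ e = a at *
    generalize ((n : ℝ) + 1) ^ e = b at *
    rw [show (n:ℝ) + (e + 1) = e + 1 + n by ring]
    field_simp
  obtain ⟨c, C, hc, hC, h⟩ := exists_bounds_of_tendsto_pos hpos
    (by have := Real.Gamma_pos_of_pos he1; positivity) hlim
  refine ⟨c, C, hc, hC, fun n => ?_⟩
  have hn : (0:ℝ) < ((n : ℝ) + 1) ^ e := by positivity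
  exact ⟨(le_div_iff₀ hn).1 (h n).1, (div_le_iff₀ hn).1 (h n).2⟩

theorem ow_pos {κ t : ℝ} (ht : t ∈ Set.Ioo (-1 : ℝ) 1) : 0 < ow κ t := by
  have h1 : 0 < 1 + t := by linarith [ht.1]
  have h2 : 0 < 1 - t ^ 2 := by nlinarith [ht.1, ht.2]
  unfold ow
  rw [if_pos ⟨ht.1, ht.2⟩]
  positivity

theorem ow_eq {κ t : ℝ} (ht : t ∈ Set.Ioo (-1 : ℝ) 1) :
    ow κ t = (1 + t) * ((1 - t) ^ (κ - 1) * (1 + t) ^ (κ - 1)) := by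
  have h1 : 0 ≤ 1 + t := by linarith [ht.1]
  have h2 : 0 ≤ 1 - t := by linarith [ht.2]
  unfold ow
  rw [if_pos ⟨ht.1, ht.2⟩, ← mul_rpow h2 h1]
  congr 2; ring

theorem integral_om {E : Type*} [NormedAddCommGroup E] [NormedSpace ℝ E] (κ : ℝ) (f : ℝ → E) :
    ∫ t, f t ∂om κ = ∫ t in Set.Ioo (-1) 1, ow κ t • f t := by
  rw [om, integral_withDensity_eq_integral_toReal_smul (by fun_prop) (by simp),
    ← integral_indicator measurableSet_Ioo]
  refine integral_congr_ae (Filter.Eventually.of_forall fun t => ?_)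
  by_cases ht : t ∈ Set.Ioo (-1 : ℝ) 1
  · simp [ht, ENNReal.toReal_ofReal (ow_nonneg κ t)]
  · have : ow κ t = 0 := if_neg fun h => ht ⟨h.1, h.2⟩
    simp [ht, this]

theorem lintegral_ow_lt_top {κ : ℝ} (hκ : 0 < κ) : ∫⁻ t, ENNReal.ofReal (ow κ t) < ⊤ := by
  have h : IntegrableOn (ow κ) (Set.Ioo (-1) 1) := by
    have h0 := (intervalIntegrable_iff_integrableOn_Ioo_of_le (by norm_num)).1
      (intervalIntegrable_one_sub_add hκ (4 * (1 + 2 ^ (κ - 1))) (1 + 2 ^ (κ - 1)))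
    refine h0.mono' (by fun_prop) ?_
    refine (ae_restrict_iff' measurableSet_Ioo).2 (Filter.Eventually.of_forall fun t ht => ?_)
    have h1 : 0 < 1 + t := by linarith [ht.1]
    have h2 : 0 < 1 - t := by linarith [ht.2]
    rw [Real.norm_of_nonneg (ow_nonneg _ _), ow_eq ht]
    have key : ∀ x : ℝ, 1 ≤ x → x ≤ 2 → x ^ (κ - 1) ≤ 1 + 2 ^ (κ - 1) := by
      intro x hx hx2
      rcases le_total 0 (κ - 1) with h | h
      · have := rpow_le_rpow (by linarith) hx2 h
        linarith
      · have := rpow_le_one_of_one_le_of_nonpos hx h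
        have : (0:ℝ) < 2 ^ (κ - 1) := by positivity
        linarith
    have hp1 : 0 < (1 + t) ^ (κ - 1) := by positivity
    have hp2 : 0 < (1 - t) ^ (κ - 1) := by positivity
    have hK : (0:ℝ) < 1 + 2 ^ (κ - 1) := by positivity
    have hh : (1 - t) ^ (κ - 1) * (1 + t) ^ (κ - 1) ≤
        (1 + 2 ^ (κ - 1)) * ((1 - t) ^ (κ - 1) + (1 + t) ^ (κ - 1) + (1 + 2 ^ (κ - 1))) := by
      rcases le_total 0 t with h | h
      · have := key (1 + t) (by linarith) (by linarith [ht.2])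
        nlinarith
      · have := key (1 - t) (by linarith) (by linarith [ht.1])
        nlinarith
    calc (1 + t) * ((1 - t) ^ (κ - 1) * (1 + t) ^ (κ - 1))
        ≤ 4 * ((1 + 2 ^ (κ - 1)) * ((1 - t) ^ (κ - 1) + (1 + t) ^ (κ - 1) + (1 + 2 ^ (κ - 1)))) :=
          mul_le_mul (by linarith [ht.2]) hh (by positivity) (by norm_num)
      _ = _ := by ring
  have h1 : ∫⁻ t in Set.Ioo (-1) 1, ENNReal.ofReal (ow κ t) < ⊤ :=
    (hasFiniteIntegral_iff_ofReal (Filter.Eventually.of_forall fun t => ow_nonneg κ t)).1 h.2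
  rwa [setLIntegral_eq_of_support_subset] at h1
  intro t ht
  by_contra hh
  exact ht (by simp [show ow κ t = 0 from if_neg fun h => hh ⟨h.1, h.2⟩])

theorem isFiniteMeasure_om {κ : ℝ} (hκ : 0 < κ) : IsFiniteMeasure (om κ) :=
  ⟨by rw [om, withDensity_apply _ MeasurableSet.univ, Measure.restrict_univ]
      exact lintegral_ow_lt_top hκ⟩

theorem ae_mem_Ioo_om (κ : ℝ) : ∀ᵐ t ∂om κ, t ∈ Set.Ioo (-1 : ℝ) 1 := by
  rw [om, ae_withDensity_iff (by fun_prop)]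
  refine Filter.Eventually.of_forall fun t ht => ?_
  by_contra hh
  exact ht (by simp [show ow κ t = 0 from if_neg fun h => hh ⟨h.1, h.2⟩])

theorem om_univ_ne_zero (κ : ℝ) : om κ Set.univ ≠ 0 := by
  rw [om, withDensity_apply _ MeasurableSet.univ, Measure.restrict_univ]
  intro h
  rw [lintegral_eq_zero_iff (by fun_prop)] at h
  have h1 : volume (Set.Ioo (-1:ℝ) 1) = 0 := by
    refine measure_mono_null (fun t ht => ?_) (show volume _ = 0 from h)
    simpa using ow_pos ht
  norm_num at h1

section
variable {m : ℕ} {κ : Fin m → ℝ}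

theorem isFiniteMeasure_pi_om (hκ : ∀ i, 0 < κ i) :
    IsFiniteMeasure (Measure.pi fun i => om (κ i)) :=
  have := fun i => isFiniteMeasure_om (hκ i)
  inferInstance

theorem ae_mem_Ioo_pi_om (κ : Fin m → ℝ) :
    ∀ᵐ t ∂Measure.pi fun i => om (κ i), ∀ i, t i ∈ Set.Ioo (-1 : ℝ) 1 := by
  rw [ae_all_iff]
  exact fun i => (Measure.quasiMeasurePreserving_eval (μ := fun i => om (κ i)) i).ae
    (ae_mem_Ioo_om (κ i))

theorem integrable_pi_om {E : Type*} [NormedAddCommGroup E] [SecondCountableTopology E]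
    (hκ : ∀ i, 0 < κ i) {f : (Fin m → ℝ) → E} (hf : Continuous f) :
    Integrable f (Measure.pi fun i => om (κ i)) := by
  have := isFiniteMeasure_pi_om hκ
  obtain ⟨C, hC⟩ := (isCompact_univ_pi (s := fun _ : Fin m => Set.Icc (-1:ℝ) 1)
    fun _ => isCompact_Icc).exists_bound_of_continuousOn hf.continuousOn
  refine Integrable.of_bound hf.aestronglyMeasurable C ?_
  filter_upwards [ae_mem_Ioo_pi_om κ] with t ht
  exact hC t fun i _ => Set.Ioo_subset_Icc_self (ht i)

theorem integral_cube_mul_wprod (κ : Fin m → ℝ) (f : (Fin m → ℝ) → ℝ) :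
    ∫ t in cube m, f t * wprod κ t = ∫ t, f t ∂Measure.pi fun i => om (κ i) := by
  have : ∀ i, SigmaFinite ((volume : Measure ℝ).withDensity fun t => ENNReal.ofReal (ow (κ i) t)) :=
    fun i => inferInstanceAs (SigmaFinite (om (κ i)))
  have h := pi_withDensity (fun _ : Fin m => (volume : Measure ℝ))
    (fun i t => ENNReal.ofReal (ow (κ i) t)) fun i => by fun_prop
  change Measure.pi (fun i => om (κ i)) = _ at h
  have hme : Measurable fun x : Fin m → ℝ => ∏ i, ENNReal.ofReal (ow (κ i) (x i)) :=
    Finset.measurable_prod _ fun i _ => by fun_prop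
  have hc : cube m = Set.Icc (fun _ => -1) (fun _ => 1) := Set.pi_univ_Icc _ _
  have hIoo : (Set.univ.pi fun _ : Fin m => Set.Ioo (-1:ℝ) 1) =ᵐ[volume]
      Set.Icc (fun _ => -1) (fun _ => 1) := Measure.univ_pi_Ioo_ae_eq_Icc
  rw [h, ← volume_pi, integral_withDensity_eq_integral_toReal_smul hme
    (Filter.Eventually.of_forall fun x => ENNReal.prod_lt_top fun i _ => by simp), hc,
    ← setIntegral_congr_set hIoo,
    ← integral_indicator (MeasurableSet.univ_pi fun _ => measurableSet_Ioo)]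
  refine integral_congr_ae (Filter.Eventually.of_forall fun t => ?_)
  simp only [ENNReal.toReal_prod, ENNReal.toReal_ofReal (ow_nonneg _ _), smul_eq_mul]
  by_cases ht : t ∈ Set.univ.pi fun _ : Fin m => Set.Ioo (-1:ℝ) 1
  · rw [Set.indicator_of_mem ht, mul_comm]
    congr 1
    exact Finset.prod_congr rfl fun i _ => (if_pos (ht i trivial)).symm
  · rw [Set.indicator_of_notMem ht]
    simp only [Set.mem_pi, not_forall] at ht
    obtain ⟨i, _, hi⟩ := ht
    rw [Finset.prod_eq_zero (Finset.mem_univ i) (if_neg fun h => hi ⟨h.1, h.2⟩), zero_mul]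

theorem integral_cube_wprod_pos (hκ : ∀ i, 0 < κ i) : 0 < ∫ t in cube m, wprod κ t := by
  have h := integral_cube_mul_wprod κ fun _ => 1
  simp only [one_mul] at h
  have := isFiniteMeasure_pi_om hκ
  rw [h, integral_const, smul_eq_mul, mul_one, measureReal_def, ENNReal.toReal_pos_iff]
  refine ⟨?_, measure_lt_top _ _⟩
  rw [Measure.pi_univ]
  exact pos_iff_ne_zero.2 (Finset.prod_ne_zero_iff.2 fun i _ => om_univ_ne_zero _)
end

theorem continuous_gegenC (n : ℕ) {l : ℝ} : Continuous (gegenC n l) := by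
  unfold gegenC jacobiP
  fun_prop

theorem continuous_qker (l δ : ℝ) (n : ℕ) : Continuous (qker l δ n) := by
  unfold qker
  exact continuous_finsetSum _ fun k _ =>
    continuous_const.mul (continuous_const.mul (continuous_gegenC k))

theorem hK_eq (d : ℕ) {κ : Fin (d + 1) → ℝ} (hκ : ∀ i, 0 < κ i) (δ : ℝ) (n : ℕ)
    (x y : EuclideanSpace ℝ (Fin (d + 1))) :
    hK d κ δ n x y = (cesA δ n)⁻¹ * ((∫ t in cube (d + 1), wprod κ t)⁻¹ *
      ∫ t, qker (lamK d κ) δ n (∑ i, x i * y i * t i) ∂Measure.pi fun i => om (κ i)) := by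
  unfold hK hP qker
  congr 1
  rw [integral_finsetSum, Finset.mul_sum]
  · refine Finset.sum_congr rfl fun k _ => ?_
    rw [integral_cube_mul_wprod, integral_const_mul, integral_const_mul]
    ring
  · intro k _
    refine integrable_pi_om hκ ?_
    exact continuous_const.mul (continuous_const.mul
      ((continuous_gegenC k).comp (by fun_prop)))

theorem lamK_eq (d : ℕ) (κ : Fin (d + 1) → ℝ) (i : Fin (d + 1)) :
    lamK d κ - κ i = ∑ j, κ (i.succAbove j) + (d - 1) / 2 := by
  rw [lamK, Fin.sum_univ_succAbove _ i]; ring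

theorem lamK_sub_pos {d : ℕ} (hd : 1 ≤ d) {κ : Fin (d + 1) → ℝ} (hκ : ∀ i, 0 < κ i)
    (i : Fin (d + 1)) : 0 < lamK d κ - κ i := by
  rw [lamK_eq]
  have h1 : (1:ℝ) ≤ d := by exact_mod_cast hd
  have : 0 < ∑ j, κ (i.succAbove j) :=
    Finset.sum_pos (fun j _ => hκ _) ⟨⟨0, hd⟩, Finset.mem_univ _⟩
  linarith

theorem lamK_pos {d : ℕ} (hd : 1 ≤ d) {κ : Fin (d + 1) → ℝ} (hκ : ∀ i, 0 < κ i) :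
    0 < lamK d κ := by
  linarith [lamK_sub_pos hd hκ 0, hκ 0]

theorem lamK_sub_le_sigmaK (d : ℕ) (κ : Fin (d + 1) → ℝ) (i : Fin (d + 1)) :
    lamK d κ - κ i ≤ sigmaK d κ := by
  have := Finset.inf'_le κ (Finset.mem_univ i)
  rw [lamK, sigmaK]; linarith

theorem exists_lamK_sub_eq_sigmaK (d : ℕ) (κ : Fin (d + 1) → ℝ) :
    ∃ i, lamK d κ - κ i = sigmaK d κ ∧ ∀ j, κ i ≤ κ j := by
  obtain ⟨i, _, hi⟩ := Finset.exists_mem_eq_inf' (Finset.univ_nonempty (α := Fin (d + 1))) κ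
  refine ⟨i, by rw [lamK, sigmaK, hi]; ring, fun j => hi ▸ Finset.inf'_le κ (Finset.mem_univ j)⟩

theorem smul_ow_eq_mul_cwt {κ t : ℝ} (ht : t ∈ Set.Ioo (-1 : ℝ) 1) (z : ℂ) :
    ow κ t • z = z * cwt 1 κ t := by
  have h1 : 0 ≤ 1 + t := by linarith [ht.1]
  have h2 : 0 ≤ 1 - t := by linarith [ht.2]
  rw [ow_eq ht, cwt, Complex.real_smul]
  push_cast [Complex.ofReal_cpow h1, Complex.ofReal_cpow h2]
  ring

theorem exists_integral_om_cpow_le {k m : ℝ} (hk : 0 < k) (hkm : k < m) :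
    ∃ C : ℝ, 0 < C ∧ ∀ a : ℝ, ∀ B : ℂ, 0 < B.im →
      |a| ^ k * ‖∫ t, (B - a * t) ^ (-m : ℂ) ∂om k‖ ≤
        C * (‖B - a‖ ^ (k - m) + ‖B + a‖ ^ (k - m)) := by
  obtain ⟨C, hC, h⟩ := exists_norm_integral_cpow_le hk hkm
  refine ⟨C, hC, fun a B hB => ?_⟩
  have e : ∫ t : ℝ, (B - a * t) ^ (-m : ℂ) ∂om k =
      ∫ u : ℝ in (-1)..1, (B - a * u) ^ (-m : ℂ) * cwt 1 k u := by
    rw [integral_om, intervalIntegral.integral_of_le (by norm_num), integral_Ioc_eq_integral_Ioo]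
    exact setIntegral_congr_fun measurableSet_Ioo fun t ht => smul_ow_eq_mul_cwt ht _
  have e' : ∀ b : ℝ, 0 < b → b ^ k * (C * (b ^ (-k) * (‖B - b‖ ^ (k - m) + ‖B + b‖ ^ (k - m)))) =
      C * (‖B - b‖ ^ (k - m) + ‖B + b‖ ^ (k - m)) := by
    intro b hb
    have : b ^ k * b ^ (-k) = 1 := by rw [← rpow_add hb, add_neg_cancel, rpow_zero]
    calc _ = (b ^ k * b ^ (-k)) * (C * (‖B - b‖ ^ (k - m) + ‖B + b‖ ^ (k - m))) := by ring
      _ = _ := by rw [this, one_mul]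
  rcases lt_trichotomy a 0 with ha | rfl | ha
  · have hb : 0 < -a := by linarith
    have h1 := h (-1) (by norm_num) (-a) hb B hB
    rw [abs_of_neg ha]
    have e2 : ∫ u : ℝ in (-1)..1, (B - a * u) ^ (-m : ℂ) * cwt 1 k u =
        ∫ u : ℝ in (-1)..1, (B - (-a : ℝ) * u) ^ (-m : ℂ) * cwt (-1 : ℝ) k u := by
      have := intervalIntegral.integral_comp_neg (a := -1) (b := 1)
        (f := fun u : ℝ => (B - a * u) ^ (-m : ℂ) * cwt 1 k u)
      rw [neg_neg] at this
      rw [← this]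
      refine intervalIntegral.integral_congr fun u _ => ?_
      simp only [cwt]
      push_cast
      simp only [mul_neg, neg_mul, sub_neg_eq_add, one_mul]
      rw [mul_comm ((1 + (u:ℂ)) ^ _)]
      rfl
    rw [e, e2]
    have h3 := mul_le_mul_of_nonneg_left h1 (rpow_nonneg hb.le k)
    refine h3.trans (le_of_eq ?_)
    rw [e' _ hb]
    push_cast
    rw [sub_neg_eq_add, ← sub_eq_add_neg, add_comm]
  · rw [abs_zero, zero_rpow hk.ne', zero_mul]; positivity
  · rw [abs_of_pos ha, e, ← e' a ha]
    have h1 := h 1 (by norm_num) a ha B hB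
    exact mul_le_mul_of_nonneg_left h1 (rpow_nonneg ha.le k)

theorem continuous_sub_ofReal_cpow {T : Type*} [TopologicalSpace T] {A : ℂ} (hA : 0 < A.im) (m : ℂ)
    {f : T → ℝ} (hf : Continuous f) : Continuous fun t => (A - f t) ^ m := by
  refine Continuous.cpow (by fun_prop) continuous_const fun t => ?_
  right; simp [hA.ne']

theorem enorm_integral_pi_om_le {m : ℕ} {κ : Fin (m + 1) → ℝ} (hκ : ∀ i, 0 < κ i)
    (i : Fin (m + 1)) {f : (Fin (m + 1) → ℝ) → ℂ} (hf : Continuous f) :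
    ‖∫ t, f t ∂Measure.pi fun i => om (κ i)‖ₑ ≤
      ∫⁻ y, ‖∫ a, f (i.insertNth a y) ∂om (κ i)‖ₑ ∂Measure.pi fun j => om (κ (i.succAbove j)) := by
  have := fun i => isFiniteMeasure_om (hκ i)
  have hmp := (measurePreserving_piFinSuccAbove (fun i => om (κ i)) i).symm
  have hi : Integrable f (Measure.pi fun i => om (κ i)) := integrable_pi_om hκ hf
  have hi2 := (hmp.integrable_comp_emb (MeasurableEquiv.measurableEmbedding _)).2 hi
  rw [← hmp.integral_comp' f, integral_prod_symm _ (by simpa only [Function.comp_def] using hi2)]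
  exact enorm_integral_le_lintegral_enorm _

theorem exists_prod_mul_enorm_integral_le {d : ℕ} (hd : 1 ≤ d) {κ : Fin (d + 1) → ℝ}
    (hκ : ∀ i, 0 < κ i) (i : Fin (d + 1)) :
    ∃ C : ENNReal, C ≠ ⊤ ∧ ∀ X Y : Fin (d + 1) → ℝ, 1 / ((d : ℝ) + 1) ≤ X i ^ 2 → |Y i| ≤ 1 →
      ∀ A : ℂ, 0 < A.im →
      (∏ j, ENNReal.ofReal (|Y j| ^ (2 * κ j))) *
        ‖∫ t : Fin (d + 1) → ℝ, (A - (∑ j, X j * Y j * t j : ℝ)) ^ (-(lamK d κ + 1 : ℝ) : ℂ)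
          ∂Measure.pi fun i => om (κ i)‖ₑ ≤
      C * (fhInt κ i X (fun u => ENNReal.ofReal (‖A - u‖ ^ (κ i - (lamK d κ + 1)))) Y +
        fhInt κ i (Function.update X i (-X i))
          (fun u => ENNReal.ofReal (‖A - u‖ ^ (κ i - (lamK d κ + 1)))) Y) := by
  obtain ⟨C, hC, h⟩ := exists_integral_om_cpow_le (hκ i)
    (by linarith [lamK_sub_pos hd hκ i] : κ i < lamK d κ + 1)
  obtain ⟨m, hm⟩ : ∃ m, m = lamK d κ + 1 := ⟨_, rfl⟩
  rw [← hm] at h ⊢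
  have hd0 : (0:ℝ) < (d : ℝ) + 1 := by positivity
  obtain ⟨D, hD⟩ : ∃ D, D = (1 / ((d : ℝ) + 1)) ^ (-(κ i / 2)) := ⟨_, rfl⟩
  have hD0 : 0 < D := hD ▸ by positivity
  refine ⟨ENNReal.ofReal (D * C), by simp, fun X Y hX hY A hA => ?_⟩
  -- the factor `|Y i| ^ (2 κ i)` compensates the singular factor
  have hYi : |Y i| ^ (2 * κ i) ≤ D * |X i * Y i| ^ κ i := by
    have h1 : 1 ≤ D * |X i| ^ κ i := by
      have e : |X i| ^ κ i = (X i ^ 2) ^ (κ i / 2) := by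
        rw [← sq_abs, ← rpow_natCast, ← rpow_mul (abs_nonneg _)]
        congr 1; push_cast; ring
      rw [hD, rpow_neg (by positivity), e, inv_mul_eq_div, one_le_div (by positivity)]
      exact rpow_le_rpow (by positivity) hX (by linarith [hκ i])
    have h2 : |Y i| ^ (2 * κ i) ≤ |Y i| ^ κ i :=
      rpow_le_rpow_of_exponent_ge' (abs_nonneg _) hY (hκ i).le (by linarith [hκ i])
    rw [abs_mul, mul_rpow (abs_nonneg _) (abs_nonneg _), ← mul_assoc]
    exact h2.trans (le_mul_of_one_le_left (by positivity) h1)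
  have hcont : Continuous fun t : Fin (d + 1) → ℝ =>
      (A - (∑ j, X j * Y j * t j : ℝ)) ^ (-(m : ℝ) : ℂ) :=
    continuous_sub_ofReal_cpow hA _ (f := fun t : Fin (d + 1) → ℝ => ∑ j, X j * Y j * t j)
      (by fun_prop)
  have h3 := enorm_integral_pi_om_le hκ i hcont
  -- the inner integral
  have h4 : ∀ y : Fin d → ℝ, ENNReal.ofReal (|Y i| ^ (2 * κ i)) *
      ‖∫ a, (A - (∑ j, X j * Y j * (i.insertNth (α := fun _ => ℝ) a y) j : ℝ)) ^ (-(m : ℝ) : ℂ)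
        ∂om (κ i)‖ₑ ≤ ENNReal.ofReal (D * C) *
      (ENNReal.ofReal (‖A - (X i * Y i +
          ∑ j, X (i.succAbove j) * (Y (i.succAbove j) * y j) : ℝ)‖ ^ (κ i - m)) +
        ENNReal.ofReal (‖A - (-X i * Y i +
          ∑ j, X (i.succAbove j) * (Y (i.succAbove j) * y j) : ℝ)‖ ^ (κ i - m))) := by
    intro y
    obtain ⟨S, hS⟩ : ∃ S, S = ∑ j, X (i.succAbove j) * (Y (i.succAbove j) * y j) := ⟨_, rfl⟩
    have e1 : ∀ a : ℝ, A - (∑ j, X j * Y j * (i.insertNth (α := fun _ => ℝ) a y) j : ℝ) =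
        (A - S) - (X i * Y i : ℝ) * a := by
      intro a
      rw [Fin.sum_univ_succAbove _ i]
      simp only [Fin.insertNth_apply_same, Fin.insertNth_apply_succAbove, mul_assoc, hS]
      push_cast
      ring
    simp only [e1, ← hS]
    have h5 := h (X i * Y i) (A - S) (by simpa using hA)
    rw [← ENNReal.ofReal_add (by positivity) (by positivity), ← ENNReal.ofReal_mul (by positivity),
      ← ofReal_norm, ← ENNReal.ofReal_mul (by positivity)]
    refine ENNReal.ofReal_le_ofReal ?_
    refine (mul_le_mul_of_nonneg_right hYi (norm_nonneg _)).trans ?_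
    rw [mul_assoc, mul_assoc]
    refine mul_le_mul_of_nonneg_left (h5.trans (le_of_eq ?_)) hD0.le
    congr 2 <;> congr 2 <;> push_cast <;> ring
  calc _ = (∏ j, ENNReal.ofReal (|Y (i.succAbove j)| ^ (2 * κ (i.succAbove j)))) *
        (ENNReal.ofReal (|Y i| ^ (2 * κ i)) * ‖∫ t : Fin (d + 1) → ℝ,
          (A - (∑ j, X j * Y j * t j : ℝ)) ^ (-(m : ℝ) : ℂ) ∂Measure.pi fun i => om (κ i)‖ₑ) := by
        rw [Fin.prod_univ_succAbove _ i]; ring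
    _ ≤ (∏ j, ENNReal.ofReal (|Y (i.succAbove j)| ^ (2 * κ (i.succAbove j)))) *
        ∫⁻ y, ENNReal.ofReal (D * C) * (ENNReal.ofReal (‖A - (X i * Y i +
          ∑ j, X (i.succAbove j) * (Y (i.succAbove j) * y j) : ℝ)‖ ^ (κ i - m)) +
        ENNReal.ofReal (‖A - (-X i * Y i +
          ∑ j, X (i.succAbove j) * (Y (i.succAbove j) * y j) : ℝ)‖ ^ (κ i - m)))
        ∂Measure.pi fun j => om (κ (i.succAbove j)) := by
        gcongr
        refine (mul_le_mul_right h3 _).trans ?_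
        rw [← lintegral_const_mul' _ _ (by simp)]
        exact lintegral_mono h4
    _ = _ := by
        unfold fhInt
        rw [lintegral_const_mul' _ _ (by simp), lintegral_add_left (by fun_prop)]
        simp only [Function.update_self, Function.update_of_ne (Fin.succAbove_ne i _)]
        ring

theorem setLIntegral_mul_fhInt {d : ℕ} (κ : Fin (d + 1) → ℝ) (i : Fin (d + 1))
    (X Y : Fin (d + 1) → ℝ) {S : Set ℝ} {q : ℝ → ENNReal} (hq : Measurable q)
    {g : ℝ → ℝ → ENNReal} (hg : Measurable (Function.uncurry g)) :
    ∫⁻ φ in S, q φ * fhInt κ i X (g φ) Y = fhInt κ i X (fun u => ∫⁻ φ in S, q φ * g φ u) Y := by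
  have hfin : (∏ j, ENNReal.ofReal (|Y (i.succAbove j)| ^ (2 * κ (i.succAbove j)))) ≠ ⊤ :=
    (ENNReal.prod_lt_top fun j _ => by simp).ne
  have hm : Measurable fun z : ℝ × (Fin d → ℝ) => q z.1 *
      g z.1 (X i * Y i + ∑ j, X (i.succAbove j) * (Y (i.succAbove j) * z.2 j)) :=
    (by fun_prop : Measurable fun z : ℝ × (Fin d → ℝ) => q z.1).mul (hg.comp (f :=
        fun z : ℝ × (Fin d → ℝ) =>
      (z.1, X i * Y i + ∑ j, X (i.succAbove j) * (Y (i.succAbove j) * z.2 j))) (by fun_prop))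
  unfold fhInt
  simp only
  rw [← lintegral_lintegral_swap hm.aemeasurable, ← lintegral_const_mul' _ _ hfin]
  refine lintegral_congr fun φ => ?_
  rw [lintegral_const_mul, mul_left_comm]
  exact hg.comp (f := fun z : Fin d → ℝ =>
      (φ, X i * Y i + ∑ j, X (i.succAbove j) * (Y (i.succAbove j) * z j))) (by fun_prop)

theorem ofReal_WB_eq {d : ℕ} (κ : Fin (d + 1) → ℝ) {y : EuclideanSpace ℝ (Fin d)} (hy : ‖y‖ < 1)
    {w : ℝ} (hw : w ^ 2 = 1 - ‖y‖ ^ 2) :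
    ENNReal.ofReal (WB d κ y) = ENNReal.ofReal (gw (1 / 2) (1 - ‖y‖ ^ 2)) *
      ∏ j, ENNReal.ofReal (|liftB d y w j| ^ (2 * κ j)) := by
  have h1 : 0 < 1 - ‖y‖ ^ 2 := by nlinarith [norm_nonneg y]
  rw [← ENNReal.ofReal_prod_of_nonneg fun j _ => by positivity,
    ← ENNReal.ofReal_mul (gw_nonneg _ _), Fin.prod_univ_castSucc, WB, gw, if_pos h1]
  congr 1
  have h2 : ∀ j : Fin d, liftB d y w j.castSucc = y j := fun j => by simp [liftB]
  have h3 : liftB d y w (Fin.last d) = w := by simp [liftB]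
  simp only [h2, h3]
  have h4 : |w| ^ (2 * κ (Fin.last d)) = (1 - ‖y‖ ^ 2) ^ κ (Fin.last d) := by
    rw [← hw, ← sq_abs, ← rpow_natCast, ← rpow_mul (abs_nonneg _)]
    norm_num
  rw [h4, mul_left_comm, ← rpow_add h1]
  congr 2; ring

theorem setLIntegral_closedBall_mul_WB {d : ℕ} (hd : 1 ≤ d) (κ : Fin (d + 1) → ℝ)
    (F : EuclideanSpace ℝ (Fin d) → ENNReal) :
    ∫⁻ y in Metric.closedBall 0 1, F y * ENNReal.ofReal (WB d κ y) =
      ∫⁻ y in Metric.ball 0 1, F y * ENNReal.ofReal (WB d κ y) := by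
  have : Nontrivial (EuclideanSpace ℝ (Fin d)) := by
    have : Nonempty (Fin d) := ⟨⟨0, hd⟩⟩
    infer_instance
  refine (setLIntegral_congr ?_).symm
  refine ae_eq_of_subset_of_measure_ge Metric.ball_subset_closedBall ?_
    measurableSet_ball.nullMeasurableSet measure_closedBall_lt_top.ne
  rw [Measure.addHaar_closedBall_eq_addHaar_ball]

theorem setLIntegral_ball_add_eq {d : ℕ} (κ : Fin (d + 1) → ℝ)
    (F₁ F₂ : EuclideanSpace ℝ (Fin d) → ENNReal) :
    ∫⁻ y in Metric.ball 0 1, (F₁ y + F₂ y) * ENNReal.ofReal (WB d κ y) =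
      ∫⁻ y, ENNReal.ofReal (gw (1 / 2) (1 - ‖y‖ ^ 2)) *
        ((∏ j, ENNReal.ofReal (|liftB d y (√(1 - ‖y‖ ^ 2)) j| ^ (2 * κ j))) * F₁ y +
         (∏ j, ENNReal.ofReal (|liftB d y (-√(1 - ‖y‖ ^ 2)) j| ^ (2 * κ j))) * F₂ y) := by
  rw [← lintegral_indicator measurableSet_ball]
  refine lintegral_congr fun y => ?_
  by_cases hy : ‖y‖ < 1
  · have h1 : 0 ≤ 1 - ‖y‖ ^ 2 := by nlinarith [norm_nonneg y]
    rw [Set.indicator_of_mem (by simpa using hy), mul_add,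
      ← mul_assoc, ← mul_assoc, ← ofReal_WB_eq κ hy (Real.sq_sqrt h1),
      ← ofReal_WB_eq κ hy (by rw [neg_sq, Real.sq_sqrt h1])]
    ring
  · rw [Set.indicator_of_notMem (by simpa using hy)]
    have : gw (1 / 2) (1 - ‖y‖ ^ 2) = 0 := if_neg (by nlinarith)
    rw [this, ENNReal.ofReal_zero, zero_mul]

/-- The weight of the contour integral representing the kernel. -/
noncomputable def qwt (δ l r : ℝ) (n : ℕ) (φ : ℝ) : ENNReal :=
  ‖(1 + zc r φ) * (1 - zc r φ) ^ (-δ : ℂ) * (zc r φ)⁻¹ ^ n * (2 * zc r φ) ^ (-(l + 1 : ℝ) : ℂ)‖ₑ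

@[fun_prop] theorem measurable_zc (r : ℝ) : Measurable (zc r) := (continuous_zc r).measurable

@[fun_prop] theorem measurable_qwt (δ l r : ℝ) (n : ℕ) : Measurable (qwt δ l r n) := by
  unfold qwt
  fun_prop

/-- The quantity controlling the Cesàro kernel in the direction of the `i`-th coordinate. -/
noncomputable def bigJ (s δ l r : ℝ) (n : ℕ) : ENNReal :=
  ∫⁻ φ in Set.Ioo 0 π, qwt δ l r n φ *
    ∫⁻ u : ℝ, ENNReal.ofReal (gw (s + 1 / 2) (1 - u ^ 2)) *
      ENNReal.ofReal (‖zA r φ - u‖ ^ (-(s + 1)))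

theorem abs_sum_mul_mul_le {m : ℕ} {X Y t : Fin m → ℝ} (hX : ∑ j, X j ^ 2 = 1)
    (hY : ∑ j, Y j ^ 2 = 1) (ht : ∀ j, |t j| ≤ 1) : |∑ j, X j * Y j * t j| ≤ 1 := by
  calc |∑ j, X j * Y j * t j| ≤ ∑ j, |X j * Y j * t j| := Finset.abs_sum_le_sum_abs _ _
    _ ≤ ∑ j, (X j ^ 2 + Y j ^ 2) / 2 := Finset.sum_le_sum fun j _ => by
        rw [abs_mul]
        refine (mul_le_of_le_one_right (abs_nonneg _) (ht j)).trans ?_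
        rw [abs_mul, ← sq_abs (X j), ← sq_abs (Y j)]
        nlinarith [sq_nonneg (|X j| - |Y j|)]
    _ = 1 := by rw [← Finset.sum_div, Finset.sum_add_distrib, hX, hY]; norm_num

theorem exists_prod_mul_enorm_hK_le {d : ℕ} (hd : 1 ≤ d) {κ : Fin (d + 1) → ℝ}
    (hκ : ∀ i, 0 < κ i) {δ : ℝ} (hδ : -1 < δ) (i : Fin (d + 1)) :
    ∃ C : ENNReal, C ≠ ⊤ ∧ ∀ x y : EuclideanSpace ℝ (Fin (d + 1)), ∑ j, x j ^ 2 = 1 →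
      ∑ j, y j ^ 2 = 1 → 1 / ((d : ℝ) + 1) ≤ x i ^ 2 → ∀ r : ℝ, 0 < r → r < 1 → ∀ n : ℕ,
      (∏ j, ENNReal.ofReal (|y j| ^ (2 * κ j))) * ‖hK d κ δ n x y‖ₑ ≤
      C * ENNReal.ofReal (cesA δ n)⁻¹ *
        (fhInt κ i (fun j => x j) (fun u => ∫⁻ φ in Set.Ioo 0 π, qwt δ (lamK d κ) r n φ *
            ENNReal.ofReal (‖zA r φ - u‖ ^ (κ i - (lamK d κ + 1)))) (fun j => y j) +
          fhInt κ i (Function.update (fun j => x j) i (-x i))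
            (fun u => ∫⁻ φ in Set.Ioo 0 π, qwt δ (lamK d κ) r n φ *
            ENNReal.ofReal (‖zA r φ - u‖ ^ (κ i - (lamK d κ + 1)))) (fun j => y j)) := by
  obtain ⟨C, hC, h⟩ := exists_prod_mul_enorm_integral_le hd hκ i
  obtain ⟨w, hw⟩ : ∃ w, w = ∫ t in cube (d + 1), wprod κ t := ⟨_, rfl⟩
  refine ⟨C * ENNReal.ofReal w⁻¹, ENNReal.mul_ne_top hC (by simp),
    fun x y hx hy hxi r hr hr1 n => ?_⟩
  have hw0 : 0 < w := hw ▸ integral_cube_wprod_pos hκ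
  have := isFiniteMeasure_pi_om hκ
  have hyi : |y i| ≤ 1 := by
    rw [abs_le_one_iff_mul_self_le_one, ← sq, ← hy]
    exact Finset.single_le_sum (f := fun j => y j ^ 2) (fun j _ => sq_nonneg _) (Finset.mem_univ i)
  have hU1 : ∀ᵐ t ∂Measure.pi fun i => om (κ i), ∑ j, x j * y j * t j ∈ Set.Icc (-1 : ℝ) 1 := by
    filter_upwards [ae_mem_Ioo_pi_om κ] with t ht
    exact abs_le.1 (abs_sum_mul_mul_le hx hy fun j => abs_le.2 ⟨(ht j).1.le, (ht j).2.le⟩)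
  have h1 := enorm_integral_qker_le (Measure.pi fun i => om (κ i))
    (U := fun t => ∑ j, x j * y j * t j) (by fun_prop) hU1 (lamK_pos hd hκ) δ hr hr1 n
  have hA := cesA_pos hδ n
  have hq : ‖hK d κ δ n x y‖ₑ ≤ ENNReal.ofReal (cesA δ n)⁻¹ * (ENNReal.ofReal w⁻¹ *
      ∫⁻ φ in Set.Ioo 0 π, qwt δ (lamK d κ) r n φ *
        ‖∫ t : Fin (d + 1) → ℝ, (zA r φ - (∑ j, x j * y j * t j : ℝ)) ^ (-(lamK d κ + 1 : ℝ) : ℂ)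
          ∂Measure.pi fun i => om (κ i)‖ₑ) := by
    rw [hK_eq d hκ, ← hw, enorm_mul, enorm_mul, Real.enorm_of_nonneg (by positivity),
      Real.enorm_of_nonneg (by positivity)]
    gcongr
    exact h1
  have hpr : (∏ j, ENNReal.ofReal (|y j| ^ (2 * κ j))) ≠ ⊤ :=
    ENNReal.prod_ne_top fun j _ => ENNReal.ofReal_ne_top
  have hgm : Measurable (Function.uncurry fun φ u : ℝ =>
      ENNReal.ofReal (‖zA r φ - u‖ ^ (κ i - (lamK d κ + 1)))) := by
    unfold Function.uncurry zA
    fun_prop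
  refine (mul_le_mul_right hq (∏ j, ENNReal.ofReal (|y j| ^ (2 * κ j)))).trans ?_
  calc (∏ j, ENNReal.ofReal (|y j| ^ (2 * κ j))) * (ENNReal.ofReal (cesA δ n)⁻¹ *
      (ENNReal.ofReal w⁻¹ *
      ∫⁻ φ in Set.Ioo 0 π, qwt δ (lamK d κ) r n φ *
        ‖∫ t : Fin (d + 1) → ℝ, (zA r φ - (∑ j, x j * y j * t j : ℝ)) ^ (-(lamK d κ + 1 : ℝ) : ℂ)
          ∂Measure.pi fun i => om (κ i)‖ₑ))
    _ = ENNReal.ofReal w⁻¹ * ENNReal.ofReal (cesA δ n)⁻¹ * ∫⁻ φ in Set.Ioo 0 π,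
      qwt δ (lamK d κ) r n φ *
        ((∏ j, ENNReal.ofReal (|y j| ^ (2 * κ j))) *
        ‖∫ t : Fin (d + 1) → ℝ, (zA r φ - (∑ j, x j * y j * t j : ℝ)) ^ (-(lamK d κ + 1 : ℝ) : ℂ)
          ∂Measure.pi fun i => om (κ i)‖ₑ) := by
        simp_rw [mul_left_comm (qwt _ _ _ _ _) (∏ j, _)]
        rw [lintegral_const_mul' _ _ hpr]
        ring
    _ ≤ ENNReal.ofReal w⁻¹ * ENNReal.ofReal (cesA δ n)⁻¹ * ∫⁻ φ in Set.Ioo 0 π,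
        C * (qwt δ (lamK d κ) r n φ * fhInt κ i (fun j => x j) (fun u =>
            ENNReal.ofReal (‖zA r φ - u‖ ^ (κ i - (lamK d κ + 1))))
            (fun j => y j) +
          qwt δ (lamK d κ) r n φ * fhInt κ i (Function.update (fun j => x j) i (-x i))
            (fun u => ENNReal.ofReal (‖zA r φ - u‖ ^ (κ i - (lamK d κ + 1)))) (fun j => y j)) := by
        refine mul_le_mul_right (setLIntegral_mono' measurableSet_Ioo fun φ hφ => ?_) _
        rw [← mul_add, mul_left_comm C]
        refine mul_le_mul_right ?_ _
        exact h (fun j => x j) (fun j => y j) hxi hyi _ (zA_im_pos hr hr1 hφ)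
    _ = _ := by
        have e : ∀ X : Fin (d + 1) → ℝ, Measurable fun φ => fhInt κ i X
            (fun u => ENNReal.ofReal (‖zA r φ - u‖ ^ (κ i - (lamK d κ + 1)))) (fun j => y j) := by
          intro X
          unfold fhInt
          refine measurable_const.mul ?_
          refine Measurable.lintegral_prod_right' (f := fun z : ℝ × (Fin d → ℝ) =>
            ENNReal.ofReal (‖zA r z.1 -
            (X i * y i + ∑ j, X (i.succAbove j) * (y (i.succAbove j) * z.2 j) : ℝ)‖ ^
              (κ i - (lamK d κ + 1)))) ?_
          unfold zA
          fun_prop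
        have hqe : ∀ X : Fin (d + 1) → ℝ, Measurable fun φ => qwt δ (lamK d κ) r n φ * fhInt κ i X
            (fun u => ENNReal.ofReal (‖zA r φ - u‖ ^ (κ i - (lamK d κ + 1)))) (fun j => y j) :=
          fun X => (measurable_qwt _ _ _ _).mul (e X)
        rw [lintegral_const_mul' _ _ hC, lintegral_add_left (hqe _),
          setLIntegral_mul_fhInt κ i _ _ (measurable_qwt _ _ _ _) hgm,
          setLIntegral_mul_fhInt κ i _ _ (measurable_qwt _ _ _ _) hgm]
        ring

theorem exists_setLIntegral_ballK_le {d : ℕ} (hd : 1 ≤ d) {κ : Fin (d + 1) → ℝ}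
    (hκ : ∀ i, 0 < κ i) {δ : ℝ} (hδ : -1 < δ) (i : Fin (d + 1)) :
    ∃ C : ENNReal, C ≠ ⊤ ∧ ∀ x : EuclideanSpace ℝ (Fin d), ‖x‖ ≤ 1 →
      1 / ((d : ℝ) + 1) ≤ liftB d x (√(1 - ‖x‖ ^ 2)) i ^ 2 → ∀ r : ℝ, 0 < r → r < 1 → ∀ n : ℕ,
      ∫⁻ y in Metric.closedBall 0 1, ‖ballK d κ δ n x y‖ₑ * ENNReal.ofReal (WB d κ y) ≤
      C * ENNReal.ofReal (cesA δ n)⁻¹ * bigJ (lamK d κ - κ i) δ (lamK d κ) r n := by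
  obtain ⟨C, hC, h⟩ := exists_prod_mul_enorm_hK_le hd hκ hδ i
  obtain ⟨D, _, hD, h2⟩ := exists_lintegral_ball_fhInt hd κ hκ i
  refine ⟨C * (2 * D), ENNReal.mul_ne_top hC (ENNReal.mul_ne_top (by simp) hD),
    fun x hx hxi r hr hr1 n => ?_⟩
  obtain ⟨X, hX⟩ : ∃ X, X = liftB d x (√(1 - ‖x‖ ^ 2)) := ⟨_, rfl⟩
  have hx2 : 0 ≤ 1 - ‖x‖ ^ 2 := by nlinarith [norm_nonneg x]
  have hXs : ∑ j, X j ^ 2 = 1 := by rw [hX, sum_sq_liftB, Real.sq_sqrt hx2]; ring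
  have hXs' : ∑ j, (Function.update (fun j => X j) i (-X i)) j ^ 2 = 1 := by
    rw [← hXs]
    refine Finset.sum_congr rfl fun j _ => ?_
    rcases eq_or_ne j i with rfl | hj
    · simp
    · simp [hj]
  rw [← hX] at hxi
  obtain ⟨G, hG⟩ : ∃ G : ℝ → ENNReal, G = fun u : ℝ => ∫⁻ φ in Set.Ioo 0 π, qwt δ (lamK d κ) r n φ *
            ENNReal.ofReal (‖zA r φ - u‖ ^ (κ i - (lamK d κ + 1))) := ⟨_, rfl⟩
  have hzm : Measurable (zA r) := by unfold zA; fun_prop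
  have hgm : Measurable fun z : ℝ × ℝ => qwt δ (lamK d κ) r n z.1 *
      ENNReal.ofReal (‖zA r z.1 - z.2‖ ^ (κ i - (lamK d κ + 1))) := by fun_prop
  have hGm : Measurable G := by
    rw [hG]
    exact hgm.lintegral_prod_left'
  have hbound : ∀ y : EuclideanSpace ℝ (Fin d), ‖y‖ < 1 → ∀ w : ℝ, w ^ 2 = 1 - ‖y‖ ^ 2 →
      (∏ j, ENNReal.ofReal (|liftB d y w j| ^ (2 * κ j))) * ‖hK d κ δ n X (liftB d y w)‖ₑ ≤
      C * ENNReal.ofReal (cesA δ n)⁻¹ * (fhInt κ i (fun j => X j) G (fun j => liftB d y w j) +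
          fhInt κ i (Function.update (fun j => X j) i (-X i)) G (fun j => liftB d y w j)) := by
    intro y hy w hw
    rw [hG]
    exact h X (liftB d y w) hXs (by rw [sum_sq_liftB, hw]; ring) hxi r hr hr1 n
  have hf := fun X => measurable_fhInt κ i X hGm
  have hF1 : ∀ X, Measurable fun y : EuclideanSpace ℝ (Fin d) =>
      fhInt κ i X G (fun j => liftB d y (√(1 - ‖y‖ ^ 2)) j) :=
    fun X => (hf X).comp (measurable_liftB (by fun_prop))
  have hF2 : ∀ X, Measurable fun y : EuclideanSpace ℝ (Fin d) =>
      fhInt κ i X G (fun j => liftB d y (-√(1 - ‖y‖ ^ 2)) j) :=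
    fun X => (hf X).comp (measurable_liftB (by fun_prop))
  rw [setLIntegral_closedBall_mul_WB hd]
  calc _ ≤ ∫⁻ y in Metric.ball 0 1, (‖hK d κ δ n X (liftB d y (√(1 - ‖y‖ ^ 2)))‖ₑ +
          ‖hK d κ δ n X (liftB d y (-√(1 - ‖y‖ ^ 2)))‖ₑ) * ENNReal.ofReal (WB d κ y) := by
        refine lintegral_mono fun y => ?_
        gcongr
        rw [ballK, ← hX]
        obtain ⟨a, ha⟩ : ∃ a, a = hK d κ δ n X (liftB d y (√(1 - ‖y‖ ^ 2))) := ⟨_, rfl⟩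
        obtain ⟨b, hb⟩ : ∃ b, b = hK d κ δ n X (liftB d y (-√(1 - ‖y‖ ^ 2))) := ⟨_, rfl⟩
        rw [← ha, ← hb]
        refine le_trans ?_ (enorm_add_le a b)
        rw [Real.enorm_eq_ofReal_abs, Real.enorm_eq_ofReal_abs, abs_div, abs_two]
        exact ENNReal.ofReal_le_ofReal (by linarith [abs_nonneg (a + b)])
    _ ≤ ∫⁻ y : EuclideanSpace ℝ (Fin d), C * ENNReal.ofReal (cesA δ n)⁻¹ *
        (ENNReal.ofReal (gw (1 / 2) (1 - ‖y‖ ^ 2)) *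
          (fhInt κ i (fun j => X j) G (fun j => liftB d y (√(1 - ‖y‖ ^ 2)) j) +
            fhInt κ i (fun j => X j) G (fun j => liftB d y (-√(1 - ‖y‖ ^ 2)) j)) +
        ENNReal.ofReal (gw (1 / 2) (1 - ‖y‖ ^ 2)) *
          (fhInt κ i (Function.update (fun j => X j) i (-X i)) G
              (fun j => liftB d y (√(1 - ‖y‖ ^ 2)) j) +
            fhInt κ i (Function.update (fun j => X j) i (-X i)) G
              (fun j => liftB d y (-√(1 - ‖y‖ ^ 2)) j))) := by
        rw [setLIntegral_ball_add_eq]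
        refine lintegral_mono fun y => ?_
        by_cases hy : ‖y‖ < 1
        · have h1 : 0 ≤ 1 - ‖y‖ ^ 2 := by nlinarith [norm_nonneg y]
          refine (mul_le_mul_right (add_le_add (hbound y hy _ (Real.sq_sqrt h1))
            (hbound y hy _ (by rw [neg_sq, Real.sq_sqrt h1]))) _).trans (le_of_eq ?_)
          ring
        · have : gw (1 / 2) (1 - ‖y‖ ^ 2) = 0 := if_neg (by nlinarith)
          rw [this, ENNReal.ofReal_zero, zero_mul, zero_mul, zero_mul, add_zero, mul_zero]
    _ = C * ENNReal.ofReal (cesA δ n)⁻¹ * (2 * (D *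
          ∫⁻ u : ℝ, ENNReal.ofReal (gw (∑ j, κ (i.succAbove j) + d / 2) (1 - u ^ 2)) * G u)) := by
        rw [lintegral_const_mul' _ _ (ENNReal.mul_ne_top hC (by simp)), lintegral_add_left,
          h2 _ hXs _ hGm, h2 _ hXs' _ hGm, two_mul]
        exact Measurable.mul (by fun_prop) ((hF1 _).add (hF2 _))
    _ = _ := by
        have hJ : ∫⁻ u : ℝ, ENNReal.ofReal (gw (∑ j, κ (i.succAbove j) + d / 2) (1 - u ^ 2)) * G u =
            bigJ (lamK d κ - κ i) δ (lamK d κ) r n := by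
          have e1 : ∑ j, κ (i.succAbove j) + (d : ℝ) / 2 = lamK d κ - κ i + 1 / 2 := by
            rw [lamK_eq]; ring
          have e2 : κ i - (lamK d κ + 1) = -(lamK d κ - κ i + 1) := by ring
          rw [hG, bigJ]
          simp_rw [← lintegral_const_mul' _ _ ENNReal.ofReal_ne_top]
          rw [lintegral_lintegral_swap (f := fun u φ => ENNReal.ofReal (gw (∑ j,
            κ (i.succAbove j) + d / 2) (1 - u ^ 2)) * (qwt δ (lamK d κ) r n φ *
            ENNReal.ofReal (‖zA r φ - u‖ ^ (κ i - (lamK d κ + 1)))))]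
          · refine lintegral_congr fun φ => ?_
            simp_rw [mul_left_comm _ (qwt _ _ _ _ _)]
            rw [lintegral_const_mul _ (by fun_prop), e1, e2]
          · have := (hgm.comp measurable_swap)
            simp only [Function.comp_def, Prod.fst_swap, Prod.snd_swap] at this
            exact (Measurable.mul (by fun_prop) this).aemeasurable
        rw [hJ]; ring

theorem lintegral_gw_eq_sin (s : ℝ) (g : ℝ → ENNReal) :
    ∫⁻ u : ℝ, ENNReal.ofReal (gw (s + 1 / 2) (1 - u ^ 2)) * g u =
      ∫⁻ ρ in Set.Ioo 0 π, ENNReal.ofReal (sin ρ ^ (2 * s)) * g (cos ρ) := by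
  have him : cos '' Set.Ioo 0 π = Set.Ioo (-1) 1 := by
    ext u
    constructor
    · rintro ⟨ρ, hρ, rfl⟩
      have h := sin_pos_of_mem_Ioo hρ
      have := sin_sq_add_cos_sq ρ
      rw [Set.mem_Ioo, ← abs_lt, ← sq_lt_one_iff_abs_lt_one]
      nlinarith
    · rintro ⟨h1, h2⟩
      exact ⟨arccos u, ⟨arccos_pos.2 h2, arccos_lt_pi.2 h1⟩, cos_arccos h1.le h2.le⟩
  have hinj : Set.InjOn cos (Set.Ioo 0 π) := injOn_cos.mono Set.Ioo_subset_Icc_self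
  have h1 : ∫⁻ u : ℝ, ENNReal.ofReal (gw (s + 1 / 2) (1 - u ^ 2)) * g u =
      ∫⁻ u in Set.Ioo (-1) 1, ENNReal.ofReal (gw (s + 1 / 2) (1 - u ^ 2)) * g u := by
    rw [← lintegral_indicator measurableSet_Ioo]
    refine lintegral_congr fun u => ?_
    by_cases hu : u ∈ Set.Ioo (-1 : ℝ) 1
    · rw [Set.indicator_of_mem hu]
    · rw [Set.indicator_of_notMem hu, gw, if_neg, ENNReal.ofReal_zero, zero_mul]
      rw [Set.mem_Ioo, ← abs_lt, ← sq_lt_one_iff_abs_lt_one] at hu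
      linarith
  rw [h1, ← him, lintegral_image_eq_lintegral_abs_deriv_mul measurableSet_Ioo
    (fun x _ => (hasDerivAt_cos x).hasDerivWithinAt) hinj]
  refine setLIntegral_congr_fun measurableSet_Ioo fun ρ hρ => ?_
  have hs := sin_pos_of_mem_Ioo hρ
  have e : 1 - cos ρ ^ 2 = sin ρ ^ 2 := by rw [← sin_sq_add_cos_sq ρ]; ring
  rw [← mul_assoc, ← ENNReal.ofReal_mul (abs_nonneg _), e, gw, if_pos (by positivity), abs_neg,
    abs_of_pos hs, ← rpow_natCast, ← rpow_mul hs.le, mul_comm (sin ρ), ← rpow_add_one hs.ne']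
  congr 3
  push_cast
  ring

theorem two_mul_div_pi_sq_le_one_sub_cos {x : ℝ} (hx : |x| ≤ π) : 2 * (x / π) ^ 2 ≤ 1 - cos x := by
  have h1 : 2 / π * (|x| / 2) ≤ sin (|x| / 2) := mul_le_sin (by positivity) (by linarith)
  have h2 : cos x = 1 - 2 * sin (|x| / 2) ^ 2 := by
    have h := cos_two_mul (|x| / 2)
    rw [mul_div_cancel₀ _ (two_ne_zero' ℝ), cos_abs] at h
    linarith [sin_sq_add_cos_sq (|x| / 2)]
  have h3 : (2 / π * (|x| / 2)) ^ 2 ≤ sin (|x| / 2) ^ 2 := by gcongr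
  have h4 : (2 / π * (|x| / 2)) ^ 2 = (x / π) ^ 2 := by
    rw [div_pow x, ← sq_abs x]; field_simp
  linarith

theorem norm_zc_sub_zc_sq (r φ ρ : ℝ) :
    ‖zc r φ - zc 1 ρ‖ ^ 2 = (1 - r) ^ 2 + 2 * r * (1 - cos (φ - ρ)) := by
  rw [← Complex.normSq_eq_norm_sq, Complex.normSq_apply, zc_eq, zc_eq]
  simp only [Complex.sub_re, Complex.sub_im, Complex.mul_re, Complex.mul_im, Complex.ofReal_re,
    Complex.ofReal_im, Complex.I_re, Complex.I_im]
  rw [cos_sub]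
  linear_combination r ^ 2 * sin_sq_add_cos_sq φ + sin_sq_add_cos_sq ρ

theorem zA_sub_cos {r : ℝ} (hr : 0 < r) (φ ρ : ℝ) :
    zA r φ - (cos ρ : ℝ) = (zc r φ - zc 1 ρ) * (zc r φ - zc 1 (-ρ)) / (2 * zc r φ) := by
  have h0 := zc_ne_zero hr φ
  have h1 : zc 1 ρ + zc 1 (-ρ) = 2 * (cos ρ : ℝ) := by
    rw [zc_eq, zc_eq, cos_neg, sin_neg]; push_cast; ring
  have h2 : zc 1 ρ * zc 1 (-ρ) = 1 := by
    rw [zc, zc, mul_mul_mul_comm, ← Complex.exp_add]; simp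
  have h3 : (zc r φ - zc 1 ρ) * (zc r φ - zc 1 (-ρ)) =
      zc r φ * zc r φ - 2 * (cos ρ : ℝ) * zc r φ + 1 := by
    linear_combination h2 - zc r φ * h1
  rw [h3, zA]
  field_simp
  ring

theorem add_abs_sub_le_norm_zc_sub_zc {r φ ρ : ℝ} (hr : 1 / 2 ≤ r) 
    (h : |φ - ρ| ≤ π) : (|φ - ρ| + (1 - r)) / 4 ≤ ‖zc r φ - zc 1 ρ‖ := by
  refine le_of_sq_le_sq ?_ (norm_nonneg _)
  rw [norm_zc_sub_zc_sq]
  have h1 := two_mul_div_pi_sq_le_one_sub_cos h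
  have h2 : (|φ - ρ| / 4) ^ 2 ≤ ((φ - ρ) / π) ^ 2 := by
    rw [div_pow, div_pow, sq_abs]
    gcongr
    exact pi_le_four
  nlinarith [sq_nonneg (|φ - ρ| - (1 - r))]

theorem sin_le_norm_zc_sub_zc {r φ ρ : ℝ} (hr : 1 / 2 ≤ r) (hφ : 0 ≤ sin φ) (hρ : 0 ≤ sin ρ) :
    (sin φ + sin ρ) / 2 ≤ ‖zc r φ - zc 1 (-ρ)‖ := by
  refine le_trans ?_ (Complex.abs_im_le_norm _)
  rw [zc_eq, zc_eq]
  simp only [Complex.sub_im, Complex.mul_im, Complex.ofReal_re,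
    Complex.ofReal_im, Complex.I_re, Complex.I_im, sin_neg]
  refine le_trans ?_ (neg_le_abs _)
  nlinarith

theorem norm_zc_sub_zc_le {r φ ρ : ℝ} (hr : 0 ≤ r) (hφ : 0 ≤ sin φ) (hρ : 0 ≤ sin ρ) :
    ‖zc r φ - zc 1 ρ‖ ≤ ‖zc r φ - zc 1 (-ρ)‖ := by
  refine le_of_sq_le_sq ?_ (norm_nonneg _)
  rw [norm_zc_sub_zc_sq, norm_zc_sub_zc_sq, sub_neg_eq_add, cos_add, cos_sub]
  nlinarith [mul_nonneg hr (mul_nonneg hφ hρ)]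

theorem sin_rpow_mul_norm_zA_sub_le {s r φ ρ : ℝ} (hs : 0 < s) (hr : 1 / 2 ≤ r) (hr1 : r < 1)
    (hφ : φ ∈ Set.Ioo 0 π) (hρ : ρ ∈ Set.Ioo 0 π) :
    sin ρ ^ (2 * s) * ‖zA r φ - (cos ρ : ℝ)‖ ^ (-(s + 1)) ≤
      128 ^ (s + 1) * 4 ^ max (s - 1) 0 * ((sin φ + (1 - r)) ^ (s - 1) *
        (1 - r) ^ (-max (s - 1) 0)) * (|φ - ρ| + (1 - r)) ^ (max (s - 1) 0 - s - 1) := by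
  obtain ⟨e, he⟩ : ∃ e, e = 1 - r := ⟨_, rfl⟩
  obtain ⟨p, hp⟩ : ∃ p, p = max (s - 1) 0 := ⟨_, rfl⟩
  have hp0 : 0 ≤ p := hp ▸ le_max_right _ _
  have he0 : 0 < e := by linarith
  have hsφ := sin_pos_of_mem_Ioo hφ
  have hsρ := sin_pos_of_mem_Ioo hρ
  have habs : |φ - ρ| ≤ π := by
    rw [abs_le]; constructor <;> linarith [hφ.1, hφ.2, hρ.1, hρ.2]
  have hE := add_abs_sub_le_norm_zc_sub_zc hr habs
  have hD1 := norm_zc_sub_zc_le (r := r) (by linarith) hsφ.le hsρ.le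
  have hD2 := sin_le_norm_zc_sub_zc hr hsφ.le hsρ.le
  have hsd : |sin φ - sin ρ| ≤ |φ - ρ| := by
    have := abs_sin_sub_sin_le φ ρ
    exact this
  rw [zA_sub_cos (by linarith), norm_div, norm_mul, norm_mul, norm_zc (by linarith)]
  rw [← he] at hE ⊢
  rw [← hp]
  obtain ⟨E, hE'⟩ : ∃ E, E = ‖zc r φ - zc 1 ρ‖ := ⟨_, rfl⟩
  obtain ⟨D, hD'⟩ : ∃ D, D = ‖zc r φ - zc 1 (-ρ)‖ := ⟨_, rfl⟩
  obtain ⟨h, hh⟩ : ∃ h, h = |φ - ρ| + e := ⟨_, rfl⟩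
  obtain ⟨m, hm⟩ : ∃ m, m = sin φ + e := ⟨_, rfl⟩
  obtain ⟨M, hM⟩ : ∃ M, M = sin ρ + m + h := ⟨_, rfl⟩
  rw [← hE', ← hD', ← hh, ← hm]
  rw [← hE', ← hD'] at hD1
  rw [← hE', ← hh] at hE
  rw [← hD'] at hD2
  have hhe : e ≤ h := by linarith [abs_nonneg (φ - ρ)]
  have hme : e ≤ m := by linarith
  have hM8 : M / 16 ≤ D := by linarith
  have hMm : M ≤ m * (4 * h / e) := by
    have h1 : M ≤ 2 * (m + h) := by linarith [(abs_le.1 hsd).1, (abs_le.1 hsd).2]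
    rw [mul_div_assoc', le_div_iff₀ he0]
    nlinarith [mul_le_mul hme hhe he0.le (by linarith),
      mul_nonneg (sub_nonneg.2 hhe) (sub_nonneg.2 hme)]
  have hh0 : 0 < h := by linarith
  have hm0 : 0 < m := by linarith
  have hM0 : 0 < M := by linarith
  have hE0 : 0 ≤ E := by linarith
  have hD0 : 0 ≤ D := by linarith
  have hr0 : 0 < r := by linarith
  have hq : h * M / 128 ≤ E * D / (‖(2 : ℂ)‖ * r) := by
    rw [Complex.norm_two, le_div_iff₀ (by positivity)]
    have : h / 4 * (M / 16) ≤ E * D := by gcongr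
    nlinarith [mul_pos hh0 hM0]
  calc sin ρ ^ (2 * s) * (E * D / (‖(2 : ℂ)‖ * r)) ^ (-(s + 1))
      ≤ M ^ (2 * s) * (h * M / 128) ^ (-(s + 1)) := by
        have h1 : sin ρ ≤ M := by linarith
        have h2 := rpow_le_rpow_of_nonpos (by positivity) hq (show -(s + 1) ≤ 0 by linarith)
        gcongr
    _ = 128 ^ (s + 1) * M ^ (s - 1) * h ^ (-(s + 1)) := by
        rw [div_rpow (by positivity) (by norm_num), mul_rpow hh0.le hM0.le,
          rpow_neg (by norm_num : (0 : ℝ) ≤ 128), div_inv_eq_mul,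
          show s - 1 = 2 * s + -(s + 1) by ring, rpow_add hM0]
        ring
    _ ≤ 128 ^ (s + 1) * (m ^ (s - 1) * (4 * h / e) ^ p) * h ^ (-(s + 1)) := by
        gcongr
        have h1 : 1 ≤ M / m := by rw [le_div_iff₀ hm0]; linarith
        calc M ^ (s - 1) = m ^ (s - 1) * (M / m) ^ (s - 1) := by
              rw [← mul_rpow hm0.le (by positivity), mul_div_cancel₀ _ hm0.ne']
          _ ≤ m ^ (s - 1) * (M / m) ^ p := by
              gcongr
              exact hp ▸ le_max_left _ _
          _ ≤ _ := by
              refine mul_le_mul_of_nonneg_left (rpow_le_rpow (by positivity) ?_ hp0) (by positivity)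
              rw [div_le_iff₀ hm0]; linarith
    _ = _ := by
        rw [div_rpow (by positivity) he0.le, mul_rpow (by norm_num) hh0.le, rpow_neg he0.le p,
          show p - s - 1 = p + -(s + 1) by ring, rpow_add hh0]
        ring

theorem lintegral_Ioo_le_of_add {f : ℝ → ENNReal} {e b : ℝ} (hb : π + e ≤ b) :
    ∫⁻ φ in Set.Ioo 0 π, f (φ + e) ≤ ∫⁻ τ in Set.Ioc e b, f τ := by
  rw [← lintegral_indicator measurableSet_Ioo, ← lintegral_indicator measurableSet_Ioc,
    ← lintegral_add_right_eq_self (μ := volume) ((Set.Ioc e b).indicator f) e]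
  refine lintegral_mono fun φ => ?_
  by_cases h : φ ∈ Set.Ioo 0 π
  · rw [Set.indicator_of_mem h, Set.indicator_of_mem]
    exact ⟨by linarith [h.1], by linarith [h.2]⟩
  · simp [Set.indicator_of_notMem h]

theorem lintegral_Ioo_le_of_sub {f : ℝ → ENNReal} {e b : ℝ} (hb : π + e ≤ b) :
    ∫⁻ φ in Set.Ioo 0 π, f (π - φ + e) ≤ ∫⁻ τ in Set.Ioc e b, f τ := by
  rw [← lintegral_indicator measurableSet_Ioo, ← lintegral_indicator measurableSet_Ioc,
    ← lintegral_sub_left_eq_self (μ := volume) ((Set.Ioc e b).indicator f) (π + e)]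
  refine lintegral_mono fun φ => ?_
  by_cases h : φ ∈ Set.Ioo 0 π
  · rw [Set.indicator_of_mem h, Set.indicator_of_mem, add_sub_right_comm]
    exact ⟨by linarith [h.2], by linarith [h.1]⟩
  · simp [Set.indicator_of_notMem h]

theorem lintegral_abs_sub_add_rpow_le {e q : ℝ} (he : 0 < e) (hq : 0 < q) (φ : ℝ) :
    ∫⁻ ρ in Set.Ioo 0 π, ENNReal.ofReal ((|φ - ρ| + e) ^ (-q - 1)) ≤
      ENNReal.ofReal (2 * (e ^ (-q) / q)) := by
  have h1 : ∫⁻ x in Set.Ioi (0 : ℝ), ENNReal.ofReal ((|x| + e) ^ (-q - 1)) =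
      ENNReal.ofReal (e ^ (-q) / q) := by
    rw [← lintegral_Ioi_rpow he hq, ← lintegral_indicator measurableSet_Ioi,
      ← lintegral_indicator measurableSet_Ioi,
      ← lintegral_add_right_eq_self (μ := volume) ((Set.Ioi e).indicator _) e]
    refine lintegral_congr fun x => ?_
    by_cases hx : 0 < x
    · rw [Set.indicator_of_mem (Set.mem_Ioi.2 hx), Set.indicator_of_mem, abs_of_pos hx]
      exact lt_add_of_pos_left e hx
    · rw [Set.indicator_of_notMem (by simpa using hx), Set.indicator_of_notMem]
      simp [hx]
  calc _ ≤ ∫⁻ ρ, ENNReal.ofReal ((|φ - ρ| + e) ^ (-q - 1)) := setLIntegral_le_lintegral _ _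
    _ = ∫⁻ x, ENNReal.ofReal ((|x| + e) ^ (-q - 1)) :=
      lintegral_sub_left_eq_self (fun x => ENNReal.ofReal ((|x| + e) ^ (-q - 1))) φ
    _ = _ := by
      rw [lintegral_eq_Ioi_add_neg _ (by fun_prop)]
      simp only [abs_neg]
      rw [lintegral_add_left (by fun_prop), h1,
        ← ENNReal.ofReal_add (by positivity) (by positivity), two_mul]

theorem rpow_le_of_le_mul {a b c : ℝ} (ha : 0 < a) (hb : 0 < b) (hc : 1 ≤ c) (h1 : b ≤ c * a)
    (h2 : a ≤ c * b) (t : ℝ) : b ^ t ≤ c ^ |t| * a ^ t := by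
  rcases le_total 0 t with ht | ht
  · rw [abs_of_nonneg ht, ← mul_rpow (by positivity) ha.le]
    gcongr
  · rw [abs_of_nonpos ht, rpow_neg (by positivity), ← inv_rpow (by positivity),
      ← mul_rpow (by positivity) ha.le]
    refine rpow_le_rpow_of_nonpos (by positivity) ?_ ht
    rw [inv_mul_le_iff₀ (by positivity)]
    exact h2

theorem lintegral_gw_norm_zA_le {s : ℝ} (hs : 0 < s) :
    ∃ C : ℝ, 0 ≤ C ∧ ∀ r φ : ℝ, 1 / 2 ≤ r → r < 1 → φ ∈ Set.Ioo 0 π →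
      ∫⁻ u : ℝ, ENNReal.ofReal (gw (s + 1 / 2) (1 - u ^ 2)) *
        ENNReal.ofReal (‖zA r φ - u‖ ^ (-(s + 1))) ≤
      ENNReal.ofReal (C * ((sin φ + (1 - r)) ^ (s - 1) * (1 - r) ^ (-s))) := by
  obtain ⟨p, hp⟩ : ∃ p, p = max (s - 1) 0 := ⟨_, rfl⟩
  have hps : 0 < s - p := by
    rw [hp, sub_pos]; exact max_lt (by linarith) hs
  refine ⟨128 ^ (s + 1) * 4 ^ p * (2 / (s - p)), by positivity, fun r φ hr hr1 hφ => ?_⟩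
  have he : 0 < 1 - r := by linarith
  have hsφ := sin_pos_of_mem_Ioo hφ
  rw [lintegral_gw_eq_sin]
  calc _ ≤ ∫⁻ ρ in Set.Ioo 0 π, ENNReal.ofReal (128 ^ (s + 1) * 4 ^ p *
        ((sin φ + (1 - r)) ^ (s - 1) * (1 - r) ^ (-p))) *
        ENNReal.ofReal ((|φ - ρ| + (1 - r)) ^ (-(s - p) - 1)) := by
        refine setLIntegral_mono' measurableSet_Ioo fun ρ hρ => ?_
        have hsρ := sin_pos_of_mem_Ioo hρ
        rw [← ENNReal.ofReal_mul (by positivity), ← ENNReal.ofReal_mul (by positivity),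
          neg_sub, hp]
        exact ENNReal.ofReal_le_ofReal (sin_rpow_mul_norm_zA_sub_le hs hr hr1 hφ hρ)
    _ ≤ _ := by
        rw [lintegral_const_mul' _ _ ENNReal.ofReal_ne_top]
        refine (mul_le_mul_right (lintegral_abs_sub_add_rpow_le he hps φ) _).trans ?_
        rw [← ENNReal.ofReal_mul (by positivity)]
        refine ENNReal.ofReal_le_ofReal (le_of_eq ?_)
        rw [show -s = -p + -(s - p) by ring, rpow_add he]
        ring

theorem norm_one_sub_zc_bounds {r φ : ℝ} (hr : 1 / 2 ≤ r) (hr1 : r < 1) (hφ : φ ∈ Set.Ioo 0 π) :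
    φ + (1 - r) ≤ 4 * ‖1 - zc r φ‖ ∧ ‖1 - zc r φ‖ ≤ 4 * (φ + (1 - r)) := by
  have e1 : zc 1 0 = 1 := by simp [zc]
  rw [norm_sub_rev, ← e1]
  constructor
  · have := add_abs_sub_le_norm_zc_sub_zc (ρ := 0) hr (by
      rw [sub_zero, abs_of_pos hφ.1]; exact hφ.2.le)
    rw [sub_zero, abs_of_pos hφ.1] at this
    linarith
  · refine le_of_sq_le_sq ?_ (by linarith [hφ.1])
    rw [norm_zc_sub_zc_sq, sub_zero]
    nlinarith [one_sub_sq_div_two_le_cos (x := φ), hφ.1, sq_nonneg φ, cos_le_one φ]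

theorem qwt_le {δ l r φ : ℝ} {n : ℕ} (hl : 0 < l) (hr : 1 / 2 ≤ r) (hr1 : r < 1)
    (hrn : 1 / 4 ≤ r ^ n) (hφ : φ ∈ Set.Ioo 0 π) :
    qwt δ l r n φ ≤ ENNReal.ofReal (8 * 4 ^ |δ| * (φ + (1 - r)) ^ (-δ)) := by
  have hr0 : 0 < r := by linarith
  have h0 := hφ.1
  obtain ⟨h1, h2⟩ := norm_one_sub_zc_bounds hr hr1 hφ
  rw [qwt, ← ofReal_norm]
  refine ENNReal.ofReal_le_ofReal ?_
  rw [norm_mul, norm_mul, norm_mul, norm_pow, norm_inv, norm_zc hr0.le, ← Complex.ofReal_neg,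
    ← Complex.ofReal_neg, Complex.norm_cpow_real, Complex.norm_cpow_real, norm_mul,
    norm_zc hr0.le, Complex.norm_two]
  have h3 : ‖1 + zc r φ‖ ≤ 2 := (norm_add_le _ _).trans (by
    rw [norm_one, norm_zc hr0.le]; linarith)
  have h4 : r⁻¹ ^ n ≤ 4 := by
    rw [inv_pow]; exact inv_le_of_inv_le₀ (by norm_num) (by linarith)
  have h5 : (2 * r) ^ (-(l + 1)) ≤ 1 := rpow_le_one_of_one_le_of_nonpos (by linarith) (by linarith)
  have h6 := rpow_le_of_le_mul (a := φ +
      (1 - r)) (by linarith) (by linarith) (by norm_num) h2 h1 (-δ)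
  rw [abs_neg] at h6
  have h7 : 0 ≤ ‖1 - zc r φ‖ ^ (-δ) := by positivity
  calc _ ≤ 2 * (4 ^ |δ| * (φ + (1 - r)) ^ (-δ)) * 4 * 1 := by gcongr
    _ = _ := by ring

theorem add_rpow_mul_sin_rpow_le {δ s σ : ℝ} (hsσ : s ≤ σ) :
    ∃ C : ℝ, 0 ≤ C ∧ ∀ e φ : ℝ, 0 < e → e ≤ 1 / 2 → φ ∈ Set.Ioo 0 π →
      (φ + e) ^ (-δ) * ((sin φ + e) ^ (s - 1) * e ^ (-s)) ≤
        C * e ^ (-σ) * ((φ + e) ^ (σ - δ - 1) + (π - φ + e) ^ (σ - 1)) := by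
  refine ⟨4 ^ |-δ| * 2 ^ |s - 1|, by positivity, fun e φ he he2 hφ => ?_⟩
  have hsφ := sin_pos_of_mem_Ioo hφ
  have hφ0 := hφ.1
  have hφ1 : 0 < π - φ := by linarith [hφ.2]
  have key : ∀ x t : ℝ, 0 < x → (x + e) ^ (s - t) * e ^ (-s) ≤ e ^ (-σ) * (x + e) ^ (σ - t) := by
    intro x t hx
    have hxe : 0 < x + e := by linarith
    have : e ^ (σ - s) ≤ (x + e) ^ (σ - s) :=
      rpow_le_rpow he.le (by linarith) (by linarith)
    calc (x + e) ^ (s - t) * e ^ (-s) = (x + e) ^ (s - t) * e ^ (-σ) * e ^ (σ - s) := by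
          rw [mul_assoc, ← rpow_add he]; ring_nf
      _ ≤ (x + e) ^ (s - t) * e ^ (-σ) * (x + e) ^ (σ - s) := by gcongr
      _ = _ := by
          rw [show σ - t = (s - t) + (σ - s) by ring, rpow_add hxe]; ring
  have hpi2 : ∀ x, 0 ≤ x → x / 2 ≤ 2 / π * x := by
    intro x hx
    have : (1 : ℝ) / 2 ≤ 2 / π := by
      rw [div_le_div_iff₀ (by norm_num) pi_pos]; linarith [pi_le_four]
    nlinarith
  rcases le_total φ (π / 2) with h | h
  · have h1 := (hpi2 φ hφ0.le).trans (mul_le_sin hφ0.le h)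
    have h2 := sin_le hφ0.le
    have h3 := rpow_le_of_le_mul (a := φ + e) (b := sin φ + e) (c := 2) (by linarith) (by linarith)
      (by norm_num) (by linarith) (by linarith) (s - 1)
    have h4 := key φ (δ + 1) hφ0
    have hc : (1 : ℝ) ≤ 4 ^ |-δ| := one_le_rpow (by norm_num) (abs_nonneg _)
    calc (φ + e) ^ (-δ) * ((sin φ + e) ^ (s - 1) * e ^ (-s))
        ≤ (φ + e) ^ (-δ) * ((2 ^ |s - 1| * (φ + e) ^ (s - 1)) * e ^ (-s)) := by gcongr
      _ = 1 * 2 ^ |s - 1| * ((φ + e) ^ (s - (δ + 1)) * e ^ (-s)) := by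
          rw [show s - (δ + 1) = -δ + (s - 1) by ring, rpow_add (by linarith)]; ring
      _ ≤ 4 ^ |-δ| * 2 ^ |s - 1| * (e ^ (-σ) * (φ + e) ^ (σ - (δ + 1))) := by gcongr
      _ ≤ 4 ^ |-δ| * 2 ^ |s - 1| * (e ^ (-σ) * ((φ + e) ^ (σ - δ - 1) + (π - φ + e) ^ (σ - 1))) :=
        by
          rw [sub_add_eq_sub_sub]
          gcongr
          exact le_add_of_nonneg_right (by positivity)
      _ = _ := by ring
  · have h0 : π - φ ≤ π / 2 := by linarith
    have h1 := (hpi2 (π - φ) hφ1.le).trans (mul_le_sin hφ1.le h0)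
    have h2 := sin_le hφ1.le
    rw [sin_pi_sub] at h1 h2
    have h3 := rpow_le_of_le_mul (a := π - φ + e) (b := sin φ + e) (c := 2) (by linarith)
      (by linarith) (by norm_num) (by linarith) (by linarith) (s - 1)
    have h4 := key (π - φ) 1 hφ1
    have h5 := rpow_le_of_le_mul (a := 1) (b := φ + e) (c := 4) (by linarith) (by linarith)
      (by norm_num) (by linarith [hφ.2, pi_lt_d2]) (by linarith [pi_gt_three]) (-δ)
    rw [one_rpow, mul_one] at h5
    calc (φ + e) ^ (-δ) * ((sin φ + e) ^ (s - 1) * e ^ (-s))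
        ≤ 4 ^ |-δ| * ((2 ^ |s - 1| * (π - φ + e) ^ (s - 1)) * e ^ (-s)) := by gcongr
      _ = 4 ^ |-δ| * 2 ^ |s - 1| * ((π - φ + e) ^ (s - 1) * e ^ (-s)) := by ring
      _ ≤ 4 ^ |-δ| * 2 ^ |s - 1| * (e ^ (-σ) * (π - φ + e) ^ (σ - 1)) := by gcongr
      _ ≤ 4 ^ |-δ| * 2 ^ |s - 1| * (e ^ (-σ) * ((φ + e) ^ (σ - δ - 1) + (π - φ + e) ^ (σ - 1))) :=
        by
          gcongr
          exact le_add_of_nonneg_left (by positivity)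
      _ = _ := by ring

theorem exists_bigJ_le {s σ δ l : ℝ} (hs : 0 < s) (hsσ : s ≤ σ) (hl : 0 < l) :
    ∃ C : ENNReal, C ≠ ⊤ ∧ ∀ (r : ℝ) (n : ℕ), 1 / 2 ≤ r → r < 1 → 1 / 4 ≤ r ^ n →
      bigJ s δ l r n ≤ C * ENNReal.ofReal ((1 - r) ^ (-σ)) *
        ((∫⁻ τ in Set.Ioc (1 - r) 5, ENNReal.ofReal (τ ^ (σ - δ - 1))) + 1) := by
  obtain ⟨C₁, hC₁, h₁⟩ := lintegral_gw_norm_zA_le hs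
  obtain ⟨C₂, hC₂, h₂⟩ := add_rpow_mul_sin_rpow_le (δ := δ) hsσ
  have hσ : 0 < σ := by linarith
  obtain ⟨K, hK⟩ : ∃ K, K = 8 * 4 ^ |δ| * C₁ * C₂ := ⟨_, rfl⟩
  have hK0 : 0 ≤ K := by rw [hK]; positivity
  obtain ⟨B, hB⟩ : ∃ B : ENNReal, B = ENNReal.ofReal (5 ^ σ / σ) := ⟨_, rfl⟩
  refine ⟨ENNReal.ofReal K * (1 + B), ENNReal.mul_ne_top (by simp) (by simp [hB]),
    fun r n hr hr1 hrn => ?_⟩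
  have he : 0 < 1 - r := by linarith
  have hpi : π + (1 - r) ≤ 5 := by linarith [pi_le_four]
  have hI2 : ∫⁻ φ in Set.Ioo 0 π, ENNReal.ofReal ((π - φ + (1 - r)) ^ (σ - 1)) ≤ B := by
    refine (lintegral_Ioo_le_of_sub (f := fun τ => ENNReal.ofReal (τ ^ (σ - 1))) hpi).trans ?_
    rw [hB, ← lintegral_Ioc_rpow (by norm_num) hσ]
    exact lintegral_mono_set (Set.Ioc_subset_Ioc_left he.le)
  have hI1 : ∫⁻ φ in Set.Ioo 0 π, ENNReal.ofReal ((φ + (1 - r)) ^ (σ - δ - 1)) ≤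
      ∫⁻ τ in Set.Ioc (1 - r) 5, ENNReal.ofReal (τ ^ (σ - δ - 1)) :=
    lintegral_Ioo_le_of_add (f := fun τ => ENNReal.ofReal (τ ^ (σ - δ - 1))) hpi
  calc bigJ s δ l r n ≤ ∫⁻ φ in Set.Ioo 0 π, ENNReal.ofReal (K * (1 - r) ^ (-σ)) *
        (ENNReal.ofReal ((φ + (1 - r)) ^ (σ - δ - 1)) +
          ENNReal.ofReal ((π - φ + (1 - r)) ^ (σ - 1))) := by
        refine setLIntegral_mono' measurableSet_Ioo fun φ hφ => ?_
        have hφ0 := hφ.1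
        have hφ1 : 0 < π - φ := by linarith [hφ.2]
        have hsφ := sin_pos_of_mem_Ioo hφ
        refine (mul_le_mul' (qwt_le hl hr hr1 hrn hφ) (h₁ r φ hr hr1 hφ)).trans ?_
        rw [← ENNReal.ofReal_add (by positivity) (by positivity),
          ← ENNReal.ofReal_mul (by positivity), ← ENNReal.ofReal_mul (by positivity)]
        refine ENNReal.ofReal_le_ofReal ?_
        have := mul_le_mul_of_nonneg_left (h₂ (1 - r) φ he (by linarith) hφ)
          (show 0 ≤ 8 * 4 ^ |δ| * C₁ by positivity)
        rw [hK]
        linarith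
    _ ≤ ENNReal.ofReal (K * (1 - r) ^ (-σ)) *
        ((∫⁻ τ in Set.Ioc (1 - r) 5, ENNReal.ofReal (τ ^ (σ - δ - 1))) + B) := by
        rw [lintegral_const_mul' _ _ ENNReal.ofReal_ne_top, lintegral_add_left (by fun_prop)]
        gcongr
    _ ≤ _ := by
        rw [ENNReal.ofReal_mul hK0]
        obtain ⟨L, hL⟩ : ∃ L, L = ∫⁻ τ in Set.Ioc (1 - r) 5, ENNReal.ofReal (τ ^ (σ - δ - 1)) :=
            ⟨_, rfl⟩
        rw [← hL]
        have : L + B ≤ (1 + B) * (L + 1) := by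
          have e : (1 + B) * (L + 1) = L + B + (1 + B * L) := by ring
          rw [e]; exact le_self_add
        calc _ ≤ ENNReal.ofReal K * ENNReal.ofReal ((1 - r) ^ (-σ)) * ((1 + B) * (L + 1)) :=
            by gcongr
          _ = _ := by ring

/-- The growth rate of the norms of the Cesàro means of order `δ` with critical index `σ`. -/
noncomputable def cesRate (σ δ : ℝ) (n : ℕ) : ℝ :=
  if σ < δ then 1 else if δ = σ then Real.log n else (n : ℝ) ^ (σ - δ)

theorem cesRate_pos (σ δ : ℝ) {n : ℕ} (hn : 2 ≤ n) : 0 < cesRate σ δ n := by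
  have : (1 : ℝ) < n := by exact_mod_cast hn
  have := Real.log_pos this
  unfold cesRate
  split_ifs <;> positivity

theorem setLIntegral_Ioc_rpow_neg_one {e b : ℝ} (he : 0 < e) (heb : e ≤ b) :
    ∫⁻ τ in Set.Ioc e b, ENNReal.ofReal (τ ^ (-1 : ℝ)) = ENNReal.ofReal (Real.log (b / e)) := by
  have h0 : (0 : ℝ) ∉ Set.uIcc e b := by
    rw [Set.uIcc_of_le heb]; exact fun h => by linarith [h.1]
  have hi : IntervalIntegrable (fun τ : ℝ => τ ^ (-1 : ℝ)) volume e b := by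
    simp_rw [rpow_neg_one]
    exact intervalIntegral.intervalIntegrable_inv (fun x hx h => h0 (h ▸ hx)) continuousOn_id
  rw [← ofReal_integral_eq_lintegral_ofReal
    ((intervalIntegrable_iff_integrableOn_Ioc_of_le heb).1 hi),
        ← intervalIntegral.integral_of_le heb]
  · simp_rw [rpow_neg_one]
    rw [integral_inv h0]
  · filter_upwards [ae_restrict_mem measurableSet_Ioc] with τ hτ
    have : 0 < τ := he.trans hτ.1
    positivity

theorem exists_mul_setLIntegral_le_cesRate (σ δ : ℝ) :
    ∃ C : ENNReal, C ≠ ⊤ ∧ ∀ n : ℕ, 2 ≤ n →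
      ENNReal.ofReal ((n : ℝ) ^ (σ - δ)) *
        ((∫⁻ τ in Set.Ioc (1 / (n : ℝ)) 5, ENNReal.ofReal (τ ^ (σ - δ - 1))) + 1) ≤
      C * ENNReal.ofReal (cesRate σ δ n) := by
  rcases lt_trichotomy σ δ with h | h | h
  · refine ⟨ENNReal.ofReal (1 / (δ - σ)) + 1, by simp, fun n hn => ?_⟩
    have hn0 : (1 : ℝ) < n := by exact_mod_cast hn
    have h1 : ∫⁻ τ in Set.Ioc (1 / (n : ℝ)) 5, ENNReal.ofReal (τ ^ (σ - δ - 1)) ≤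
        ENNReal.ofReal ((1 / (n : ℝ)) ^ (-(δ - σ)) / (δ - σ)) := by
      rw [← lintegral_Ioi_rpow (by positivity) (by linarith), neg_sub]
      exact lintegral_mono_set Set.Ioc_subset_Ioi_self
    rw [cesRate, if_pos h, ENNReal.ofReal_one, mul_one]
    refine (mul_le_mul_right (add_le_add_left h1 1) _).trans ?_
    rw [mul_add, mul_one, ← ENNReal.ofReal_mul (by positivity)]
    refine add_le_add (ENNReal.ofReal_le_ofReal (le_of_eq ?_)) ?_
    · rw [one_div, inv_rpow (by positivity), ← rpow_neg (by positivity), neg_neg, mul_div_assoc',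
        ← rpow_add (by positivity), show σ - δ + (δ - σ) = 0 by ring, rpow_zero]
    · rw [ENNReal.ofReal_le_one]
      exact rpow_le_one_of_one_le_of_nonpos hn0.le (by linarith)
  · refine ⟨ENNReal.ofReal ((Real.log 5 + 1) / Real.log 2 + 1), by simp, fun n hn => ?_⟩
    have hn2 : (2 : ℝ) ≤ n := by exact_mod_cast hn
    have h1 : 1 / (n : ℝ) ≤ 5 := by
      rw [div_le_iff₀ (by linarith)]; linarith
    have hl2 : 0 < Real.log 2 := Real.log_pos (by norm_num)
    have hln : Real.log 2 ≤ Real.log n := Real.log_le_log (by norm_num) hn2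
    have hl5 : 0 < Real.log 5 := Real.log_pos (by norm_num)
    rw [cesRate, if_neg h.not_lt, if_pos h.symm, h, sub_self, zero_sub, rpow_zero,
      setLIntegral_Ioc_rpow_neg_one (by positivity) h1, ENNReal.ofReal_one, one_mul,
          div_div_eq_mul_div,
      div_one, Real.log_mul (by norm_num) (by positivity), ← ENNReal.ofReal_mul (by positivity),
      ← ENNReal.ofReal_one, ← ENNReal.ofReal_add (by positivity) (by norm_num)]
    refine ENNReal.ofReal_le_ofReal ?_
    have : Real.log 5 + 1 ≤ (Real.log 5 + 1) / Real.log 2 * Real.log n := by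
      rw [div_mul_eq_mul_div, le_div_iff₀ hl2]; gcongr
    linarith
  · refine ⟨ENNReal.ofReal (5 ^ (σ - δ) / (σ - δ)) + 1, by simp, fun n hn => ?_⟩
    rw [cesRate, if_neg (by linarith), if_neg (by linarith), mul_comm]
    gcongr
    rw [← lintegral_Ioc_rpow (by norm_num) (by linarith)]
    exact lintegral_mono_set (Set.Ioc_subset_Ioc_left (by positivity))

theorem one_quarter_le_one_sub_inv_pow {n : ℕ} (hn : 2 ≤ n) : 1 / 4 ≤ (1 - 1 / (n : ℝ)) ^ n := by
  have hn2 : (2 : ℝ) ≤ n := by exact_mod_cast hn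
  have h0 : 1 / (n : ℝ) ≤ 1 / 2 := one_div_le_one_div_of_le (by norm_num) hn2
  obtain ⟨m, rfl | rfl⟩ := Nat.even_or_odd' n
  · have h1 := one_add_mul_le_pow (a := -(1 / ((2 * m : ℕ) : ℝ))) (by linarith) m
    have h2 : 1 + (m : ℝ) * -(1 / ((2 * m : ℕ) : ℝ)) = 1 / 2 := by
      have : (m : ℝ) ≠ 0 := by rintro h; simp [h] at hn2; linarith
      push_cast; field_simp; ring
    rw [mul_comm 2 m, pow_mul, mul_comm m 2]
    rw [h2, ← sub_eq_add_neg] at h1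
    nlinarith
  · have hm1 : (1 : ℝ) ≤ m := by exact_mod_cast (by omega : 1 ≤ m)
    have h1 := one_add_mul_le_pow (a := -(1 / ((2 * m + 1 : ℕ) : ℝ))) (by linarith) m
    have h3 : 1 + (m : ℝ) * -(1 / ((2 * m + 1 : ℕ) : ℝ)) = (m + 1) / (2 * m + 1) := by
      push_cast; field_simp; ring
    have h4 : 1 - 1 / ((2 * m + 1 : ℕ) : ℝ) = 2 * m / (2 * m + 1) := by
      push_cast; field_simp; ring
    rw [h3, ← sub_eq_add_neg, h4] at h1
    rw [pow_succ, mul_comm 2 m, pow_mul, mul_comm m 2, h4, ← pow_mul, mul_comm m 2, two_mul m,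
      pow_add]
    calc (1 : ℝ) / 4 ≤ (m + 1) / (2 * m + 1) * ((m + 1) / (2 * m + 1)) * (2 * m / (2 * m + 1)) := by
          rw [div_mul_div_comm, div_mul_div_comm, div_le_div_iff₀ (by norm_num) (by positivity)]
          nlinarith [mul_nonneg (sub_nonneg.2 hm1) (sub_nonneg.2 hm1)]
      _ ≤ _ := by gcongr

theorem WB_nonneg {d : ℕ} (κ : Fin (d + 1) → ℝ) {y : EuclideanSpace ℝ (Fin d)}
    (hy : y ∈ Metric.closedBall (0 : EuclideanSpace ℝ (Fin d)) 1) : 0 ≤ WB d κ y := by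
  rw [mem_closedBall_zero_iff] at hy
  have : 0 ≤ 1 - ‖y‖ ^ 2 := by nlinarith [norm_nonneg y]
  unfold WB
  positivity

theorem exists_sq_liftB_ge {d : ℕ} {x : EuclideanSpace ℝ (Fin d)} (hx : ‖x‖ ≤ 1) :
    ∃ i, 1 / ((d : ℝ) + 1) ≤ liftB d x (√(1 - ‖x‖ ^ 2)) i ^ 2 := by
  by_contra! h
  have h1 : ∑ i, liftB d x (√(1 - ‖x‖ ^ 2)) i ^ 2 < ∑ _i : Fin (d + 1), 1 / ((d : ℝ) + 1) :=
    Finset.sum_lt_sum_of_nonempty Finset.univ_nonempty fun i _ => h i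
  rw [sum_sq_liftB, Real.sq_sqrt (by nlinarith [norm_nonneg x])] at h1
  simp at h1
  have : (d : ℝ) + 1 ≠ 0 := by positivity
  rw [mul_inv_cancel₀ this] at h1
  linarith

theorem exists_cesaro_le {d : ℕ} (hd : 1 ≤ d) {κ : Fin (d + 1) → ℝ}
    (hκ : ∀ i, 0 < κ i) {δ : ℝ} (hδ : -1 < δ) :
    ∃ C : ℝ, 0 < C ∧ ∀ n : ℕ, 2 ≤ n → ∀ x ∈ Metric.closedBall (0 : EuclideanSpace ℝ (Fin d)) 1,
      (∫ y in Metric.closedBall (0 : EuclideanSpace ℝ (Fin d)) 1, WB d κ y)⁻¹ *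
        ∫ y in Metric.closedBall (0 : EuclideanSpace ℝ (Fin d)) 1, |ballK d κ δ n x y| * WB d κ y ≤
      C * cesRate (sigmaK d κ) δ n := by
  obtain ⟨W, hW⟩ : ∃ W, W = ∫ y in Metric.closedBall (0 : EuclideanSpace ℝ (Fin d)) 1, WB d κ y :=
    ⟨_, rfl⟩
  have hW0 : 0 ≤ W := by
    rw [hW]
    exact setIntegral_nonneg Metric.isClosed_closedBall.measurableSet fun y hy => WB_nonneg κ hy
  choose C₁ hC₁ h₁ using exists_setLIntegral_ballK_le hd hκ hδ
  choose C₂ hC₂ h₂ using fun i => exists_bigJ_le (δ := δ) (lamK_sub_pos hd hκ i)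
    (lamK_sub_le_sigmaK d κ i) (lamK_pos hd hκ)
  obtain ⟨C₃, hC₃, h₃⟩ := exists_mul_setLIntegral_le_cesRate (sigmaK d κ) δ
  obtain ⟨a, _, ha, _, hA⟩ := exists_cesA_bounds hδ
  obtain ⟨B, hB⟩ : ∃ B : ENNReal, B = (∑ i, C₁ i * C₂ i) * ENNReal.ofReal (2 ^ |δ| / a) * C₃ := ⟨_,
      rfl⟩
  have hBt : B ≠ ⊤ := by
    rw [hB]
    refine ENNReal.mul_ne_top (ENNReal.mul_ne_top ?_ (by simp)) hC₃
    exact ENNReal.sum_ne_top.2 fun i _ => ENNReal.mul_ne_top (hC₁ i) (hC₂ i)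
  refine ⟨W⁻¹ * B.toReal + 1, by positivity, fun n hn x hx => ?_⟩
  have hn2 : (2 : ℝ) ≤ n := by exact_mod_cast hn
  have hR := cesRate_pos (sigmaK d κ) δ hn
  have hinv : 1 / (n : ℝ) ≤ 1 / 2 := one_div_le_one_div_of_le (by norm_num) hn2
  have hinv0 : 0 < 1 / (n : ℝ) := by positivity
  have hcA : (cesA δ n)⁻¹ ≤ 2 ^ |δ| / a * (n : ℝ) ^ (-δ) := by
    have h1 := rpow_le_of_le_mul (a := (n : ℝ)) (b := n + 1) (c := 2) (by linarith) (by linarith)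
      (by norm_num) (by linarith) (by linarith) (-δ)
    rw [abs_neg] at h1
    calc (cesA δ n)⁻¹ ≤ (a * ((n : ℝ) + 1) ^ δ)⁻¹ := inv_anti₀ (by positivity) (hA n).1
      _ = ((n : ℝ) + 1) ^ (-δ) / a := by rw [rpow_neg (by positivity), mul_inv]; ring
      _ ≤ (2 ^ |δ| * (n : ℝ) ^ (-δ)) / a := by gcongr
      _ = _ := by ring
  have hmain : ∫⁻ y in Metric.closedBall 0 1, ‖ballK d κ δ n x y‖ₑ * ENNReal.ofReal (WB d κ y) ≤
      B * ENNReal.ofReal (cesRate (sigmaK d κ) δ n) := by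
    rw [mem_closedBall_zero_iff] at hx
    obtain ⟨i, hi⟩ := exists_sq_liftB_ge hx
    refine (h₁ i x hx hi (1 - 1 / n) (by linarith) (by linarith) n).trans ?_
    have hJ := h₂ i (1 - 1 / n) n (by linarith) (by linarith) (one_quarter_le_one_sub_inv_pow hn)
    rw [sub_sub_cancel, one_div, inv_rpow (by positivity), rpow_neg (by positivity), inv_inv,
      ← one_div] at hJ
    have h3 := h₃ n hn
    obtain ⟨L, hL⟩ : ∃ L, L = ∫⁻ τ in Set.Ioc (1 / (n : ℝ)) 5,
        ENNReal.ofReal (τ ^ (sigmaK d κ - δ - 1)) := ⟨_, rfl⟩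
    rw [← hL] at hJ h3
    have hs : C₁ i * C₂ i ≤ ∑ i, C₁ i * C₂ i :=
      Finset.single_le_sum (f := fun i => C₁ i * C₂ i) (fun _ _ => zero_le) (Finset.mem_univ i)
    calc _ ≤ C₁ i * ENNReal.ofReal (2 ^ |δ| / a * (n : ℝ) ^ (-δ)) *
          (C₂ i * ENNReal.ofReal ((n : ℝ) ^ sigmaK d κ) * (L + 1)) := by gcongr
      _ = (C₁ i * C₂ i) * ENNReal.ofReal (2 ^ |δ| / a) *
          (ENNReal.ofReal ((n : ℝ) ^ (sigmaK d κ - δ)) * (L + 1)) := by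
          rw [sub_eq_add_neg, rpow_add (by positivity), ENNReal.ofReal_mul (by positivity),
            ENNReal.ofReal_mul (by positivity)]
          ring
      _ ≤ (∑ i, C₁ i * C₂ i) * ENNReal.ofReal (2 ^ |δ| / a) *
          (C₃ * ENNReal.ofReal (cesRate (sigmaK d κ) δ n)) := by gcongr
      _ = _ := by rw [hB]; ring
  have hb : ∫ y in Metric.closedBall (0 : EuclideanSpace ℝ (Fin d)) 1, |ballK d κ δ n x y| *
      WB d κ y ≤
      B.toReal * cesRate (sigmaK d κ) δ n := by
    refine (le_abs_self _).trans ?_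
    have h1 := enorm_integral_le_lintegral_enorm (μ := volume.restrict
      (Metric.closedBall (0 : EuclideanSpace ℝ (Fin d)) 1)) fun y => |ballK d κ δ n x y| * WB d κ y
    have h2 : ∫⁻ y in Metric.closedBall 0 1, ‖|ballK d κ δ n x y| * WB d κ y‖ₑ =
        ∫⁻ y in Metric.closedBall 0 1, ‖ballK d κ δ n x y‖ₑ * ENNReal.ofReal (WB d κ y) := by
      refine setLIntegral_congr_fun Metric.isClosed_closedBall.measurableSet fun y hy => ?_
      simp only [enorm_mul, enorm_abs]
      rw [Real.enorm_of_nonneg (WB_nonneg κ hy)]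
    rw [h2] at h1
    have h4 := ENNReal.toReal_mono (ENNReal.mul_ne_top hBt ENNReal.ofReal_ne_top) (h1.trans hmain)
    rwa [ENNReal.toReal_mul, ENNReal.toReal_ofReal hR.le, toReal_enorm, Real.norm_eq_abs] at h4
  rw [← hW]
  calc _ ≤ W⁻¹ * (B.toReal * cesRate (sigmaK d κ) δ n) := by gcongr
    _ ≤ _ := by nlinarith

/-- Gegenbauer polynomials, extended by zero to negative degrees. -/
noncomputable def gegenZ (i : ℤ) (l t : ℝ) : ℝ := if 0 ≤ i then gegenC i.toNat l t else 0

theorem gegenZ_natCast (n : ℕ) (l t : ℝ) : gegenZ n l t = gegenC n l t := by simp [gegenZ]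

theorem gegenZ_of_neg {i : ℤ} (hi : i < 0) (l t : ℝ) : gegenZ i l t = 0 := if_neg (by omega)

theorem gegenZ_recurrence (i : ℤ) {l : ℝ} (hl : 0 < l) (t : ℝ) :
    2 * (i + l) * (t * gegenZ i l t) =
      (i + 1) * gegenZ (i + 1) l t + (i + 2 * l - 1) * gegenZ (i - 1) l t := by
  rcases lt_trichotomy i 0 with h | rfl | h
  · rw [gegenZ_of_neg h, gegenZ_of_neg (show i - 1 < 0 by omega)]
    rcases (show i = -1 ∨ i + 1 < 0 by omega) with rfl | h'
    · simp
    · rw [gegenZ_of_neg h']; ring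
  · rw [gegenZ_of_neg (show (0 : ℤ) - 1 < 0 by omega), show (0 : ℤ) + 1 = (1 : ℕ) by rfl,
      show (0 : ℤ) = (0 : ℕ) by rfl, gegenZ_natCast, gegenZ_natCast, gegenC_zero,
      gegenC_one_left hl]
    push_cast; ring
  · obtain ⟨n, rfl⟩ : ∃ n : ℕ, i = n + 1 := ⟨(i - 1).toNat, by omega⟩
    rw [show (n : ℤ) + 1 - 1 = (n : ℕ) by ring, show (n : ℤ) + 1 + 1 = (n +
      2 : ℕ) by push_cast; ring,
      show (n : ℤ) + 1 = (n + 1 : ℕ) by push_cast; ring, gegenZ_natCast, gegenZ_natCast,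
      gegenZ_natCast]
    have := gegenC_recurrence n hl t
    push_cast
    linarith

/-- Connection coefficients between Gegenbauer polynomials of orders `l` and `v`. -/
noncomputable def connC (l v : ℝ) (q p : ℕ) : ℝ :=
  poch l q * poch (l - v) p / (poch v (q + 1) * p.factorial)

theorem connC_nonneg {l v : ℝ} (hv : 0 < v) (hvl : v ≤ l) (q p : ℕ) : 0 ≤ connC l v q p := by
  have h1 := poch_nonneg (hv.le.trans hvl) q
  have h2 := poch_nonneg (sub_nonneg.2 hvl) p
  have h3 := poch_pos hv (q + 1)
  unfold connC
  positivity

theorem connC_succ_right (l v : ℝ) (q p : ℕ) :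
    connC l v q (p + 1) = connC l v q p * ((l - v + p) / (p + 1)) := by
  unfold connC
  rw [poch_succ (l - v), Nat.factorial_succ]
  push_cast
  rw [div_mul_div_comm]
  ring_nf

theorem connC_succ_left (l v : ℝ) (q p : ℕ) :
    connC l v (q + 1) p = connC l v q p * ((l + q) / (v + q + 1)) := by
  unfold connC
  rw [poch_succ l, poch_succ v (q + 1), div_mul_div_comm]
  push_cast
  ring_nf

theorem gegenC_eq_sum_gegenZ {l v : ℝ} (hl : 0 < l) (hv : 0 < v) (j : ℕ) (t : ℝ) :
    gegenC j l t = ∑ x ∈ HasAntidiagonal.antidiagonal j,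
      connC l v x.1 x.2 * ((x.1 : ℝ) - x.2 + v) * gegenZ (x.1 - x.2) v t := by
  induction j using Nat.twoStepInduction with
  | zero =>
    simp [gegenC_zero, gegenZ, connC, poch_zero, poch_succ, hv.ne']
  | one =>
    rw [Finset.Nat.antidiagonal_succ]
    simp [gegenC_one_left hl, gegenZ, connC, poch_zero, poch_succ, gegenC_one_left hv]
    field_simp
    ring
  | more j ih1 ih2 =>
    have hrec := gegenC_recurrence j hl t
    obtain ⟨c, hc⟩ : ∃ c : ℤ → ℝ, c = fun i => gegenZ i v t := ⟨_, rfl⟩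
    have hcr : ∀ i : ℤ, 2 * (i + v) * (t * c i) = (i + 1) * c (i + 1) + (i + 2 * v - 1) *
        c (i - 1) := by
      intro i; rw [hc]; exact gegenZ_recurrence i hv t
    have hcn : ∀ i : ℤ, i < 0 → c i = 0 := by
      intro i hi; rw [hc]; exact gegenZ_of_neg hi _ _
    have e0 : ∀ m : ℕ, ∑ x ∈ HasAntidiagonal.antidiagonal m,
      connC l v x.1 x.2 * ((x.1 : ℝ) - x.2 + v) * gegenZ (x.1 - x.2) v t =
      ∑ x ∈ HasAntidiagonal.antidiagonal m,
      connC l v x.1 x.2 * ((x.1 : ℝ) - x.2 + v) * c (x.1 - x.2) := by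
      intro m; rw [hc]
    rw [e0] at ih1 ih2 ⊢
    have h1 : 2 * (t * gegenC (j + 1) l t) =
        (connC l v (j + 1) 0 * (j + 2) * c (j + 2) +
          ∑ x ∈ HasAntidiagonal.antidiagonal j,
            connC l v x.1 (x.2 + 1) * ((x.1 : ℝ) - x.2) * c (x.1 - x.2)) +
        ∑ x ∈ HasAntidiagonal.antidiagonal j,
            connC l v (x.1 + 1) x.2 * ((x.1 : ℝ) - x.2 + 2 * v) * c (x.1 - x.2) := by
      have ha : 2 * (t * gegenC (j + 1) l t) =
          ∑ x ∈ HasAntidiagonal.antidiagonal (j + 1),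
            connC l v x.1 x.2 * ((x.1 : ℝ) - x.2 + 1) * c (x.1 - x.2 + 1) +
          ∑ x ∈ HasAntidiagonal.antidiagonal (j + 1),
            connC l v x.1 x.2 * ((x.1 : ℝ) - x.2 + 2 * v - 1) * c (x.1 - x.2 - 1) := by
        rw [ih2, ← Finset.sum_add_distrib, Finset.mul_sum, Finset.mul_sum]
        refine Finset.sum_congr rfl fun x _ => ?_
        have := hcr (x.1 - x.2)
        push_cast at this
        linear_combination connC l v x.1 x.2 * this
      rw [ha, Finset.Nat.sum_antidiagonal_succ', Finset.Nat.sum_antidiagonal_succ]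
      have hb : c (((0 : ℕ) : ℤ) - ((j + 1 : ℕ) : ℤ) - 1) = 0 := hcn _ (by push_cast; omega)
      rw [hb, mul_zero, zero_add]
      have hd : (((j + 1 : ℕ) : ℤ) - ((0 : ℕ) : ℤ) + 1) = j + 2 := by push_cast; ring
      rw [hd]
      congr 1
      · congr 1
        · push_cast; ring
        · refine Finset.sum_congr rfl fun x _ => ?_
          rw [show ((x.1 : ℕ) : ℤ) - ((x.2 + 1 : ℕ) : ℤ) + 1 = x.1 - x.2 by push_cast; ring]
          push_cast; ring
      · refine Finset.sum_congr rfl fun x _ => ?_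
        rw [show ((x.1 + 1 : ℕ) : ℤ) - ((x.2 : ℕ) : ℤ) - 1 = x.1 - x.2 by push_cast; ring]
        push_cast; ring
    have h2 : ∑ x ∈ HasAntidiagonal.antidiagonal (j + 2),
        connC l v x.1 x.2 * ((x.1 : ℝ) - x.2 + v) * c (x.1 - x.2) =
        connC l v (j + 2) 0 * (j + 2 + v) * c (j + 2) +
          ∑ x ∈ HasAntidiagonal.antidiagonal j,
            connC l v (x.1 + 1) (x.2 + 1) * ((x.1 : ℝ) - x.2 + v) * c (x.1 - x.2) := by
      rw [Finset.Nat.sum_antidiagonal_succ, Finset.Nat.sum_antidiagonal_succ']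
      have hb : c (((0 : ℕ) : ℤ) - ((j + 1 + 1 : ℕ) : ℤ)) = 0 := hcn _ (by push_cast; omega)
      rw [hb, mul_zero, zero_add]
      have hd : (((j + 1 + 1 : ℕ) : ℤ) - ((0 : ℕ) : ℤ)) = j + 2 := by push_cast; ring
      rw [hd]
      congr 1
      · push_cast; ring
      · refine Finset.sum_congr rfl fun x _ => ?_
        rw [show ((x.1 + 1 : ℕ) : ℤ) - ((x.2 + 1 : ℕ) : ℤ) = x.1 - x.2 by push_cast; ring]
        push_cast; ring
    have hj : ((j : ℝ) + 2) ≠ 0 := by positivity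
    refine mul_left_cancel₀ hj ?_
    rw [hrec, h2]
    have hk : ((j : ℝ) + 2) * (∑ x ∈ HasAntidiagonal.antidiagonal j,
            connC l v (x.1 + 1) (x.2 + 1) * ((x.1 : ℝ) - x.2 + v) * c (x.1 - x.2)) =
        (j + 1 + l) * (∑ x ∈ HasAntidiagonal.antidiagonal j,
            connC l v x.1 (x.2 + 1) * ((x.1 : ℝ) - x.2) * c (x.1 - x.2) +
        ∑ x ∈ HasAntidiagonal.antidiagonal j,
            connC l v (x.1 + 1) x.2 * ((x.1 : ℝ) - x.2 + 2 * v) * c (x.1 - x.2)) -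
        (j + 2 * l) * ∑ x ∈ HasAntidiagonal.antidiagonal j,
          connC l v x.1 x.2 * ((x.1 : ℝ) - x.2 + v) * c (x.1 - x.2) := by
      rw [← Finset.sum_add_distrib, Finset.mul_sum, Finset.mul_sum, Finset.mul_sum,
        ← Finset.sum_sub_distrib]
      refine Finset.sum_congr rfl fun x hx => ?_
      have hj : (j : ℝ) = x.1 + x.2 := by
        exact_mod_cast (HasAntidiagonal.mem_antidiagonal.1 hx).symm
      rw [connC_succ_left, connC_succ_left, connC_succ_right, hj]
      have h3 : v + (x.1 : ℝ) + 1 ≠ 0 := by positivity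
      have h4 : (x.2 : ℝ) + 1 ≠ 0 := by positivity
      generalize connC l v x.1 x.2 = A
      generalize c (x.1 - x.2) = B
      generalize (x.1 : ℝ) = q at *
      generalize (x.2 : ℝ) = p at *
      field_simp
      ring
    have hz : connC l v (j + 2) 0 * (j + 2 + v) = connC l v (j + 1) 0 * (j + 1 + l) := by
      have := connC_succ_left l v (j + 1) 0
      have h3 : v + ((j + 1 : ℕ) : ℝ) + 1 ≠ 0 := by positivity
      rw [this]
      push_cast at h3 ⊢
      have h5 : (j : ℝ) + 2 + v = v + (j + 1) + 1 := by ring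
      rw [h5]
      field_simp
      ring
    linear_combination (j + 1 + l) * h1 - (j + 2) * c (j + 2) * hz - (j + 2 * l) * ih1 - hk

theorem gw_one_sub_sq_eq_zero (a : ℝ) {t : ℝ} (ht : t ∉ Set.Ioo (-1 : ℝ) 1) :
    gw a (1 - t ^ 2) = 0 := by
  refine if_neg fun h => ht ?_
  have : t ^ 2 < 1 := by linarith
  exact abs_lt.1 ((sq_lt_one_iff_abs_lt_one t).1 this)

theorem gw_one_sub_sq (a : ℝ) {t : ℝ} (ht : t ∈ Set.Ioo (-1 : ℝ) 1) :
    gw a (1 - t ^ 2) = (1 - t ^ 2) ^ (a - 1) :=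
  if_pos (by nlinarith [ht.1, ht.2])

theorem ow_eq_mul_gw (κ t : ℝ) : ow κ t = (1 + t) * gw κ (1 - t ^ 2) := by
  by_cases ht : t ∈ Set.Ioo (-1 : ℝ) 1
  · rw [gw_one_sub_sq κ ht]; exact if_pos ⟨ht.1, ht.2⟩
  · rw [gw_one_sub_sq_eq_zero κ ht, mul_zero]; exact if_neg fun h => ht ⟨h.1, h.2⟩

theorem integrable_ow {κ : ℝ} (hκ : 0 < κ) : Integrable (ow κ) := by
  refine ⟨(measurable_ow κ).aestronglyMeasurable, ?_⟩
  rw [hasFiniteIntegral_iff_ofReal (Filter.Eventually.of_forall fun t => ow_nonneg κ t)]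
  exact lintegral_ow_lt_top hκ

theorem integrable_gw_one_sub_sq {κ : ℝ} (hκ : 0 < κ) :
    Integrable fun t : ℝ => gw κ (1 - t ^ 2) := by
  have h := ((integrable_ow hκ).add (integrable_ow hκ).comp_neg).const_mul (1 / 2)
  refine h.congr (Filter.Eventually.of_forall fun t => ?_)
  simp only [Pi.add_apply, ow_eq_mul_gw]
  rw [neg_sq]; ring

theorem abs_gw_mul_le {κ C t : ℝ} {x : ℝ} (h : t ∈ Set.Icc (-1 : ℝ) 1 → |x| ≤ C) :
    ‖gw κ (1 - t ^ 2) * x‖ ≤ gw κ (1 - t ^ 2) * C := by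
  by_cases ht : t ∈ Set.Ioo (-1 : ℝ) 1
  · rw [norm_mul, Real.norm_of_nonneg (gw_nonneg _ _)]
    exact mul_le_mul_of_nonneg_left (h (Set.Ioo_subset_Icc_self ht)) (gw_nonneg _ _)
  · simp [gw_one_sub_sq_eq_zero κ ht]

theorem integrable_gw_mul {κ : ℝ} (hκ : 0 < κ) {f : ℝ → ℝ} (hf : Continuous f) :
    Integrable fun t : ℝ => gw κ (1 - t ^ 2) * f t := by
  obtain ⟨C, hC⟩ := (isCompact_Icc (a := (-1 : ℝ)) (b := 1)).exists_bound_of_continuousOn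
    hf.continuousOn
  refine ((integrable_gw_one_sub_sq hκ).mul_const C).mono' ?_
    (Filter.Eventually.of_forall fun t => abs_gw_mul_le (hC t))
  exact (Measurable.aestronglyMeasurable (by fun_prop)).mul hf.aestronglyMeasurable

theorem integral_gw_mul_id_mul {κ : ℝ} (hκ : 0 < κ) {g g' : ℝ → ℝ} (hg : ∀ t, HasDerivAt g (g' t) t)
    (hg' : Continuous g') :
    2 * κ * ∫ t, gw κ (1 - t ^ 2) * (t * g t) = ∫ t, gw (κ + 1) (1 - t ^ 2) * g' t := by
  have hgc : Continuous g := continuous_iff_continuousAt.2 fun t => (hg t).continuousAt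
  have i1 := integrable_gw_mul hκ (f := fun t => t * g t) (by fun_prop)
  have i2 := integrable_gw_mul (show 0 < κ + 1 by linarith) hg'
  have hi := i2.sub (i1.const_mul (2 * κ))
  have key : ∫ t, (gw (κ + 1) (1 - t ^ 2) * g' t - 2 * κ * (gw κ (1 - t ^ 2) * (t * g t))) = 0 := by
    rw [← setIntegral_eq_integral_of_forall_compl_eq_zero (s := Set.Ioc (-1 : ℝ) 1),
      ← intervalIntegral.integral_of_le (by norm_num),
      intervalIntegral.integral_eq_sub_of_hasDerivAt_of_le
      (f := fun t => (1 - t ^ 2) ^ κ * g t) (by norm_num)]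
    · norm_num [zero_rpow hκ.ne']
    · exact ((by fun_prop : Continuous fun t : ℝ => 1 - t ^ 2).rpow_const
        (fun t => Or.inr hκ.le) |>.mul hgc).continuousOn
    · intro t ht
      have hp : 0 < 1 - t ^ 2 := by nlinarith [ht.1, ht.2]
      have h1 : HasDerivAt (fun t : ℝ => 1 - t ^ 2) (-(2 * t)) t := by
        refine ((hasDerivAt_pow 2 t).const_sub 1).congr_deriv (by norm_num)
      refine ((h1.rpow_const (p := κ) (Or.inl hp.ne')).fun_mul (hg t)).congr_deriv ?_
      rw [gw_one_sub_sq _ ht, gw_one_sub_sq _ ht, add_sub_cancel_right]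
      ring
    · exact hi.intervalIntegrable
    · intro t ht
      have ht' : t ∉ Set.Ioo (-1 : ℝ) 1 := fun h => ht ⟨h.1, h.2.le⟩
      rw [gw_one_sub_sq_eq_zero _ ht', gw_one_sub_sq_eq_zero _ ht']; ring
  rw [integral_sub i2 (i1.const_mul _), integral_const_mul] at key
  linarith

theorem integral_gw_succ {κ : ℝ} (hκ : 0 < κ) :
    (2 * κ + 1) * ∫ t, gw (κ + 1) (1 - t ^ 2) = 2 * κ * ∫ t, gw κ (1 - t ^ 2) := by
  have h1 := integral_gw_mul_id_mul hκ (g := fun t => t) (g' := fun _ => 1) hasDerivAt_id'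
    continuous_const
  have h2 : ∫ t, gw κ (1 - t ^ 2) * (t * t) =
      (∫ t, gw κ (1 - t ^ 2)) - ∫ t, gw (κ + 1) (1 - t ^ 2) := by
    rw [← integral_sub (integrable_gw_one_sub_sq hκ) (integrable_gw_one_sub_sq (by linarith))]
    refine integral_congr_ae (Filter.Eventually.of_forall fun t => ?_)
    by_cases ht : t ∈ Set.Ioo (-1 : ℝ) 1
    · have hp : 0 < 1 - t ^ 2 := by nlinarith [ht.1, ht.2]
      simp only [gw_one_sub_sq _ ht, add_sub_cancel_right]
      rw [show (1 - t ^ 2) ^ κ = (1 - t ^ 2) ^ (κ - 1) * (1 - t ^ 2) by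
        rw [← rpow_add_one hp.ne']; ring_nf]
      ring
    · simp [gw_one_sub_sq_eq_zero _ ht]
  simp only [mul_one] at h1
  rw [h2] at h1
  linarith

theorem hasDerivAt_integral_gw_gegenC {κ l : ℝ} (hκ : 0 < κ) (hl : 0 < l) (n : ℕ) (s : ℝ) :
    HasDerivAt (fun s => ∫ t, gw κ (1 - t ^ 2) * gegenC (n + 1) l (s * t))
      (∫ t, gw κ (1 - t ^ 2) * (2 * l * (t * gegenC n (l + 1) (s * t)))) s := by
  have hc : ∀ m a, Continuous fun p : ℝ × ℝ => gegenC m a (p.1 * p.2) := fun m a =>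
    (continuous_gegenC m).comp (continuous_fst.mul continuous_snd)
  have hc' : ∀ m a s, Continuous fun t : ℝ => gegenC m a (s * t) := fun m a s =>
    (continuous_gegenC m).comp (continuous_const.mul continuous_id)
  obtain ⟨C, hC⟩ := ((isCompact_closedBall s 1).prod
    (isCompact_Icc (a := (-1 : ℝ)) (b := 1))).exists_bound_of_continuousOn
    (f := fun p : ℝ × ℝ => 2 * l * (p.2 * gegenC n (l + 1) (p.1 * p.2)))
    (Continuous.continuousOn (continuous_const.mul (continuous_snd.mul (hc n (l + 1)))))
  refine (hasDerivAt_integral_of_dominated_loc_of_deriv_le (Metric.ball_mem_nhds s one_pos)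
    (bound := fun t => gw κ (1 - t ^ 2) * C)
    (F := fun s t => gw κ (1 - t ^ 2) * gegenC (n + 1) l (s * t))
    (F' := fun s t => gw κ (1 - t ^ 2) * (2 * l * (t * gegenC n (l + 1) (s * t))))
    (Filter.Eventually.of_forall fun x =>
      (integrable_gw_mul hκ (hc' _ _ x)).aestronglyMeasurable)
    (integrable_gw_mul hκ (hc' _ _ s))
    (integrable_gw_mul hκ (continuous_const.mul (continuous_id.mul (hc' n (l + 1) s)))
      ).aestronglyMeasurable ?_ ((integrable_gw_one_sub_sq hκ).mul_const C) ?_).2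
  · refine Filter.Eventually.of_forall fun t x hx => abs_gw_mul_le fun ht => ?_
    exact hC (x, t) ⟨Metric.ball_subset_closedBall hx, ht⟩
  · refine Filter.Eventually.of_forall fun t x _ => ?_
    refine (((hasDerivAt_gegenC n hl (x * t)).comp x
      ((hasDerivAt_id' x).mul_const t)).const_mul (gw κ (1 - t ^ 2))).congr_deriv ?_
    ring

theorem gegenC_even_zero {l : ℝ} (hl : 0 < l) (m : ℕ) :
    gegenC (2 * m) l 0 = (-1) ^ m * poch l m / m.factorial := by
  induction m with
  | zero => simp [gegenC_zero, poch_zero]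
  | succ m ih =>
    have h := gegenC_recurrence (2 * m) hl 0
    rw [show 2 * (m + 1) = 2 * m + 2 by ring, poch_succ, Nat.factorial_succ]
    rw [ih] at h
    have h1 : (m.factorial : ℝ) ≠ 0 := by positivity
    have h2 : (m : ℝ) + 1 ≠ 0 := by positivity
    push_cast at h ⊢
    field_simp at h ⊢
    linear_combination h

theorem gegenC_neg_one {l : ℝ} (hl : 0 < l) (m : ℕ) :
    gegenC m l (-1) = (-1) ^ m * poch (2 * l) m / m.factorial := by
  induction m using Nat.twoStepInduction with
  | zero => simp [gegenC_zero, poch_zero]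
  | one => simp [gegenC_one_left hl, poch_zero, poch_succ]
  | more m ih1 ih2 =>
    have h := gegenC_recurrence m hl (-1)
    rw [ih1, ih2] at h
    rw [poch_succ, Nat.factorial_succ]
    rw [poch_succ, Nat.factorial_succ] at h ⊢
    have h1 : (m.factorial : ℝ) ≠ 0 := by positivity
    have h2 : (m : ℝ) + 1 ≠ 0 := by positivity
    have h3 : (m : ℝ) + 1 + 1 ≠ 0 := by positivity
    push_cast at h ⊢
    field_simp at h ⊢
    rw [pow_succ, pow_succ] at *
    linear_combination h

theorem integral_gw_gegenC_even {κ : ℝ} (hκ : 0 < κ) (m : ℕ) (s : ℝ) :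
    ∫ t, gw κ (1 - t ^ 2) * gegenC (2 * m) (2 * κ) (s * t) =
      (∫ t, gw κ (1 - t ^ 2)) * gegenC m κ (2 * s ^ 2 - 1) := by
  induction m generalizing κ s with
  | zero => simp [gegenC_zero]
  | succ m ih =>
    have hκ1 : 0 < κ + 1 := by linarith
    refine congrFun (eq_of_hasDerivAt_of_eq
      (f := fun s => ∫ t, gw κ (1 - t ^ 2) * gegenC (2 * (m + 1)) (2 * κ) (s * t))
      (g := fun s => (∫ t, gw κ (1 - t ^ 2)) * gegenC (m + 1) κ (2 * s ^ 2 - 1))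
      (hasDerivAt_integral_gw_gegenC hκ (by positivity) (2 * m + 1)) (c := 0) ?_ ?_) s
    · intro s
      have h1 : HasDerivAt (fun s : ℝ => 2 * s ^ 2 - 1) (4 * s) s :=
        (((hasDerivAt_pow 2 s).const_mul 2).sub_const 1).congr_deriv (by norm_num; ring)
      refine (((hasDerivAt_gegenC m hκ _).comp s h1).const_mul
        (∫ t, gw κ (1 - t ^ 2))).congr_deriv ?_
      have h2 := integral_gw_mul_id_mul hκ
        (g := fun t => gegenC (2 * m + 1) (2 * κ + 1) (s * t))
        (g' := fun t => 2 * (2 * κ + 1) * gegenC (2 * m) (2 * (κ + 1)) (s * t) * s)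
        (fun t => by
          refine ((hasDerivAt_gegenC (2 * m) (show 0 < 2 * κ + 1 by positivity) (s * t)).comp t
            ((hasDerivAt_id' t).const_mul s)).congr_deriv ?_
          rw [show 2 * κ + 1 + 1 = 2 * (κ + 1) by ring]; ring)
        ((continuous_const.mul ((continuous_gegenC _).comp
          (continuous_const.mul continuous_id))).mul continuous_const)
      have h3 : ∫ t, gw (κ + 1) (1 - t ^ 2) *
          (2 * (2 * κ + 1) * gegenC (2 * m) (2 * (κ + 1)) (s * t) * s) =
          2 * (2 * κ + 1) * s *
            ((∫ t, gw (κ + 1) (1 - t ^ 2)) * gegenC m (κ + 1) (2 * s ^ 2 - 1)) := by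
        rw [← ih hκ1, ← integral_const_mul]
        congr 1; ext t; ring
      have h4 : ∫ t, gw κ (1 - t ^ 2) * (2 * (2 * κ) * (t * gegenC (2 * m + 1) (2 * κ + 1) (s * t)))
          = 2 * (2 * κ * ∫ t, gw κ (1 - t ^ 2) *
            (t * gegenC (2 * m + 1) (2 * κ + 1) (s * t))) := by
        rw [← integral_const_mul, ← integral_const_mul]
        congr 1; ext t; ring
      rw [h4, h2, h3]
      have h5 := integral_gw_succ hκ
      linear_combination (-4 * s * gegenC m (κ + 1) (2 * s ^ 2 - 1)) * h5
    · simp only [zero_mul]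
      rw [integral_mul_const, gegenC_even_zero (by positivity)]
      norm_num
      exact Or.inl (gegenC_neg_one hκ _).symm

theorem gegenC_neg {l : ℝ} (hl : 0 < l) (j : ℕ) (t : ℝ) :
    gegenC j l (-t) = (-1) ^ j * gegenC j l t := by
  induction j using Nat.twoStepInduction with
  | zero => simp [gegenC_zero]
  | one => simp [gegenC_one_left hl]
  | more j ih1 ih2 =>
    have h1 := gegenC_recurrence j hl t
    have h2 := gegenC_recurrence j hl (-t)
    rw [ih1, ih2] at h2
    have h3 : (j : ℝ) + 2 ≠ 0 := by positivity
    refine mul_left_cancel₀ h3 ?_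
    rw [pow_succ] at h2
    rw [pow_succ, pow_succ]
    linear_combination h2 - (-1) ^ j * h1

theorem sum_range_succ_even (n : ℕ) (a : ℕ → ℝ) :
    ∑ j ∈ range (n + 1), (1 + (-1) ^ j) / 2 * a j = ∑ m ∈ range (n / 2 + 1), a (2 * m) := by
  have h : ∀ j ∈ range (n + 1), (1 + (-1) ^ j) / 2 * a j = if Even j then a j else 0 := by
    intro j _
    split_ifs with h
    · rw [h.neg_one_pow]; ring
    · rw [(Nat.not_even_iff_odd.1 h).neg_one_pow]; ring
  rw [Finset.sum_congr rfl h, ← Finset.sum_filter]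
  refine Finset.sum_nbij' (fun j => j / 2) (fun m => 2 * m) ?_ ?_ ?_ ?_ ?_
  · intro j hj; simp at hj ⊢; omega
  · intro j hj; simp at hj ⊢; omega
  · intro j hj; simp at hj; exact Nat.mul_div_cancel' hj.2.two_dvd
  · intro j hj; simp
  · intro j hj; simp at hj; simp [Nat.mul_div_cancel' hj.2.two_dvd]

theorem gegenC_even_eq_sum {l v : ℝ} (hl : 0 < l) (hv : 0 < v) (m : ℕ) (t : ℝ) :
    gegenC (2 * m) l t = ∑ x ∈ HasAntidiagonal.antidiagonal m,
      connC l v (2 * x.1 + x.2) x.2 * (2 * x.1 + v) * gegenC (2 * x.1) v t := by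
  rw [gegenC_eq_sum_gegenZ hl hv]
  have h : ∀ x ∈ HasAntidiagonal.antidiagonal (2 * m),
      connC l v x.1 x.2 * ((x.1 : ℝ) - x.2 + v) * gegenZ (x.1 - x.2) v t =
      if x.2 ≤ x.1 then connC l v x.1 x.2 * ((x.1 : ℝ) - x.2 + v) *
          gegenC (x.1 - x.2) v t else 0 := by
    intro x _
    split_ifs with h
    · rw [← gegenZ_natCast, Nat.cast_sub h]
    · rw [gegenZ_of_neg (by omega), mul_zero]
  rw [Finset.sum_congr rfl h, ← Finset.sum_filter]
  symm
  refine Finset.sum_nbij' (fun x => (2 * x.1 + x.2, x.2)) (fun x => ((x.1 - x.2) / 2, x.2))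
    ?_ ?_ ?_ ?_ ?_
  · intro x hx
    simp only [HasAntidiagonal.mem_antidiagonal, Finset.mem_filter] at hx ⊢
    omega
  · intro x hx
    simp only [HasAntidiagonal.mem_antidiagonal, Finset.mem_filter] at hx ⊢
    omega
  · intro x _; ext <;> simp
  · intro x hx
    simp only [HasAntidiagonal.mem_antidiagonal, Finset.mem_filter] at hx
    ext <;> simp; omega
  · intro x _
    simp only
    rw [Nat.add_sub_cancel]
    push_cast; ring_nf

/-- The coefficients of the even part of the Cesàro kernel in the polynomials `C_i^{(k)}(cos 2ρ)`,
up to normalization. -/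
noncomputable def evenCoef (l k δ : ℝ) (n i : ℕ) : ℝ :=
  ∑ p ∈ range (n / 2 + 1 - i), cesA δ (n - 2 * (i + p)) * (((2 * (i + p) : ℕ) + l) / l) *
    (connC l (2 * k) (2 * i + p) p * (2 * i + 2 * k))

theorem evenCoef_nonneg {l k δ : ℝ} (hk : 0 < k) (hkl : 2 * k ≤ l) (hδ : -1 < δ) (n i : ℕ) :
    0 ≤ evenCoef l k δ n i := by
  refine Finset.sum_nonneg fun p _ => ?_
  have h1 := (cesA_pos hδ (n - 2 * (i + p))).le
  have h2 := connC_nonneg (show 0 < 2 * k by positivity) hkl (2 * i + p) p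
  have h3 : 0 < l := by linarith
  positivity

theorem qker_add_qker_neg {l k : ℝ} (hl : 0 < l) (hk : 0 < k) (δ : ℝ) (n : ℕ) (u : ℝ) :
    (qker l δ n u + qker l δ n (-u)) / 2 =
      ∑ i ∈ range (n / 2 + 1), evenCoef l k δ n i * gegenC (2 * i) (2 * k) u := by
  have h1 : (qker l δ n u + qker l δ n (-u)) / 2 = ∑ j ∈ range (n + 1),
      (1 + (-1) ^ j) / 2 * (cesA δ (n - j) * (((j : ℝ) + l) / l * gegenC j l u)) := by
    rw [qker, qker, ← Finset.sum_add_distrib, Finset.sum_div]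
    refine Finset.sum_congr rfl fun j _ => ?_
    rw [gegenC_neg hl]; ring
  rw [h1, sum_range_succ_even n fun j => cesA δ (n - j) * (((j : ℝ) + l) / l * gegenC j l u)]
  obtain ⟨f, hf⟩ : ∃ f : ℕ → ℕ → ℝ, f = fun i p => cesA δ (n - 2 * (i + p)) *
    (((2 * (i + p) : ℕ) + l) / l) *
    (connC l (2 * k) (2 * i + p) p * (2 * i + 2 * k)) * gegenC (2 * i) (2 * k) u := ⟨_, rfl⟩
  have h2 : ∀ m ∈ range (n / 2 + 1),
      cesA δ (n - 2 * m) * ((((2 * m : ℕ) : ℝ) + l) / l * gegenC (2 * m) l u) =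
      ∑ i ∈ range (m + 1), f i (m - i) := by
    intro m _
    rw [gegenC_even_eq_sum hl (show 0 < 2 * k by positivity),
      ← Finset.Nat.sum_antidiagonal_eq_sum_range_succ f m, hf, Finset.mul_sum, Finset.mul_sum]
    refine Finset.sum_congr rfl fun x hx => ?_
    rw [HasAntidiagonal.mem_antidiagonal] at hx
    simp only
    rw [hx]
    ring
  rw [Finset.sum_congr rfl h2, Finset.sum_range_diag_flip]
  refine Finset.sum_congr rfl fun i _ => ?_
  rw [evenCoef, Finset.sum_mul, hf]

theorem integral_om_add_neg {κ : ℝ} (hκ : 0 < κ) {f : ℝ → ℝ} (hf : Continuous f) :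
    (∫ t, f t ∂om κ) + ∫ t, f (-t) ∂om κ = ∫ t, gw κ (1 - t ^ 2) * (f t + f (-t)) := by
  have e : ∀ g : ℝ → ℝ, ∫ t, g t ∂om κ = ∫ t, ow κ t * g t := by
    intro g
    rw [integral_om, setIntegral_eq_integral_of_forall_compl_eq_zero]
    · rfl
    · intro t ht
      rw [ow_eq_mul_gw, gw_one_sub_sq_eq_zero κ ht]; simp
  have i1 := integrable_gw_mul hκ (f := fun t => (1 + t) * f t) (by fun_prop)
  have i2 := integrable_gw_mul hκ (f := fun t => (1 - t) * f t) (by fun_prop)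
  have i3 := integrable_gw_mul hκ (f := f) (by fun_prop)
  have i4 := integrable_gw_mul hκ (f := fun t => f (-t)) (by fun_prop)
  have h1 : ∫ t, ow κ t * f (-t) = ∫ t, gw κ (1 - t ^ 2) * ((1 - t) * f t) := by
    rw [← integral_neg_eq_self]
    refine integral_congr_ae (Filter.Eventually.of_forall fun t => ?_)
    simp only [ow_eq_mul_gw, neg_sq, neg_neg]; ring
  have h2 : ∫ t, gw κ (1 - t ^ 2) * f (-t) = ∫ t, gw κ (1 - t ^ 2) * f t := by
    rw [← integral_neg_eq_self]
    refine integral_congr_ae (Filter.Eventually.of_forall fun t => ?_)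
    simp only [neg_sq, neg_neg]
  rw [e, e, h1]
  simp only [mul_add]
  rw [integral_add i3 i4, h2, ← integral_add i3 i3]
  have h3 : ∫ t, ow κ t * f t = ∫ t, gw κ (1 - t ^ 2) * ((1 + t) * f t) := by
    refine integral_congr_ae (Filter.Eventually.of_forall fun t => ?_)
    simp only [ow_eq_mul_gw]; ring
  rw [h3, ← integral_add i1 i2]
  refine integral_congr_ae (Filter.Eventually.of_forall fun t => ?_)
  simp only; ring

theorem integral_qker_om_add_neg {l k : ℝ} (hl : 0 < l) (hk : 0 < k) (δ : ℝ) (n : ℕ) (ρ : ℝ) :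
    ((∫ t, qker l δ n (cos ρ * t) ∂om k) + ∫ t, qker l δ n (-cos ρ * t) ∂om k) / 2 =
      (∫ t, gw k (1 - t ^ 2)) *
        ∑ i ∈ range (n / 2 + 1), evenCoef l k δ n i * gegenC i k (cos (2 * ρ)) := by
  have hc : Continuous fun t => qker l δ n (cos ρ * t) :=
    (continuous_qker _ _ _).comp (continuous_const.mul continuous_id)
  have h := integral_om_add_neg hk hc
  simp only [show ∀ t, -cos ρ * t = cos ρ * -t by intro t; ring]
  rw [h, ← integral_div, Finset.mul_sum]
  have h1 : ∀ t, gw k (1 - t ^ 2) * (qker l δ n (cos ρ * t) + qker l δ n (cos ρ * -t)) / 2 =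
      ∑ i ∈ range (n / 2 + 1), evenCoef l k δ n i *
        (gw k (1 - t ^ 2) * gegenC (2 * i) (2 * k) (cos ρ * t)) := by
    intro t
    rw [mul_div_assoc, mul_neg, qker_add_qker_neg hl hk, Finset.mul_sum]
    refine Finset.sum_congr rfl fun i _ => ?_
    ring
  simp only [h1]
  rw [integral_finsetSum]
  · refine Finset.sum_congr rfl fun i _ => ?_
    rw [integral_const_mul, integral_gw_gegenC_even hk, cos_two_mul]; ring
  · intro i _
    exact (integrable_gw_mul hk ((continuous_gegenC _).comp
      (continuous_const.mul continuous_id))).const_mul _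

/-- The test functions of the lower estimate: trigonometric polynomials in `2ρ` whose lowest
frequency is `2M`. -/
noncomputable def testH (P Q M w : ℕ) (ρ : ℝ) : ℝ :=
  ∑ a ∈ range (P + 1), ∑ b ∈ range (Q + 1),
    (-1) ^ a * P.choose a * Q.choose b * cos (2 * (M + w * a + b : ℕ) * ρ)

theorem continuous_testH (P Q M w : ℕ) : Continuous (testH P Q M w) := by
  unfold testH
  fun_prop

theorem abs_testH_le (P Q M w : ℕ) (ρ : ℝ) :
    |testH P Q M w ρ| ≤ (2 * |sin (w * ρ)|) ^ P * (2 * |cos ρ|) ^ Q := by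
  have hre : ∀ x : ℝ, (Complex.exp (x * Complex.I)).re = cos x := Complex.exp_ofReal_mul_I_re
  have h : testH P Q M w ρ = (Complex.exp ((2 * M * ρ : ℝ) * Complex.I) *
      ((1 - Complex.exp ((2 * (w * ρ) : ℝ) * Complex.I)) ^ P *
        (1 + Complex.exp ((2 * ρ : ℝ) * Complex.I)) ^ Q)).re := by
    rw [sub_eq_neg_add, add_comm (1 : ℂ), add_pow, add_pow, Finset.sum_mul_sum, Finset.mul_sum,
      Complex.re_sum, testH]
    refine Finset.sum_congr rfl fun a _ => ?_
    rw [Finset.mul_sum, Complex.re_sum]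
    refine Finset.sum_congr rfl fun b _ => ?_
    rw [← hre, ← Complex.re_ofReal_mul]
    congr 1
    rw [neg_pow (Complex.exp ((2 * (w * ρ) : ℝ) * Complex.I)) a, ← Complex.exp_nat_mul,
      ← Complex.exp_nat_mul]
    simp only [one_pow, mul_one]
    rw [show Complex.exp ((2 * M * ρ : ℝ) * Complex.I) *
      ((-1) ^ a * Complex.exp (a * ((2 * (w * ρ) : ℝ) * Complex.I)) * (P.choose a) *
        (Complex.exp (b * ((2 * ρ : ℝ) * Complex.I)) * (Q.choose b))) =
      (-1) ^ a * (P.choose a) * (Q.choose b) * (Complex.exp ((2 * M * ρ : ℝ) * Complex.I) *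
        Complex.exp (a * ((2 * (w * ρ) : ℝ) * Complex.I)) *
        Complex.exp (b * ((2 * ρ : ℝ) * Complex.I))) by ring, ← Complex.exp_add, ← Complex.exp_add]
    push_cast
    congr 2
    ring
  have h1 : ∀ x : ℝ, ‖1 - Complex.exp ((2 * x : ℝ) * Complex.I)‖ = 2 * |sin x| := by
    intro x
    rw [norm_sub_rev, mul_comm, Complex.norm_exp_I_mul_ofReal_sub_one,
      mul_div_cancel_left₀ x two_ne_zero,
      Real.norm_eq_abs, abs_mul, abs_two]
  have h2 : ∀ x : ℝ, ‖1 + Complex.exp ((2 * x : ℝ) * Complex.I)‖ = 2 * |cos x| := by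
    intro x
    have : 1 + Complex.exp ((2 * x : ℝ) * Complex.I) =
        Complex.exp (x * Complex.I) * ((2 * cos x : ℝ) : ℂ) := by
      rw [Complex.ofReal_mul 2 (cos x), Complex.ofReal_cos, Complex.ofReal_ofNat, Complex.two_cos,
        mul_add,
        ← Complex.exp_add, ← Complex.exp_add]
      push_cast
      rw [show (x : ℂ) * Complex.I + -x * Complex.I = 0 by ring, Complex.exp_zero, add_comm]
      ring_nf
    rw [this, norm_mul, Complex.norm_exp_ofReal_mul_I, one_mul, Complex.norm_real,
      Real.norm_eq_abs, abs_mul, abs_two]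
  rw [h]
  refine (Complex.abs_re_le_norm _).trans ?_
  rw [norm_mul, Complex.norm_exp_ofReal_mul_I, one_mul, norm_mul, norm_pow, norm_pow, h1, h2]

theorem integral_cos_two_int (z : ℤ) :
    ∫ ρ in (0 : ℝ)..π, cos (2 * z * ρ) = if z = 0 then π else 0 := by
  split_ifs with h
  · simp [h]
  · have h2 : (2 * (z : ℝ)) ≠ 0 := by exact_mod_cast mul_ne_zero two_ne_zero h
    rw [intervalIntegral.integral_comp_mul_left _ h2, integral_cos, mul_zero, sin_zero, sub_zero,
      show 2 * (z : ℝ) * π = (2 * z : ℤ) * π by push_cast; ring, sin_int_mul_pi, smul_zero]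

theorem integral_cos_mul_cos (j z : ℤ) :
    ∫ ρ in (0 : ℝ)..π, cos (2 * j * ρ) * cos (2 * z * ρ) =
      ((if j = z then π else 0) + if j = -z then π else 0) / 2 := by
  have h : ∀ ρ : ℝ, cos (2 * j * ρ) * cos (2 * z * ρ) =
      (cos (2 * (j - z : ℤ) * ρ) + cos (2 * (j + z : ℤ) * ρ)) / 2 := by
    intro ρ
    rw [show 2 * ((j - z : ℤ) : ℝ) * ρ = 2 * j * ρ - 2 * z * ρ by push_cast; ring,
      show 2 * ((j + z : ℤ) : ℝ) * ρ = 2 * j * ρ + 2 * z * ρ by push_cast; ring, cos_sub, cos_add]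
    ring
  simp only [h]
  rw [intervalIntegral.integral_div, intervalIntegral.integral_add
    (Continuous.intervalIntegrable (by fun_prop) _ _)
    (Continuous.intervalIntegrable (by fun_prop) _ _), integral_cos_two_int, integral_cos_two_int]
  simp only [sub_eq_zero, add_eq_zero_iff_eq_neg]

theorem integral_cos_mul_testH (P Q M w : ℕ) (j : ℤ) :
    ∫ ρ in (0 : ℝ)..π, cos (2 * j * ρ) * testH P Q M w ρ =
      ∑ a ∈ range (P + 1), ∑ b ∈ range (Q + 1), (-1) ^ a * P.choose a * Q.choose b *
        (((if j = (M + w * a + b : ℕ) then π else 0) +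
          if j = -(M + w * a + b : ℕ) then π else 0) / 2) := by
  simp only [testH, Finset.mul_sum]
  rw [intervalIntegral.integral_finsetSum fun a _ =>
    Continuous.intervalIntegrable (by fun_prop) _ _]
  refine Finset.sum_congr rfl fun a _ => ?_
  rw [intervalIntegral.integral_finsetSum fun a _ =>
    Continuous.intervalIntegrable (by fun_prop) _ _]
  refine Finset.sum_congr rfl fun b _ => ?_
  rw [← integral_cos_mul_cos, ← intervalIntegral.integral_const_mul]
  congr 1; ext ρ
  rw [Int.cast_natCast]
  ring

theorem integral_cos_mul_testH_term_nonneg (P Q : ℕ) {M w : ℕ} {j : ℤ} (hj : |j| < M + w)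
    (a b : ℕ) : 0 ≤ (-1 : ℝ) ^ a * P.choose a * Q.choose b *
        (((if j = (M + w * a + b : ℕ) then π else 0) +
          if j = -(M + w * a + b : ℕ) then π else 0) / 2) := by
  rcases Nat.eq_zero_or_pos a with rfl | ha
  · rw [pow_zero]
    have := pi_pos.le
    positivity
  · have h1 : M + w ≤ M + w * a + b := by nlinarith
    have h2 := abs_lt.1 hj
    rw [if_neg (by omega), if_neg (by omega)]
    simp

theorem integral_cos_mul_testH_nonneg (P Q : ℕ) {M w : ℕ} {j : ℤ} (hj : |j| < M + w) :
    0 ≤ ∫ ρ in (0 : ℝ)..π, cos (2 * j * ρ) * testH P Q M w ρ := by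
  rw [integral_cos_mul_testH]
  exact Finset.sum_nonneg fun a _ => Finset.sum_nonneg fun b _ =>
    integral_cos_mul_testH_term_nonneg P Q hj a b

theorem le_integral_cos_mul_testH (P Q : ℕ) {M w : ℕ} (hw : 0 < w) :
    π / 2 ≤ ∫ ρ in (0 : ℝ)..π, cos (2 * (M : ℤ) * ρ) * testH P Q M w ρ := by
  have hj : |(M : ℤ)| < M + w := by rw [abs_of_nonneg (by positivity)]; omega
  rw [integral_cos_mul_testH]
  refine le_trans ?_ (Finset.single_le_sum (fun a _ => Finset.sum_nonneg fun b _ =>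
    integral_cos_mul_testH_term_nonneg P Q hj a b) (Finset.mem_range.2 P.succ_pos))
  refine le_trans ?_ (Finset.single_le_sum (fun b _ =>
    integral_cos_mul_testH_term_nonneg P Q hj 0 b) (Finset.mem_range.2 Q.succ_pos))
  have := pi_pos
  simp
  gcongr
  split_ifs <;> linarith

theorem sum_min_pow_le {s r : ℝ} (hs : 0 < s) (hr : r = 2 ^ (-s)) (P L : ℕ)
    {x : ℝ} (hx0 : 0 ≤ x) :
    ∑ l ∈ range L, r ^ l * (min 1 (2 ^ l * x)) ^ P ≤ (1 - r)⁻¹ := by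
  have hr0 : 0 < r := by rw [hr]; positivity
  have hr1 : r < 1 := by rw [hr]; exact rpow_lt_one_of_one_lt_of_neg one_lt_two (by linarith)
  rw [← tsum_geometric_of_lt_one hr0.le hr1]
  refine le_trans (Finset.sum_le_sum fun l _ => ?_)
    ((summable_geometric_of_lt_one hr0.le hr1).sum_le_tsum _ fun l _ => by positivity)
  exact mul_le_of_le_one_right (by positivity) (pow_le_one₀ (by positivity) (min_le_left _ _))

theorem sum_min_pow_le_rpow {s r : ℝ} (hs : 0 < s) (hr : r = 2 ^ (-s)) {P : ℕ} (hP : s + 1 ≤ P)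
    (L : ℕ) {x : ℝ} (hx0 : 0 < x) (hx : x ≤ 2) :
    ∑ l ∈ range L, r ^ l * (min 1 (2 ^ l * x)) ^ P ≤
      ((1 - r)⁻¹ + 2 ^ P) * x ^ s - x ^ P := by
  have hr0 : 0 < r := by rw [hr]; positivity
  have hr1 : r < 1 := by rw [hr]; exact rpow_lt_one_of_one_lt_of_neg one_lt_two (by linarith)
  have hK : 0 < (1 - r)⁻¹ := inv_pos.2 (by linarith)
  have h2P : (1:ℝ) ≤ 2 ^ P := one_le_pow₀ (by norm_num)
  induction L generalizing x with
  | zero =>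
    rw [Finset.range_zero, Finset.sum_empty]
    rcases le_or_gt 1 x with h1 | h1
    · have h4 : (1 : ℝ) ≤ x ^ s := one_le_rpow h1 hs.le
      have h5 : x ^ P ≤ 2 ^ P := pow_le_pow_left₀ hx0.le hx P
      nlinarith
    · have h4 : x ^ P ≤ x ^ s := by
        rw [← rpow_natCast]
        exact rpow_le_rpow_of_exponent_ge hx0 h1.le (by linarith)
      have h5 : 0 < x ^ s := by positivity
      nlinarith
  | succ L ih =>
    rcases le_or_gt 1 x with h1 | h1
    · have h3 := sum_min_pow_le hs hr P (L + 1) hx0.le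
      have h4 : (1 : ℝ) ≤ x ^ s := one_le_rpow h1 hs.le
      have h5 : x ^ P ≤ 2 ^ P := pow_le_pow_left₀ hx0.le hx P
      nlinarith
    · rw [Finset.sum_range_succ']
      have h3 := ih (x := 2 * x) (by linarith) (by linarith)
      have h4 : ∑ l ∈ range L, r ^ (l + 1) * (min 1 (2 ^ (l + 1) * x)) ^ P =
          r * ∑ l ∈ range L, r ^ l * (min 1 (2 ^ l * (2 * x))) ^ P := by
        rw [Finset.mul_sum]
        refine Finset.sum_congr rfl fun l _ => ?_
        rw [pow_succ, pow_succ, mul_assoc (2 ^ l)]; ring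
      have h5 : r * (2 * x) ^ s = x ^ s := by
        rw [mul_rpow zero_le_two hx0.le, ← mul_assoc, hr, ← rpow_add two_pos]; simp
      have h6 : 2 ≤ r * 2 ^ P := by
        rw [hr, ← rpow_natCast 2 P, ← rpow_add two_pos]
        calc (2 : ℝ) = 2 ^ (1 : ℝ) := (rpow_one 2).symm
          _ ≤ _ := rpow_le_rpow_of_exponent_le one_le_two (by linarith)
      have h7 : min 1 (2 ^ 0 * x) = x := by rw [pow_zero, one_mul, min_eq_right h1.le]
      rw [h4, h7, pow_zero, one_mul]
      have h8 := mul_le_mul_of_nonneg_left h3 hr0.le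
      have h9 : 0 < x ^ P := by positivity
      rw [mul_pow] at h8
      nlinarith

theorem abs_sin_two_pow_mul_le (l : ℕ) (ρ : ℝ) : |sin (2 ^ l * ρ)| ≤ 2 ^ l * |sin ρ| := by
  induction l with
  | zero => simp
  | succ l ih =>
    rw [pow_succ', mul_assoc, sin_two_mul, abs_mul, abs_mul, abs_two]
    have := abs_cos_le_one (2 ^ l * ρ)
    have := abs_nonneg (sin (2 ^ l * ρ))
    nlinarith

theorem exists_abs_sum_testH_le {s q : ℝ} (hs : 0 < s) {P Q : ℕ} (hP : s + 1 ≤ P) (hQ : q ≤ Q) :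
    ∃ C, 0 < C ∧ ∀ (L : ℕ) (M : ℕ → ℕ) (ρ : ℝ), ρ ∈ Set.Ioo 0 π → cos ρ ≠ 0 →
      |∑ l ∈ range L, ((2 : ℝ) ^ (-s)) ^ l * testH P Q (M l) (2 ^ l) ρ| ≤
        C * (sin ρ ^ s * |cos ρ| ^ q) := by
  obtain ⟨r, hr⟩ : ∃ r : ℝ, r = 2 ^ (-s) := ⟨_, rfl⟩
  have hr0 : 0 < r := by rw [hr]; positivity
  have hr1 : r < 1 := by rw [hr]; exact rpow_lt_one_of_one_lt_of_neg one_lt_two (by linarith)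
  have hK : 0 < (1 - r)⁻¹ := inv_pos.2 (by linarith)
  refine ⟨2 ^ P * 2 ^ Q * ((1 - r)⁻¹ + 2 ^ P), by positivity, fun L M ρ hρ hc => ?_⟩
  have hsin := sin_pos_of_mem_Ioo hρ
  have hcos : 0 < |cos ρ| := abs_pos.2 hc
  rw [← hr]
  have h1 : |∑ l ∈ range L, r ^ l * testH P Q (M l) (2 ^ l) ρ| ≤
      2 ^ P * 2 ^ Q * |cos ρ| ^ Q * ∑ l ∈ range L, r ^ l * (min 1 (2 ^ l * sin ρ)) ^ P := by
    refine (Finset.abs_sum_le_sum_abs _ _).trans ?_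
    rw [Finset.mul_sum]
    refine Finset.sum_le_sum fun l _ => ?_
    rw [abs_mul, abs_of_pos (pow_pos hr0 l)]
    have h2 : |sin ((2 ^ l : ℕ) * ρ)| ≤ min 1 (2 ^ l * sin ρ) := by
      refine le_min (abs_sin_le_one _) ?_
      push_cast
      refine (abs_sin_two_pow_mul_le l ρ).trans_eq ?_
      rw [abs_of_pos hsin]
    calc r ^ l * |testH P Q (M l) (2 ^ l) ρ|
        ≤ r ^ l * ((2 * |sin ((2 ^ l : ℕ) * ρ)|) ^ P * (2 * |cos ρ|) ^ Q) := by
          gcongr; exact abs_testH_le P Q (M l) (2 ^ l) ρ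
      _ ≤ r ^ l * ((2 * min 1 (2 ^ l * sin ρ)) ^ P * (2 * |cos ρ|) ^ Q) := by gcongr
      _ = _ := by rw [mul_pow, mul_pow]; ring
  have h2 := sum_min_pow_le_rpow hs hr hP L hsin ((sin_le_one ρ).trans one_le_two)
  have h3 : |cos ρ| ^ Q ≤ |cos ρ| ^ q := by
    rw [← rpow_natCast]
    exact rpow_le_rpow_of_exponent_ge hcos (abs_cos_le_one ρ) hQ
  have h4 : 0 < sin ρ ^ P := by positivity
  calc _ ≤ _ := h1
    _ ≤ 2 ^ P * 2 ^ Q * |cos ρ| ^ q * (((1 - r)⁻¹ + 2 ^ P) * sin ρ ^ s) := by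
        gcongr; linarith
    _ = _ := by ring

theorem exists_le_sum_rpow_mul_poch {α b : ℝ} (hα : -1 < α) (hb : 0 ≤ b) :
    ∃ c, 0 < c ∧ ∀ R : ℕ, c * ((R : ℝ) + 1) ^ (α + b) ≤
      ∑ p ∈ range (R / 2 + 1), (((R - 2 * p : ℕ) : ℝ) + 1) ^ α * (poch b p / p.factorial) := by
  obtain ⟨c₁, C₁, hc₁, hC₁, h₁⟩ := exists_cesA_bounds hα
  obtain ⟨c₂, C₂, hc₂, hC₂, h₂⟩ := exists_cesA_bounds (show -1 < α + b by linarith)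
  refine ⟨c₂ / (2 ^ |α + b| * (C₁ * 2 ^ |α|)), by positivity, fun R => ?_⟩
  obtain ⟨T, hT⟩ : ∃ T, T = R / 2 := ⟨_, rfl⟩
  have hR1 : (R : ℝ) + 1 ≤ 2 * ((T : ℝ) + 1) := by
    have : R + 1 ≤ 2 * (T + 1) := by omega
    exact_mod_cast this
  have hR2 : (T : ℝ) + 1 ≤ 2 * ((R : ℝ) + 1) := by
    have : T + 1 ≤ 2 * (R + 1) := by omega
    exact_mod_cast this
  have key : cesA (α + b) T ≤ C₁ * 2 ^ |α| *
      ∑ p ∈ range (T + 1), (((R - 2 * p : ℕ) : ℝ) + 1) ^ α * (poch b p / p.factorial) := by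
    have h3 := sum_poch_mul_poch b (α + 1) T
    rw [Finset.Nat.sum_antidiagonal_eq_sum_range_succ
      (f := fun i j => poch b i / i.factorial * (poch (α + 1) j / j.factorial))] at h3
    rw [cesA_eq_poch, show α + b + 1 = b + (α + 1) by ring, ← h3, Finset.mul_sum]
    refine Finset.sum_le_sum fun p hp => ?_
    have hp' : p ≤ T := by simpa [Nat.lt_succ_iff] using hp
    have hpb : 0 ≤ poch b p / p.factorial := div_nonneg (poch_nonneg hb p) (by positivity)
    have h4 := (h₁ (T - p)).2
    rw [cesA_eq_poch] at h4
    have h5 : (((T - p : ℕ) : ℝ) + 1) ^ α ≤ 2 ^ |α| * (((R - 2 * p : ℕ) : ℝ) + 1) ^ α := by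
      refine rpow_le_of_le_mul (by positivity) (by positivity) one_le_two ?_ ?_ α
      · have : (T - p) + 1 ≤ 2 * ((R - 2 * p) + 1) := by omega
        exact_mod_cast this
      · have : (R - 2 * p) + 1 ≤ 2 * ((T - p) + 1) := by omega
        exact_mod_cast this
    calc poch b p / p.factorial * (poch (α + 1) (T - p) / (T - p).factorial)
        ≤ poch b p / p.factorial * (C₁ * (2 ^ |α| * (((R - 2 * p : ℕ) : ℝ) + 1) ^ α)) := by
          gcongr
          exact h4.trans (by gcongr)
      _ = _ := by ring
  have h6 : ((R : ℝ) + 1) ^ (α + b) ≤ 2 ^ |α + b| * ((T : ℝ) + 1) ^ (α + b) :=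
    rpow_le_of_le_mul (by positivity) (by positivity) one_le_two hR1 hR2 _
  have h7 := (h₂ T).1
  rw [← hT, div_mul_eq_mul_div, div_le_iff₀ (by positivity)]
  calc c₂ * ((R : ℝ) + 1) ^ (α + b) ≤ c₂ * (2 ^ |α + b| * ((T : ℝ) + 1) ^ (α + b)) := by gcongr
    _ = 2 ^ |α + b| * (c₂ * ((T : ℝ) + 1) ^ (α + b)) := by ring
    _ ≤ 2 ^ |α + b| * (C₁ * 2 ^ |α| * ∑ p ∈ range (T + 1),
        (((R - 2 * p : ℕ) : ℝ) + 1) ^ α * (poch b p / p.factorial)) := by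
        exact mul_le_mul_of_nonneg_left (h7.trans key) (by positivity)
    _ = _ := by ring

theorem exists_le_poch_div_factorial {a : ℝ} (ha : 0 < a) :
    ∃ c, 0 < c ∧ ∀ n q : ℕ, 0 < n → n ≤ 8 * (q + 1) → q + 1 ≤ 8 * n →
      c * (n : ℝ) ^ (a - 1) ≤ poch a q / q.factorial := by
  obtain ⟨c₁, C₁, hc₁, hC₁, h₁⟩ := exists_cesA_bounds (show -1 < a - 1 by linarith)
  refine ⟨c₁ / 8 ^ |a - 1|, by positivity, fun n q hn h1 h2 => ?_⟩
  have hn' : (0 : ℝ) < n := by exact_mod_cast hn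
  have h3 : (n : ℝ) ^ (a - 1) ≤ 8 ^ |a - 1| * ((q : ℝ) + 1) ^ (a - 1) :=
    rpow_le_of_le_mul (by positivity) hn' (by norm_num) (by exact_mod_cast h1)
      (by exact_mod_cast h2) _
  have h4 := (h₁ q).1
  rw [cesA_eq_poch, sub_add_cancel] at h4
  refine le_trans ?_ h4
  rw [div_mul_eq_mul_div, div_le_iff₀ (by positivity)]
  calc _ ≤ c₁ * (8 ^ |a - 1| * ((q : ℝ) + 1) ^ (a - 1)) := by gcongr
    _ = _ := by ring

theorem exists_le_poch_div_poch {l v : ℝ} (hl : 0 < l) (hv : 0 < v) :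
    ∃ c, 0 < c ∧ ∀ n q : ℕ, 0 < n → n ≤ 8 * (q + 1) → q + 1 ≤ 8 * n →
      c * (n : ℝ) ^ (l - v - 1) ≤ poch l q / poch v (q + 1) := by
  obtain ⟨c₁, hc₁, h₁⟩ := exists_le_poch_div_factorial hl
  obtain ⟨c₂, C₂, hc₂, hC₂, h₂⟩ := exists_cesA_bounds (show -1 < v - 1 by linarith)
  refine ⟨c₁ / (C₂ * 16 ^ |v - 1| * 8), by positivity, fun n q hn h1 h2 => ?_⟩
  have hn' : (0 : ℝ) < n := by exact_mod_cast hn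
  have h3 := h₁ n q hn h1 h2
  have h4 := (h₂ (q + 1)).2
  rw [cesA_eq_poch, sub_add_cancel] at h4
  have h5 : (((q + 1 : ℕ) : ℝ) + 1) ^ (v - 1) ≤ 16 ^ |v - 1| * (n : ℝ) ^ (v - 1) := by
    refine rpow_le_of_le_mul hn' (by positivity) (by norm_num) ?_ ?_ _
    · have : (q + 1) + 1 ≤ 16 * n := by omega
      exact_mod_cast this
    · have : n ≤ 16 * (q + 1 + 1) := by omega
      exact_mod_cast this
  have hv1 := poch_pos hv (q + 1)
  have hq : ((q : ℝ) + 1) ≤ 8 * n := by exact_mod_cast h2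
  have h6 : poch v (q + 1) ≤ C₂ * 16 ^ |v - 1| * 8 * (n : ℝ) ^ v * q.factorial := by
    rw [div_le_iff₀ (by positivity), Nat.factorial_succ] at h4
    refine h4.trans ?_
    push_cast at h5 ⊢
    calc C₂ * ((q : ℝ) + 1 + 1) ^ (v - 1) * (((q : ℝ) + 1) * q.factorial)
        ≤ C₂ * (16 ^ |v - 1| * (n : ℝ) ^ (v - 1)) * ((8 * n) * q.factorial) := by gcongr
      _ = C₂ * 16 ^ |v - 1| * 8 * ((n : ℝ) ^ (v - 1) * n) * q.factorial := by ring
      _ = _ := by rw [← rpow_add_one hn'.ne', sub_add_cancel]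
  rw [le_div_iff₀ (by positivity)] at h3
  rw [le_div_iff₀ hv1]
  calc c₁ / (C₂ * 16 ^ |v - 1| * 8) * (n : ℝ) ^ (l - v - 1) * poch v (q + 1)
      ≤ c₁ / (C₂ * 16 ^ |v - 1| * 8) * (n : ℝ) ^ (l - v - 1) *
        (C₂ * 16 ^ |v - 1| * 8 * (n : ℝ) ^ v * q.factorial) := by gcongr
    _ = c₁ * ((n : ℝ) ^ (l - v - 1) * (n : ℝ) ^ v) * q.factorial := by
        field_simp
    _ = c₁ * (n : ℝ) ^ (l - 1) * q.factorial := by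
        rw [← rpow_add hn']; ring_nf
    _ ≤ _ := h3

theorem exists_le_evenCoef {l k δ : ℝ} (hk : 0 < k) (hkl : 2 * k ≤ l) (hδ : -1 < δ) :
    ∃ c, 0 < c ∧ ∀ n i : ℕ, 0 < n → i ≤ n / 2 → n / 2 + 1 ≤ 2 * i →
      c * (n : ℝ) ^ (l - 2 * k + 1) * (((n - 2 * i : ℕ) : ℝ) + 1) ^ (δ + (l - 2 * k)) ≤
        evenCoef l k δ n i := by
  have hl : 0 < l := by linarith
  obtain ⟨c₁, hc₁, h₁⟩ := exists_le_sum_rpow_mul_poch hδ (sub_nonneg.2 hkl)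
  obtain ⟨c₂, hc₂, h₂⟩ := exists_le_poch_div_poch hl (show 0 < 2 * k by positivity)
  obtain ⟨c₃, C₃, hc₃, hC₃, h₃⟩ := exists_cesA_bounds hδ
  refine ⟨c₁ * (c₃ * (1 / (2 * l)) * c₂ * (1 / 2)), by positivity, fun n i hn hi hi2 => ?_⟩
  have hn' : (0 : ℝ) < n := by exact_mod_cast hn
  have hin : (n : ℝ) ≤ 4 * i := by
    have : n ≤ 4 * i := by omega
    exact_mod_cast this
  have key : ∀ p ∈ range (n / 2 + 1 - i),
      (c₃ * (1 / (2 * l)) * c₂ * (1 / 2)) * (n : ℝ) ^ (l - 2 * k + 1) *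
      ((((n - 2 * i - 2 * p : ℕ) : ℝ) + 1) ^ δ * (poch (l - 2 * k) p / p.factorial)) ≤
      cesA δ (n - 2 * (i + p)) * (((2 * (i + p) : ℕ) + l) / l) *
      (connC l (2 * k) (2 * i + p) p * (2 * i + 2 * k)) := by
    intro p hp
    have hp' := Finset.mem_range.1 hp
    have h4 := (h₃ (n - 2 * i - 2 * p)).1
    rw [show n - 2 * i - 2 * p = n - 2 * (i + p) by omega] at h4 ⊢
    have h5 := h₂ n (2 * i + p) hn (by omega) (by omega)
    have h6 : 0 ≤ poch (l - 2 * k) p / p.factorial :=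
      div_nonneg (poch_nonneg (sub_nonneg.2 hkl) p) (by positivity)
    have h7 : 1 / (2 * l) * n ≤ ((2 * (i + p) : ℕ) + l) / l := by
      rw [le_div_iff₀ hl]
      have : 1 / (2 * l) * (n : ℝ) * l = n / 2 := by field_simp
      rw [this]
      push_cast
      have : (0 : ℝ) ≤ p := by positivity
      linarith
    have h8 : 1 / 2 * (n : ℝ) ≤ 2 * i + 2 * k := by linarith
    have h9 : connC l (2 * k) (2 * i + p) p = poch l (2 * i + p) / poch (2 * k) (2 * i + p + 1) *
        (poch (l - 2 * k) p / p.factorial) := by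
      rw [connC, div_mul_div_comm]
    have h10 := (cesA_pos hδ (n - 2 * (i + p))).le
    have h11 := poch_pos hl (2 * i + p)
    have h12 := poch_pos (show 0 < 2 * k by positivity) (2 * i + p + 1)
    rw [h9]
    calc _ = (c₃ * (((n - 2 * (i + p) : ℕ) : ℝ) + 1) ^ δ) * (1 / (2 * l) * n) *
          ((c₂ * (n : ℝ) ^ (l - 2 * k - 1) * (poch (l - 2 * k) p / p.factorial)) *
            (1 / 2 * n)) := by
          rw [show l - 2 * k + 1 = l - 2 * k - 1 + 1 + 1 by ring, rpow_add_one hn'.ne',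
            rpow_add_one hn'.ne']
          ring
      _ ≤ _ := by gcongr
  calc _ = (c₃ * (1 / (2 * l)) * c₂ * (1 / 2)) * (n : ℝ) ^ (l - 2 * k + 1) *
        (c₁ * (((n - 2 * i : ℕ) : ℝ) + 1) ^ (δ + (l - 2 * k))) := by ring
    _ ≤ (c₃ * (1 / (2 * l)) * c₂ * (1 / 2)) * (n : ℝ) ^ (l - 2 * k + 1) *
        ∑ p ∈ range ((n - 2 * i) / 2 + 1), (((n - 2 * i - 2 * p : ℕ) : ℝ) + 1) ^ δ *
          (poch (l - 2 * k) p / p.factorial) := by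
        gcongr; exact h₁ (n - 2 * i)
    _ ≤ _ := by
        rw [Finset.mul_sum, evenCoef, show (n - 2 * i) / 2 + 1 = n / 2 + 1 - i by omega]
        exact Finset.sum_le_sum key

theorem integral_gegenC_mul_testH {k : ℝ} (hk : 0 < k) (P Q M w i : ℕ) :
    ∫ ρ in (0 : ℝ)..π, gegenC i k (cos (2 * ρ)) * testH P Q M w ρ =
      ∑ x ∈ HasAntidiagonal.antidiagonal i,
        (poch k x.1 / x.1.factorial) * (poch k x.2 / x.2.factorial) *
          ∫ ρ in (0 : ℝ)..π, cos (2 * ((x.1 - x.2 : ℤ) : ℝ) * ρ) * testH P Q M w ρ := by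
  have hc := continuous_testH P Q M w
  have h : ∀ ρ, gegenC i k (cos (2 * ρ)) * testH P Q M w ρ =
      ∑ x ∈ HasAntidiagonal.antidiagonal i,
        (poch k x.1 / x.1.factorial) * (poch k x.2 / x.2.factorial) *
          (cos (2 * ((x.1 - x.2 : ℤ) : ℝ) * ρ) * testH P Q M w ρ) := by
    intro ρ
    rw [gegenC_cos hk, Finset.sum_mul]
    refine Finset.sum_congr rfl fun x _ => ?_
    rw [show 2 * ((x.1 - x.2 : ℤ) : ℝ) * ρ = ((x.1 : ℝ) - x.2) * (2 * ρ) by push_cast; ring]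
    ring
  simp only [h]
  rw [intervalIntegral.integral_finsetSum fun x _ =>
    Continuous.intervalIntegrable (by fun_prop) _ _]
  simp only [intervalIntegral.integral_const_mul]

theorem integral_gegenC_mul_testH_term_nonneg {k : ℝ} (hk : 0 < k) (P Q : ℕ) {M w i : ℕ}
    (hi : i < M + w) {x : ℕ × ℕ} (hx : x ∈ HasAntidiagonal.antidiagonal i) :
    0 ≤ (poch k x.1 / x.1.factorial) * (poch k x.2 / x.2.factorial) *
      ∫ ρ in (0 : ℝ)..π, cos (2 * ((x.1 - x.2 : ℤ) : ℝ) * ρ) * testH P Q M w ρ := by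
  rw [HasAntidiagonal.mem_antidiagonal] at hx
  have h1 := poch_pos hk x.1
  have h2 := poch_pos hk x.2
  have h3 := integral_cos_mul_testH_nonneg P Q (M := M) (w := w) (j := x.1 - x.2)
    (abs_lt.2 ⟨by omega, by omega⟩)
  positivity

theorem integral_gegenC_mul_testH_nonneg {k : ℝ} (hk : 0 < k) (P Q : ℕ) {M w i : ℕ}
    (hi : i < M + w) :
    0 ≤ ∫ ρ in (0 : ℝ)..π, gegenC i k (cos (2 * ρ)) * testH P Q M w ρ := by
  rw [integral_gegenC_mul_testH hk]
  exact Finset.sum_nonneg fun x hx => integral_gegenC_mul_testH_term_nonneg hk P Q hi hx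

theorem le_integral_gegenC_mul_testH {k : ℝ} (hk : 0 < k) (P Q : ℕ) {M w b : ℕ}
    (hi : 2 * b < w) :
    (poch k (M + b) / (M + b).factorial) * (poch k b / b.factorial) * (π / 2) ≤
      ∫ ρ in (0 : ℝ)..π, gegenC (M + 2 * b) k (cos (2 * ρ)) * testH P Q M w ρ := by
  rw [integral_gegenC_mul_testH hk]
  have h1 := poch_pos hk (M + b)
  have h2 := poch_pos hk b
  refine le_trans ?_ (Finset.single_le_sum (fun x hx =>
    integral_gegenC_mul_testH_term_nonneg hk P Q (by omega) hx)
    (show (M + b, b) ∈ HasAntidiagonal.antidiagonal (M + 2 * b) by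
      rw [HasAntidiagonal.mem_antidiagonal]; ring))
  have h3 := le_integral_cos_mul_testH P Q (M := M) (show 0 < w by omega)
  rw [show (((M + b : ℕ), b).1 - ((M + b : ℕ), b).2 : ℤ) = M by simp]
  gcongr

theorem exists_le_integral_evenCoef {l k δ : ℝ} (hk : 0 < k) (hkl : 2 * k ≤ l) (hδ : -1 < δ) :
    ∃ c, 0 < c ∧ ∀ P Q n w : ℕ, 0 < n → 0 < w → 2 * w ≤ n / 2 + 1 →
      c * (n : ℝ) ^ (l - k) * (w : ℝ) ^ (δ + (l - k)) ≤
        ∫ ρ in (0 : ℝ)..π, (∑ i ∈ range (n / 2 + 1), evenCoef l k δ n i * gegenC i k (cos (2 *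
            ρ))) *
          testH P Q (n / 2 + 1 - w) w ρ := by
  obtain ⟨c₁, hc₁, h₁⟩ := exists_le_evenCoef hk hkl hδ
  obtain ⟨c₂, hc₂, h₂⟩ := exists_le_poch_div_factorial hk
  obtain ⟨c₃, hc₃, h₃⟩ := exists_le_sum_rpow_mul_poch (show -1 < δ + (l - 2 * k) by linarith) hk.le
  have hpi := pi_pos
  obtain ⟨e, he⟩ : ∃ e, e = δ + (l - 2 * k) := ⟨_, rfl⟩
  rw [← he] at h₁ h₃
  refine ⟨c₁ / 2 ^ |e| * c₂ * (π / 2) * c₃, by positivity, fun P Q n w hn hw hwn => ?_⟩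
  have hn' : (0 : ℝ) < n := by exact_mod_cast hn
  obtain ⟨M, hM⟩ : ∃ M, M = n / 2 + 1 - w := ⟨_, rfl⟩
  rw [← hM]
  have hcT := continuous_testH P Q M w
  have hcG : ∀ i, Continuous fun ρ : ℝ => gegenC i k (cos (2 * ρ)) := fun i =>
    (continuous_gegenC i).comp (by fun_prop)
  have e1 : ∫ ρ in (0 : ℝ)..π, (∑ i ∈ range (n / 2 + 1), evenCoef l k δ n i *
      gegenC i k (cos (2 * ρ))) * testH P Q M w ρ = ∑ i ∈ range (n / 2 + 1), evenCoef l k δ n i *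
        ∫ ρ in (0 : ℝ)..π, gegenC i k (cos (2 * ρ)) * testH P Q M w ρ := by
    simp only [Finset.sum_mul, mul_assoc]
    have hcc : ∀ i, Continuous fun ρ => evenCoef l k δ n i *
        (gegenC i k (cos (2 * ρ)) * testH P Q M w ρ) :=
      fun i => continuous_const.mul ((hcG i).mul hcT)
    rw [intervalIntegral.integral_finsetSum fun i _ => (hcc i).intervalIntegrable _ _]
    simp only [intervalIntegral.integral_const_mul]
  rw [e1]
  obtain ⟨f, hf⟩ : ∃ f : ℕ → ℝ, f = fun i => evenCoef l k δ n i *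
    ∫ ρ in (0 : ℝ)..π, gegenC i k (cos (2 * ρ)) * testH P Q M w ρ := ⟨_, rfl⟩
  have hf0 : ∀ i ∈ range (n / 2 + 1), 0 ≤ f i := by
    intro i hi
    rw [Finset.mem_range] at hi
    rw [hf]
    exact mul_nonneg (evenCoef_nonneg hk hkl hδ n i)
      (integral_gegenC_mul_testH_nonneg hk P Q (by omega))
  have h4 : ∑ b ∈ range ((w - 1) / 2 + 1), f (M + 2 * b) ≤ ∑ i ∈ range (n / 2 + 1), f i := by
    rw [← Finset.sum_image (s := range ((w - 1) / 2 + 1)) (g := fun b => M + 2 * b)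
      (f := f) (fun a _ b _ h => by simpa using h)]
    refine Finset.sum_le_sum_of_subset_of_nonneg ?_ fun i hi _ => hf0 i hi
    intro i hi
    simp only [Finset.mem_image, Finset.mem_range] at hi ⊢
    omega
  have hsum : ∑ i ∈ range (n / 2 + 1), evenCoef l k δ n i *
      ∫ ρ in (0 : ℝ)..π, gegenC i k (cos (2 * ρ)) * testH P Q M w ρ =
        ∑ i ∈ range (n / 2 + 1), f i := by rw [hf]
  rw [hsum]
  have h5 : ∀ b ∈ range ((w - 1) / 2 + 1), (c₁ / 2 ^ |e| * c₂ * (π / 2)) * (n : ℝ) ^ (l - k) *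
      ((((w - 1 - 2 * b : ℕ) : ℝ) + 1) ^ e * (poch k b / b.factorial)) ≤ f (M + 2 * b) := by
    intro b hb
    have hb' := Finset.mem_range.1 hb
    have g1 := h₁ n (M + 2 * b) hn (by omega) (by omega)
    have g2 := h₂ n (M + b) hn (by omega) (by omega)
    have g3 := le_integral_gegenC_mul_testH hk P Q (M := M) (w := w) (b := b) (by omega)
    have g4 := poch_pos hk b
    have g5 := poch_pos hk (M + b)
    have g6 : (((w - 1 - 2 * b : ℕ) : ℝ) + 1) ^ e ≤
        2 ^ |e| * (((n - 2 * (M + 2 * b) : ℕ) : ℝ) + 1) ^ e := by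
      refine rpow_le_of_le_mul (by positivity) (by positivity) one_le_two ?_ ?_ e
      · have : (w - 1 - 2 * b) + 1 ≤ 2 * ((n - 2 * (M + 2 * b)) + 1) := by omega
        exact_mod_cast this
      · have : (n - 2 * (M + 2 * b)) + 1 ≤ 2 * ((w - 1 - 2 * b) + 1) := by omega
        exact_mod_cast this
    have g7 := evenCoef_nonneg hk hkl hδ n (M + 2 * b)
    rw [hf]
    calc _ ≤ (c₁ / 2 ^ |e| * c₂ * (π / 2)) * (n : ℝ) ^ (l - k) *
          (2 ^ |e| * (((n - 2 * (M + 2 * b) : ℕ) : ℝ) + 1) ^ e * (poch k b / b.factorial)) := by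
          gcongr
      _ = (c₁ * (n : ℝ) ^ (l - 2 * k + 1) * (((n - 2 * (M + 2 * b) : ℕ) : ℝ) + 1) ^ e) *
          ((c₂ * (n : ℝ) ^ (k - 1)) * (poch k b / b.factorial) * (π / 2)) := by
          rw [show l - k = (l - 2 * k + 1) + (k - 1) by ring, rpow_add hn']
          field_simp
      _ ≤ evenCoef l k δ n (M + 2 * b) * ((poch k (M + b) / (M + b).factorial) *
          (poch k b / b.factorial) * (π / 2)) := by gcongr
      _ ≤ _ := mul_le_mul_of_nonneg_left g3 g7
  refine le_trans ?_ ((Finset.sum_le_sum h5).trans h4)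
  rw [← Finset.mul_sum]
  have h6 := h₃ (w - 1)
  have hw1 : (((w - 1 : ℕ) : ℝ) + 1) = w := by
    rw [Nat.cast_sub (by omega)]; simp
  rw [hw1, he, show δ + (l - 2 * k) + k = δ + (l - k) by ring, ← he] at h6
  calc _ = (c₁ / 2 ^ |e| * c₂ * (π / 2)) * (n : ℝ) ^ (l - k) *
      (c₃ * (w : ℝ) ^ (δ + (l - k))) := by ring
    _ ≤ _ := mul_le_mul_of_nonneg_left h6 (by positivity)

theorem exists_le_integral_abs_sum_evenCoef {l k δ : ℝ} (hk : 0 < k) (hkl : 2 * k ≤ l)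
    (hδ : -1 < δ) :
    ∃ c, 0 < c ∧ ∀ n L : ℕ, 0 < n → (∀ j < L, 2 * 2 ^ j ≤ n / 2 + 1) →
      c * (n : ℝ) ^ (l - k) * ∑ j ∈ range L, ((2 : ℝ) ^ j) ^ (δ - (l - k)) ≤
        ∫ ρ in (0 : ℝ)..π, sin ρ ^ (2 * (l - k)) * |cos ρ| ^ (2 * k) *
          |∑ i ∈ range (n / 2 + 1), evenCoef l k δ n i * gegenC i k (cos (2 * ρ))| := by
  have hs : 0 < 2 * (l - k) := by linarith
  obtain ⟨P, hP⟩ := exists_nat_ge (2 * (l - k) + 1)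
  obtain ⟨Q, hQ⟩ := exists_nat_ge (2 * k)
  obtain ⟨C, hC, hCG⟩ := exists_abs_sum_testH_le hs hP hQ
  obtain ⟨c, hc, h⟩ := exists_le_integral_evenCoef hk hkl hδ
  refine ⟨C⁻¹ * c, by positivity, fun n L hn hL => ?_⟩
  have hQ0 : Q ≠ 0 := by
    rintro rfl
    simp only [Nat.cast_zero] at hQ
    linarith
  obtain ⟨E, hE⟩ : ∃ E : ℝ → ℝ, E = fun ρ => ∑ i ∈ range (n / 2 + 1),
    evenCoef l k δ n i * gegenC i k (cos (2 * ρ)) := ⟨_, rfl⟩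
  obtain ⟨G, hG⟩ : ∃ G : ℝ → ℝ, G = fun ρ => ∑ j ∈ range L,
    ((2 : ℝ) ^ (-(2 * (l - k)))) ^ j * testH P Q (n / 2 + 1 - 2 ^ j) (2 ^ j) ρ := ⟨_, rfl⟩
  have hEc : Continuous E := by
    rw [hE]
    exact continuous_finsetSum _ fun i _ => continuous_const.mul
      ((continuous_gegenC i).comp (by fun_prop))
  have hTc := fun j : ℕ => continuous_testH P Q (n / 2 + 1 - 2 ^ j) (2 ^ j)
  have hGc : Continuous G := by
    rw [hG]
    exact continuous_finsetSum _ fun j _ => continuous_const.mul (hTc j)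
  have hWc : Continuous fun ρ : ℝ => sin ρ ^ (2 * (l - k)) * |cos ρ| ^ (2 * k) :=
    (continuous_sin.rpow_const fun _ => Or.inr hs.le).mul
      (continuous_cos.abs.rpow_const fun _ => Or.inr (by positivity))
  have h1 : c * (n : ℝ) ^ (l - k) * ∑ j ∈ range L, ((2 : ℝ) ^ j) ^ (δ - (l - k)) ≤
      ∫ ρ in (0 : ℝ)..π, E ρ * G ρ := by
    have e1 : ∀ ρ, E ρ * G ρ = ∑ j ∈ range L, ((2 : ℝ) ^ (-(2 * (l - k)))) ^ j *
        (E ρ * testH P Q (n / 2 + 1 - 2 ^ j) (2 ^ j) ρ) := fun ρ => by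
      rw [hG, Finset.mul_sum]
      exact Finset.sum_congr rfl fun j _ => by ring
    have hcc : ∀ j : ℕ, Continuous fun ρ => ((2 : ℝ) ^ (-(2 * (l - k)))) ^ j *
        (E ρ * testH P Q (n / 2 + 1 - 2 ^ j) (2 ^ j) ρ) :=
      fun j => continuous_const.mul (hEc.mul (hTc j))
    simp only [e1]
    rw [intervalIntegral.integral_finsetSum fun j _ => (hcc j).intervalIntegrable _ _,
      Finset.mul_sum]
    refine Finset.sum_le_sum fun j hj => ?_
    rw [intervalIntegral.integral_const_mul]
    have h2 := h P Q n (2 ^ j) hn (by positivity) (hL j (Finset.mem_range.1 hj))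
    rw [hE]
    refine le_trans (le_of_eq ?_) (mul_le_mul_of_nonneg_left h2 (by positivity))
    have e2 : ((2 : ℝ) ^ (-(2 * (l - k)))) ^ j = ((2 : ℝ) ^ j) ^ (-(2 * (l - k))) := by
      rw [← rpow_natCast, ← rpow_mul two_pos.le, mul_comm, rpow_mul two_pos.le, rpow_natCast]
    rw [e2, Nat.cast_pow, Nat.cast_two,
      show δ - (l - k) = -(2 * (l - k)) + (δ + (l - k)) by ring, rpow_add (by positivity)]
    ring
  have h2 : ∫ ρ in (0 : ℝ)..π, E ρ * G ρ ≤
      ∫ ρ in (0 : ℝ)..π, C * (sin ρ ^ (2 * (l - k)) * |cos ρ| ^ (2 * k) * |E ρ|) := by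
    refine intervalIntegral.integral_mono_on_of_le_Ioo pi_pos.le
      ((hEc.mul hGc).intervalIntegrable _ _)
      ((continuous_const.mul (hWc.mul hEc.abs)).intervalIntegrable _ _) fun ρ hρ => ?_
    have h3 : |G ρ| ≤ C * (sin ρ ^ (2 * (l - k)) * |cos ρ| ^ (2 * k)) := by
      by_cases h0 : cos ρ = 0
      · have h4 : ∀ j : ℕ, testH P Q (n / 2 + 1 - 2 ^ j) (2 ^ j) ρ = 0 := fun j => by
          have := abs_testH_le P Q (n / 2 + 1 - 2 ^ j) (2 ^ j) ρ
          rw [h0, abs_zero, mul_zero, zero_pow hQ0, mul_zero] at this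
          exact abs_nonpos_iff.1 this
        have h5 := sin_pos_of_mem_Ioo hρ
        rw [hG]
        simp only [h4, mul_zero, Finset.sum_const_zero, abs_zero]
        positivity
      · rw [hG]
        exact hCG L (fun j => n / 2 + 1 - 2 ^ j) ρ hρ h0
    calc E ρ * G ρ ≤ |E ρ| * |G ρ| := (le_abs_self _).trans (abs_mul _ _).le
      _ ≤ |E ρ| * (C * (sin ρ ^ (2 * (l - k)) * |cos ρ| ^ (2 * k))) := by gcongr
      _ = _ := by ring
  rw [intervalIntegral.integral_const_mul, hE] at h2
  rw [hE] at h1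
  rw [mul_assoc C⁻¹, mul_assoc C⁻¹, inv_mul_le_iff₀ hC]
  exact h1.trans h2

theorem exists_mul_cesRate_le_integral {l k δ : ℝ} (hk : 0 < k) (hkl : 2 * k ≤ l)
    (hδ : -1 < δ) :
    ∃ c, 0 < c ∧ ∀ n : ℕ, 2 ≤ n → c * cesRate (l - k) δ n ≤
      (cesA δ n)⁻¹ * ∫ ρ in (0 : ℝ)..π, sin ρ ^ (2 * (l - k)) * |cos ρ| ^ (2 * k) *
        |∑ i ∈ range (n / 2 + 1), evenCoef l k δ n i * gegenC i k (cos (2 * ρ))| := by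
  obtain ⟨c, hc, h⟩ := exists_le_integral_abs_sum_evenCoef hk hkl hδ
  obtain ⟨_, C, _, hC, hA⟩ := exists_cesA_bounds hδ
  suffices H : ∃ e, 0 < e ∧ ∀ n : ℕ, 2 ≤ n → ∃ L : ℕ, (∀ j < L, 2 * 2 ^ j ≤ n / 2 + 1) ∧
      e * cesRate (l - k) δ n ≤
        (n : ℝ) ^ (l - k - δ) * ∑ j ∈ range L, ((2 : ℝ) ^ j) ^ (δ - (l - k)) by
    obtain ⟨e, he, H⟩ := H
    refine ⟨c * (C * 2 ^ |δ|)⁻¹ * e, by positivity, fun n hn => ?_⟩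
    obtain ⟨L, hL, hL'⟩ := H n hn
    have hn0 : (0 : ℝ) < n := by exact_mod_cast (by omega : 0 < n)
    have hn1 : (1 : ℝ) ≤ n := by exact_mod_cast (by omega : 1 ≤ n)
    have h1 : cesA δ n ≤ C * 2 ^ |δ| * (n : ℝ) ^ δ := by
      rw [mul_assoc]
      exact (hA n).2.trans (mul_le_mul_of_nonneg_left
        (rpow_le_of_le_mul hn0 (by positivity) one_le_two (by linarith) (by linarith) δ) hC.le)
    have hAp := cesA_pos hδ n
    have h2 : (C * 2 ^ |δ|)⁻¹ * (n : ℝ) ^ (-δ) ≤ (cesA δ n)⁻¹ := by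
      rw [rpow_neg hn0.le, ← mul_inv]
      exact inv_anti₀ hAp h1
    calc c * (C * 2 ^ |δ|)⁻¹ * e * cesRate (l - k) δ n
        = c * (C * 2 ^ |δ|)⁻¹ * (e * cesRate (l - k) δ n) := by ring
      _ ≤ c * (C * 2 ^ |δ|)⁻¹ * ((n : ℝ) ^ (l - k - δ) *
          ∑ j ∈ range L, ((2 : ℝ) ^ j) ^ (δ - (l - k))) :=
          mul_le_mul_of_nonneg_left hL' (by positivity)
      _ = ((C * 2 ^ |δ|)⁻¹ * (n : ℝ) ^ (-δ)) * (c * (n : ℝ) ^ (l - k) *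
          ∑ j ∈ range L, ((2 : ℝ) ^ j) ^ (δ - (l - k))) := by
          rw [show l - k - δ = -δ + (l - k) by ring, rpow_add hn0]
          ring
      _ ≤ (cesA δ n)⁻¹ * (c * (n : ℝ) ^ (l - k) *
          ∑ j ∈ range L, ((2 : ℝ) ^ j) ^ (δ - (l - k))) :=
          mul_le_mul_of_nonneg_right h2 (mul_nonneg (by positivity)
            (Finset.sum_nonneg fun _ _ => by positivity))
      _ ≤ _ := mul_le_mul_of_nonneg_left (h n L (by omega) hL) (inv_pos.2 hAp).le
  have hlog : ∀ n : ℕ, 2 ≤ n → ∃ L : ℕ, (∀ j < L + 1, 2 * 2 ^ j ≤ n / 2 + 1) ∧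
      (n : ℝ) ≤ 8 * 2 ^ L := by
    intro n hn
    have h1 : 1 ≤ Nat.log 2 (n / 2 + 1) :=
      (Nat.le_log_iff_pow_le one_lt_two (by omega)).2 (by omega)
    obtain ⟨L, hL⟩ := Nat.exists_eq_add_of_le' h1
    refine ⟨L, fun j hj => ?_, ?_⟩
    · have h2 : 2 ^ (L + 1) ≤ n / 2 + 1 := hL ▸ Nat.pow_log_le_self 2 (by omega)
      have h3 : 2 ^ (j + 1) ≤ 2 ^ (L + 1) := Nat.pow_le_pow_right two_pos (by omega)
      rw [← pow_succ']
      exact h3.trans h2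
    · have h2 : n / 2 + 1 < 2 ^ (L + 1 + 1) := hL ▸ Nat.lt_pow_succ_log_self one_lt_two _
      have h3 : n ≤ 8 * 2 ^ L := by
        rw [pow_succ, pow_succ] at h2
        omega
      exact_mod_cast h3
  unfold cesRate
  split_ifs with h1 h2
  · refine ⟨(8 ^ (δ - (l - k)))⁻¹, by positivity, fun n hn => ?_⟩
    obtain ⟨L, hL, hn'⟩ := hlog n hn
    refine ⟨L + 1, hL, ?_⟩
    have hn0 : (0 : ℝ) < n := by exact_mod_cast (by omega : 0 < n)
    have h3 : ((2 : ℝ) ^ L) ^ (δ - (l - k)) ≤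
        ∑ j ∈ range (L + 1), ((2 : ℝ) ^ j) ^ (δ - (l - k)) :=
      Finset.single_le_sum (f := fun j : ℕ => ((2 : ℝ) ^ j) ^ (δ - (l - k)))
        (fun _ _ => by positivity) (Finset.self_mem_range_succ L)
    have h4 : (n : ℝ) ^ (δ - (l - k)) ≤ 8 ^ (δ - (l - k)) * ((2 : ℝ) ^ L) ^ (δ - (l - k)) := by
      rw [← mul_rpow (by norm_num) (by positivity)]
      exact rpow_le_rpow hn0.le hn' (by linarith)
    have h5 : 0 < (n : ℝ) ^ (δ - (l - k)) := by positivity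
    rw [mul_one, show l - k - δ = -(δ - (l - k)) by ring, rpow_neg hn0.le,
      inv_mul_eq_div, le_div_iff₀ h5, inv_mul_le_iff₀ (by positivity)]
    exact h4.trans (mul_le_mul_of_nonneg_left h3 (by positivity))
  · refine ⟨1 / 3, by positivity, fun n hn => ?_⟩
    obtain ⟨L, hL, hn'⟩ := hlog n hn
    refine ⟨L + 1, hL, ?_⟩
    have hn0 : (0 : ℝ) < n := by exact_mod_cast (by omega : 0 < n)
    have h3 : Real.log n ≤ (L + 3) * Real.log 2 := by
      refine (Real.log_le_log hn0 hn').trans_eq ?_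
      rw [show (8 : ℝ) * 2 ^ L = 2 ^ (L + 3) by ring, Real.log_pow]
      push_cast
      rfl
    have h4 : Real.log 2 ≤ 1 := by linarith [Real.log_two_lt_d9]
    have h5 : (L + 3 : ℝ) * Real.log 2 ≤ (L + 3) * 1 := by gcongr
    have h6 : (0 : ℝ) ≤ L := L.cast_nonneg
    rw [h2]
    simp only [sub_self, rpow_zero, Finset.sum_const, Finset.card_range, nsmul_eq_mul, one_mul,
      mul_one]
    push_cast
    linarith
  · refine ⟨1, one_pos, fun n hn => ⟨1, fun j hj => ?_, ?_⟩⟩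
    · obtain rfl : j = 0 := by omega
      omega
    · simp

theorem exists_liftB_eq_single {d : ℕ} (i : Fin (d + 1)) :
    ∃ x ∈ Metric.closedBall (0 : EuclideanSpace ℝ (Fin d)) 1,
      ∀ j, liftB d x (√(1 - ‖x‖ ^ 2)) j = if j = i then 1 else 0 := by
  induction i using Fin.lastCases with
  | last =>
    refine ⟨0, by simp, fun j => ?_⟩
    induction j using Fin.lastCases with
    | last => simp [liftB]
    | cast j => simp [liftB, (Fin.castSucc_lt_last j).ne]
  | cast i =>
    refine ⟨EuclideanSpace.single i 1, by simp, fun j => ?_⟩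
    induction j using Fin.lastCases with
    | last => simp [liftB, (Fin.castSucc_lt_last i).ne']
    | cast j => simp [liftB]

/-- The integral of the kernel `qker` against the one-dimensional weight `om k`. -/
noncomputable def qkerInt (l k δ : ℝ) (n : ℕ) (u : ℝ) : ℝ := ∫ t, qker l δ n (u * t) ∂om k

theorem measurable_qkerInt (l δ : ℝ) {k : ℝ} (hk : 0 < k) (n : ℕ) :
    Measurable (qkerInt l k δ n) := by
  have := isFiniteMeasure_om hk
  have h : Continuous fun z : ℝ × ℝ => qker l δ n (z.1 * z.2) :=
    (continuous_qker l δ n).comp (by fun_prop)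
  exact (StronglyMeasurable.integral_prod_right' (ν := om k) h.stronglyMeasurable).measurable

theorem integral_pi_om_eval {m : ℕ} {κ : Fin m → ℝ} (hκ : ∀ i, 0 < κ i) (i : Fin m) :
    ∃ c : ℝ, 0 < c ∧ ∀ f : ℝ → ℝ, Continuous f →
      ∫ t, f (t i) ∂Measure.pi (fun j => om (κ j)) = c * ∫ t, f t ∂om (κ i) := by
  have := fun i => isFiniteMeasure_om (hκ i)
  refine ⟨(∏ j ∈ Finset.univ.erase i, om (κ j) Set.univ).toReal, ?_, fun f hf => ?_⟩
  · refine ENNReal.toReal_pos (Finset.prod_ne_zero_iff.2 fun j _ => om_univ_ne_zero _) ?_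
    exact ENNReal.prod_ne_top fun j _ => measure_ne_top _ _
  · have h := integral_map (μ := Measure.pi fun j => om (κ j)) (φ := Function.eval i) (f := f)
      (measurable_pi_apply i).aemeasurable hf.aestronglyMeasurable
    rw [Measure.pi_map_eval, integral_smul_measure, smul_eq_mul] at h
    exact h.symm

theorem exists_hK_eq_mul_qkerInt {d : ℕ} {κ : Fin (d + 1) → ℝ} (hκ : ∀ i, 0 < κ i)
    (i : Fin (d + 1)) :
    ∃ c : ℝ, 0 < c ∧ ∀ (δ : ℝ) (n : ℕ) (x y : EuclideanSpace ℝ (Fin (d + 1))),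
      (∀ j, x j = if j = i then 1 else 0) →
      hK d κ δ n x y = c * ((cesA δ n)⁻¹ * qkerInt (lamK d κ) (κ i) δ n (y i)) := by
  obtain ⟨c, hc, h⟩ := integral_pi_om_eval hκ i
  have hw := integral_cube_wprod_pos hκ
  refine ⟨(∫ t in cube (d + 1), wprod κ t)⁻¹ * c, by positivity, fun δ n x y hx => ?_⟩
  have hc : Continuous fun t => qker (lamK d κ) δ n (y i * t) :=
    (continuous_qker _ _ _).comp (by fun_prop)
  have e : ∀ t : Fin (d + 1) → ℝ, ∑ j, x j * y j * t j = y i * t i := fun t => by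
    simp [hx]
  rw [hK_eq d hκ]
  simp only [e]
  rw [h _ hc, qkerInt]
  ring

theorem exists_setLIntegral_liftB_apply {d : ℕ} (hd : 1 ≤ d) {κ : Fin (d + 1) → ℝ}
    (hκ : ∀ i, 0 < κ i) (i : Fin (d + 1)) :
    ∃ C : ENNReal, C ≠ 0 ∧ C ≠ ⊤ ∧ ∀ G : ℝ → ENNReal, Measurable G →
      ∫⁻ y in Metric.closedBall 0 1, (G (liftB d y (√(1 - ‖y‖ ^ 2)) i) +
          G (liftB d y (-√(1 - ‖y‖ ^ 2)) i)) * ENNReal.ofReal (WB d κ y) =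
        C * ∫⁻ u : ℝ, ENNReal.ofReal (gw (lamK d κ - κ i + 1 / 2) (1 - u ^ 2)) *
          (ENNReal.ofReal (|u| ^ (2 * κ i)) * G u) := by
  obtain ⟨C, h0, htop, h⟩ := exists_lintegral_ball_fhInt hd κ hκ i
  have hκ' : ∀ j, 0 < κ (i.succAbove j) := fun j => hκ _
  have := isFiniteMeasure_pi_om hκ'
  obtain ⟨m, hm⟩ : ∃ m, m = (Measure.pi fun j => om (κ (i.succAbove j))) Set.univ := ⟨_, rfl⟩
  have hm0 : m ≠ 0 := by
    rw [hm, Measure.pi_univ]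
    exact Finset.prod_ne_zero_iff.2 fun j _ => om_univ_ne_zero _
  have hmt : m ≠ ⊤ := hm ▸ measure_ne_top _ _
  refine ⟨C * m⁻¹, mul_ne_zero h0 (ENNReal.inv_ne_zero.2 hmt),
    ENNReal.mul_ne_top htop (ENNReal.inv_ne_top.2 hm0), fun G hG => ?_⟩
  obtain ⟨X, hX⟩ : ∃ X : Fin (d + 1) → ℝ, X = fun j => if j = i then 1 else 0 := ⟨_, rfl⟩
  have h1 := h X (by simp [hX]) (fun u => m⁻¹ * (ENNReal.ofReal (|u| ^ (2 * κ i)) * G u))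
    (by fun_prop)
  have hfh : ∀ Y : Fin (d + 1) → ℝ,
      fhInt κ i X (fun u => m⁻¹ * (ENNReal.ofReal (|u| ^ (2 * κ i)) * G u)) Y =
        (∏ j, ENNReal.ofReal (|Y j| ^ (2 * κ j))) * G (Y i) := fun Y => by
    have e : ∀ t : Fin d → ℝ, X i * Y i + ∑ j, X (i.succAbove j) * (Y (i.succAbove j) * t j) =
        Y i := fun t => by simp [hX, Fin.succAbove_ne]
    unfold fhInt
    simp only [e]
    rw [lintegral_const, ← hm, Fin.prod_univ_succAbove _ i, mul_comm m⁻¹, mul_assoc _ m⁻¹,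
      ENNReal.inv_mul_cancel hm0 hmt]
    ring
  simp only [hfh] at h1
  rw [setLIntegral_closedBall_mul_WB hd, setLIntegral_ball_add_eq, h1, mul_assoc]
  congr 1
  rw [← lintegral_const_mul' _ _ (ENNReal.inv_ne_top.2 hm0),
    show ∑ j, κ (i.succAbove j) + (d : ℝ) / 2 = lamK d κ - κ i + 1 / 2 by
      rw [lamK_eq]; ring]
  exact lintegral_congr fun u => by ring

theorem integral_gw_one_sub_sq_pos {k : ℝ} (hk : 0 < k) : 0 < ∫ t, gw k (1 - t ^ 2) := by
  rw [integral_pos_iff_support_of_nonneg (fun t => gw_nonneg _ _) (integrable_gw_one_sub_sq hk)]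
  refine lt_of_lt_of_le ?_ (measure_mono (s := Set.Ioo (-1 : ℝ) 1) fun t ht => ?_)
  · simp
  · have h : 0 < 1 - t ^ 2 := by nlinarith [ht.1, ht.2]
    rw [Function.mem_support, gw, if_pos h]
    positivity

theorem lintegral_gw_mul_enorm_add_neg_le (a b : ℝ) {f : ℝ → ℝ} (hf : Measurable f) :
    ∫⁻ u : ℝ, ENNReal.ofReal (gw a (1 - u ^ 2)) *
        (ENNReal.ofReal (|u| ^ b) * ‖(f u + f (-u)) / 2‖ₑ) ≤
      ∫⁻ u : ℝ, ENNReal.ofReal (gw a (1 - u ^ 2)) * (ENNReal.ofReal (|u| ^ b) * ‖f u‖ₑ) := by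
  obtain ⟨w, hw⟩ : ∃ w : ℝ → ENNReal, w = fun u =>
    ENNReal.ofReal (gw a (1 - u ^ 2)) * (ENNReal.ofReal (|u| ^ b) * ‖f u‖ₑ) := ⟨_, rfl⟩
  have hwm : Measurable w := by
    have := measurable_gw a
    rw [hw]
    fun_prop
  calc _ ≤ ∫⁻ u, 2⁻¹ * (w u + w (-u)) := by
        refine lintegral_mono fun u => ?_
        have h : ‖(f u + f (-u)) / 2‖ₑ ≤ 2⁻¹ * (‖f u‖ₑ + ‖f (-u)‖ₑ) := by
          rw [div_eq_inv_mul, enorm_mul,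
            show ‖(2 : ℝ)⁻¹‖ₑ = 2⁻¹ by
              rw [Real.enorm_of_nonneg (by norm_num), ENNReal.ofReal_inv_of_pos two_pos]
              simp]
          exact mul_le_mul_right (enorm_add_le _ _) _
        refine (mul_le_mul_right (mul_le_mul_right h _) _).trans_eq ?_
        rw [hw]
        simp only [neg_sq, abs_neg]
        ring
    _ = 2⁻¹ * ((∫⁻ u, w u) + ∫⁻ u, w u) := by
        rw [lintegral_const_mul' _ _ (by simp), lintegral_add_left hwm, lintegral_neg_eq_self]
    _ = ∫⁻ u, w u := by
        rw [← two_mul, ← mul_assoc, ENNReal.inv_mul_cancel (by simp) (by simp), one_mul]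
    _ = _ := by rw [hw]

theorem exists_le_lintegral_ballK {d : ℕ} (hd : 1 ≤ d) {κ : Fin (d + 1) → ℝ}
    (hκ : ∀ i, 0 < κ i) {δ : ℝ} (hδ : -1 < δ) (i : Fin (d + 1)) :
    ∃ x ∈ Metric.closedBall (0 : EuclideanSpace ℝ (Fin d)) 1, ∃ C : ℝ, 0 < C ∧ ∀ n : ℕ,
      ENNReal.ofReal (C * ((cesA δ n)⁻¹ * ∫ ρ in (0 : ℝ)..π,
        sin ρ ^ (2 * (lamK d κ - κ i)) * |cos ρ| ^ (2 * κ i) *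
        |∑ j ∈ range (n / 2 + 1),
          evenCoef (lamK d κ) (κ i) δ n j * gegenC j (κ i) (cos (2 * ρ))|)) ≤
      ∫⁻ y in Metric.closedBall 0 1, ‖ballK d κ δ n x y‖ₑ * ENNReal.ofReal (WB d κ y) := by
  obtain ⟨x, hx, hxi⟩ := exists_liftB_eq_single i
  obtain ⟨c, hc, hK⟩ := exists_hK_eq_mul_qkerInt hκ i
  obtain ⟨D, hD0, hDt, hΦ⟩ := exists_setLIntegral_liftB_apply hd hκ i
  have hgI := integral_gw_one_sub_sq_pos (hκ i)
  obtain ⟨gI, hg⟩ : ∃ g, g = ∫ t, gw (κ i) (1 - t ^ 2) := ⟨_, rfl⟩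
  rw [← hg] at hgI
  have hD : 0 < D.toReal := ENNReal.toReal_pos hD0 hDt
  refine ⟨x, hx, c * D.toReal * gI / 2, by positivity, fun n => ?_⟩
  have hA := cesA_pos hδ n
  have hl := lamK_sub_pos hd hκ i
  obtain ⟨a, ha⟩ : ∃ a, a = c * (cesA δ n)⁻¹ := ⟨_, rfl⟩
  have ha0 : 0 < a := by rw [ha]; positivity
  obtain ⟨f, hf⟩ : ∃ f, f = qkerInt (lamK d κ) (κ i) δ n := ⟨_, rfl⟩
  have hfm : Measurable f := hf ▸ measurable_qkerInt _ _ (hκ i) n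
  have hb : ∀ y, ballK d κ δ n x y = a * ((f (liftB d y (√(1 - ‖y‖ ^ 2)) i) +
      f (liftB d y (-√(1 - ‖y‖ ^ 2)) i)) / 2) := fun y => by
    rw [ballK, hK δ n _ _ hxi, hK δ n _ _ hxi, ha, hf]
    ring
  obtain ⟨E, hE⟩ : ∃ E : ℝ → ℝ, E = fun ρ => ∑ j ∈ range (n / 2 + 1),
    evenCoef (lamK d κ) (κ i) δ n j * gegenC j (κ i) (cos (2 * ρ)) := ⟨_, rfl⟩
  have hEc : Continuous E := by
    rw [hE]
    exact continuous_finsetSum _ fun i _ => continuous_const.mul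
      ((continuous_gegenC i).comp (by fun_prop))
  have hfE : ∀ ρ, (f (cos ρ) + f (-cos ρ)) / 2 = gI * E ρ := fun ρ => by
    rw [hf, hE, hg]
    exact integral_qker_om_add_neg (lamK_pos hd hκ) (hκ i) δ n ρ
  have h1 : ENNReal.ofReal a * (D * ∫⁻ u : ℝ,
      ENNReal.ofReal (gw (lamK d κ - κ i + 1 / 2) (1 - u ^ 2)) *
        (ENNReal.ofReal (|u| ^ (2 * κ i)) * ‖(f u + f (-u)) / 2‖ₑ)) ≤
      2 * ∫⁻ y in Metric.closedBall 0 1, ‖ballK d κ δ n x y‖ₑ * ENNReal.ofReal (WB d κ y) := by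
    rw [← lintegral_const_mul' _ _ ENNReal.ofNat_ne_top]
    induction i using Fin.lastCases with
    | last =>
      rw [← hΦ (fun u => ‖(f u + f (-u)) / 2‖ₑ) (by fun_prop),
        ← lintegral_const_mul' _ _ ENNReal.ofReal_ne_top]
      refine le_of_eq (lintegral_congr fun y => ?_)
      have e : ∀ w : ℝ, liftB d y w (Fin.last d) = w := fun w => by simp [liftB]
      rw [hb, enorm_mul, Real.enorm_of_nonneg ha0.le]
      simp only [e, neg_neg]
      rw [add_comm (f (-√(1 - ‖y‖ ^ 2)))]
      ring
    | cast i =>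
      refine (mul_le_mul_right (mul_le_mul_right
        (lintegral_gw_mul_enorm_add_neg_le _ _ hfm) _) _).trans ?_
      rw [← hΦ (fun u => ‖f u‖ₑ) (by fun_prop), ← lintegral_const_mul' _ _ ENNReal.ofReal_ne_top]
      refine le_of_eq (lintegral_congr fun y => ?_)
      have e : ∀ w : ℝ, liftB d y w i.castSucc = y i := fun w => by simp [liftB]
      rw [hb, enorm_mul, Real.enorm_of_nonneg ha0.le]
      simp only [e]
      rw [add_self_div_two]
      ring
  have h2 : ∫⁻ u : ℝ, ENNReal.ofReal (gw (lamK d κ - κ i + 1 / 2) (1 - u ^ 2)) *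
        (ENNReal.ofReal (|u| ^ (2 * κ i)) * ‖(f u + f (-u)) / 2‖ₑ) =
      ENNReal.ofReal (gI * ∫ ρ in (0 : ℝ)..π, sin ρ ^ (2 * (lamK d κ - κ i)) *
        |cos ρ| ^ (2 * κ i) * |E ρ|) := by
    have hWc : Continuous fun ρ : ℝ => gI * (sin ρ ^ (2 * (lamK d κ - κ i)) *
        |cos ρ| ^ (2 * κ i) * |E ρ|) :=
      continuous_const.mul (((continuous_sin.rpow_const fun _ => Or.inr (by positivity)).mul
        (continuous_cos.abs.rpow_const fun _ => Or.inr (by have := hκ i; positivity))).mul hEc.abs)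
    rw [← intervalIntegral.integral_const_mul, intervalIntegral.integral_of_le pi_pos.le,
      integral_Ioc_eq_integral_Ioo, lintegral_gw_eq_sin, ofReal_integral_eq_lintegral_ofReal]
    · refine setLIntegral_congr_fun measurableSet_Ioo fun ρ hρ => ?_
      have hs := sin_pos_of_mem_Ioo hρ
      rw [hfE, enorm_mul, Real.enorm_of_nonneg hgI.le, ← ofReal_norm, Real.norm_eq_abs,
        ← ENNReal.ofReal_mul hgI.le, ← ENNReal.ofReal_mul (by positivity),
        ← ENNReal.ofReal_mul (by positivity)]
      congr 1
      ring
    · exact (hWc.integrableOn_Icc (a := 0) (b := π)).mono_set Set.Ioo_subset_Icc_self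
    · filter_upwards [self_mem_ae_restrict measurableSet_Ioo] with ρ hρ
      have hs := sin_pos_of_mem_Ioo hρ
      positivity
  rw [h2, ← ENNReal.ofReal_toReal hDt, ← ENNReal.ofReal_mul (by positivity),
    ← ENNReal.ofReal_mul ha0.le] at h1
  rw [← ENNReal.mul_le_mul_iff_right (a := 2) (by simp) (by simp)]
  refine le_trans (le_of_eq ?_) h1
  rw [show (2 : ENNReal) = ENNReal.ofReal 2 by simp, ← ENNReal.ofReal_mul two_pos.le, ha, hE]
  congr 1
  ring

theorem measurable_WB {d : ℕ} (κ : Fin (d + 1) → ℝ) : Measurable (WB d κ) := by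
  unfold WB
  fun_prop

theorem lintegral_WB_lt_top {d : ℕ} (hd : 1 ≤ d) {κ : Fin (d + 1) → ℝ} (hκ : ∀ i, 0 < κ i) :
    ∫⁻ y in Metric.closedBall 0 1, ENNReal.ofReal (WB d κ y) < ⊤ := by
  obtain ⟨D, -, hDt, h⟩ := exists_setLIntegral_liftB_apply hd hκ 0
  have h1 := h (fun _ => 1) measurable_const
  rw [lintegral_const_mul' _ _ (by simp), lintegral_gw_eq_sin] at h1
  have h2 : ∫⁻ ρ in Set.Ioo 0 π, ENNReal.ofReal (sin ρ ^ (2 * (lamK d κ - κ 0))) *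
      (ENNReal.ofReal (|cos ρ| ^ (2 * κ 0)) * 1) ≤ ∫⁻ _ρ in Set.Ioo 0 π, 1 := by
    refine setLIntegral_mono measurable_const fun ρ hρ => ?_
    have hs := lamK_sub_pos hd hκ 0
    have hk := hκ 0
    rw [mul_one, ← mul_one (1 : ENNReal)]
    refine mul_le_mul' ?_ ?_
    · exact ENNReal.ofReal_le_one.2
        (rpow_le_one (sin_pos_of_mem_Ioo hρ).le (sin_le_one ρ) (by positivity))
    · exact ENNReal.ofReal_le_one.2
        (rpow_le_one (abs_nonneg _) (abs_cos_le_one ρ) (by positivity))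
  have h3 : D * ∫⁻ ρ in Set.Ioo 0 π, ENNReal.ofReal (sin ρ ^ (2 * (lamK d κ - κ 0))) *
      (ENNReal.ofReal (|cos ρ| ^ (2 * κ 0)) * 1) < ⊤ :=
    ENNReal.mul_lt_top hDt.lt_top (h2.trans_lt (by simp))
  rw [← h1] at h3
  refine lt_of_le_of_lt (le_mul_of_one_le_left' ?_) h3
  norm_num

theorem measurable_hK {d : ℕ} {κ : Fin (d + 1) → ℝ} (hκ : ∀ i, 0 < κ i) (δ : ℝ) (n : ℕ)
    (x : EuclideanSpace ℝ (Fin (d + 1))) :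
    Measurable (hK d κ δ n x) := by
  have := isFiniteMeasure_pi_om hκ
  have h : Continuous fun z : EuclideanSpace ℝ (Fin (d + 1)) × (Fin (d + 1) → ℝ) =>
      qker (lamK d κ) δ n (∑ i, x i * z.1 i * z.2 i) :=
    (continuous_qker _ δ n).comp (by fun_prop)
  have h1 := (StronglyMeasurable.integral_prod_right'
    (ν := Measure.pi fun i => om (κ i)) h.stronglyMeasurable).measurable
  rw [show hK d κ δ n x = fun y => hK d κ δ n x y from rfl]
  simp only [hK_eq d hκ]
  exact (h1.const_mul _).const_mul _

theorem exists_abs_hK_le {d : ℕ} {κ : Fin (d + 1) → ℝ} (hκ : ∀ i, 0 < κ i) (δ : ℝ) (n : ℕ) :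
    ∃ B, ∀ x y : EuclideanSpace ℝ (Fin (d + 1)), ∑ j, x j ^ 2 = 1 → ∑ j, y j ^ 2 = 1 →
      |hK d κ δ n x y| ≤ B := by
  have := isFiniteMeasure_pi_om hκ
  obtain ⟨B, hB⟩ := isCompact_Icc.exists_bound_of_continuousOn (s := Set.Icc (-1 : ℝ) 1)
    (continuous_qker (lamK d κ) δ n).continuousOn
  refine ⟨|(cesA δ n)⁻¹| * (|(∫ t in cube (d + 1), wprod κ t)⁻¹| *
    (B * (Measure.pi fun i => om (κ i)).real Set.univ)), fun x y hx hy => ?_⟩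
  rw [hK_eq d hκ, abs_mul, abs_mul]
  refine mul_le_mul_of_nonneg_left (mul_le_mul_of_nonneg_left ?_ (abs_nonneg _)) (abs_nonneg _)
  rw [← Real.norm_eq_abs]
  refine norm_integral_le_of_norm_le_const ?_
  filter_upwards [ae_mem_Ioo_pi_om κ] with t ht
  exact hB _ (abs_le.1 (abs_sum_mul_mul_le hx hy fun j => abs_le.2 ⟨(ht j).1.le, (ht j).2.le⟩))

theorem measurable_ballK {d : ℕ} {κ : Fin (d + 1) → ℝ} (hκ : ∀ i, 0 < κ i) (δ : ℝ) (n : ℕ)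
    (x : EuclideanSpace ℝ (Fin d)) : Measurable (ballK d κ δ n x) := by
  have h : ∀ w : EuclideanSpace ℝ (Fin d) → ℝ, Measurable w →
      Measurable fun y => liftB d y (w y) := fun w hw => by
    have := measurable_liftB (p := fun y : EuclideanSpace ℝ (Fin d) => y) hw
    exact (EuclideanSpace.equiv (Fin (d + 1)) ℝ).symm.continuous.measurable.comp this
  have h1 := (measurable_hK hκ δ n (liftB d x √(1 - ‖x‖ ^ 2))).comp
    (h (fun y => √(1 - ‖y‖ ^ 2)) (by fun_prop))
  have h2 := (measurable_hK hκ δ n (liftB d x √(1 - ‖x‖ ^ 2))).comp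
    (h (fun y => -√(1 - ‖y‖ ^ 2)) (by fun_prop))
  exact (h1.add h2).div_const 2

theorem exists_abs_ballK_le {d : ℕ} {κ : Fin (d + 1) → ℝ} (hκ : ∀ i, 0 < κ i) (δ : ℝ) (n : ℕ) :
    ∃ B, ∀ x ∈ Metric.closedBall (0 : EuclideanSpace ℝ (Fin d)) 1,
      ∀ y ∈ Metric.closedBall (0 : EuclideanSpace ℝ (Fin d)) 1, |ballK d κ δ n x y| ≤ B := by
  obtain ⟨B, hB⟩ := exists_abs_hK_le hκ δ n
  have h0 : ∀ z ∈ Metric.closedBall (0 : EuclideanSpace ℝ (Fin d)) 1, 0 ≤ 1 - ‖z‖ ^ 2 :=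
    fun z hz => by
      rw [mem_closedBall_zero_iff] at hz
      nlinarith [norm_nonneg z]
  have h1 : ∀ z ∈ Metric.closedBall (0 : EuclideanSpace ℝ (Fin d)) 1,
      ∑ j, liftB d z (√(1 - ‖z‖ ^ 2)) j ^ 2 = 1 := fun z hz => by
    rw [sum_sq_liftB, Real.sq_sqrt (h0 z hz)]; ring
  have h2 : ∀ z ∈ Metric.closedBall (0 : EuclideanSpace ℝ (Fin d)) 1,
      ∑ j, liftB d z (-√(1 - ‖z‖ ^ 2)) j ^ 2 = 1 := fun z hz => by
    rw [sum_sq_liftB, neg_sq, Real.sq_sqrt (h0 z hz)]; ring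
  refine ⟨B, fun x hx y hy => ?_⟩
  rw [ballK, abs_div, abs_two, div_le_iff₀ two_pos, mul_two]
  exact (abs_add_le _ _).trans
    (add_le_add (hB _ _ (h1 x hx) (h1 y hy)) (hB _ _ (h1 x hx) (h2 y hy)))

theorem exists_le_cesaro {d : ℕ} (hd : 1 ≤ d) {κ : Fin (d + 1) → ℝ}
    (hκ : ∀ i, 0 < κ i) {δ : ℝ} (hδ : -1 < δ) :
    ∃ x ∈ Metric.closedBall (0 : EuclideanSpace ℝ (Fin d)) 1, ∃ c : ℝ, 0 < c ∧
      ∀ n : ℕ, 2 ≤ n → c * cesRate (sigmaK d κ) δ n ≤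
      (∫ y in Metric.closedBall (0 : EuclideanSpace ℝ (Fin d)) 1, WB d κ y)⁻¹ *
        ∫ y in Metric.closedBall (0 : EuclideanSpace ℝ (Fin d)) 1,
          |ballK d κ δ n x y| * WB d κ y := by
  obtain ⟨i, hi, hmin⟩ := exists_lamK_sub_eq_sigmaK d κ
  have hkl : 2 * κ i ≤ lamK d κ := by
    have h1 : ∑ _j : Fin (d + 1), κ i ≤ ∑ j, κ j := Finset.sum_le_sum fun j _ => hmin j
    have hd' : (1 : ℝ) ≤ d := by exact_mod_cast hd
    simp only [Finset.sum_const, Finset.card_univ, Fintype.card_fin, nsmul_eq_mul] at h1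
    push_cast at h1
    rw [lamK]
    nlinarith [hκ i]
  obtain ⟨c, hc, h⟩ := exists_mul_cesRate_le_integral (hκ i) hkl hδ
  obtain ⟨x, hx, C, hC, h'⟩ := exists_le_lintegral_ballK hd hκ hδ i
  rw [hi] at h h'
  have hlow : ∀ n : ℕ, 2 ≤ n → ENNReal.ofReal (C * (c * cesRate (sigmaK d κ) δ n)) ≤
      ∫⁻ y in Metric.closedBall 0 1, ‖ballK d κ δ n x y‖ₑ * ENNReal.ofReal (WB d κ y) :=
    fun n hn => (ENNReal.ofReal_le_ofReal (mul_le_mul_of_nonneg_left (h n hn) hC.le)).trans (h' n)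
  have hmeas : MeasurableSet (Metric.closedBall (0 : EuclideanSpace ℝ (Fin d)) 1) :=
    Metric.isClosed_closedBall.measurableSet
  have hup : ∀ n : ℕ, ∃ B : ℝ,
      ∫⁻ y in Metric.closedBall 0 1, ‖ballK d κ δ n x y‖ₑ * ENNReal.ofReal (WB d κ y) ≤
        ENNReal.ofReal B * ∫⁻ y in Metric.closedBall 0 1, ENNReal.ofReal (WB d κ y) := by
    intro n
    obtain ⟨B, hB⟩ := exists_abs_ballK_le hκ δ n
    refine ⟨B, ?_⟩
    rw [← lintegral_const_mul' _ _ ENNReal.ofReal_ne_top]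
    refine setLIntegral_mono' hmeas fun y hy => mul_le_mul_left ?_ _
    rw [← ofReal_norm, Real.norm_eq_abs]
    exact ENNReal.ofReal_le_ofReal (hB x hx y hy)
  have hWt := lintegral_WB_lt_top hd hκ
  have hWe : ∫ y in Metric.closedBall (0 : EuclideanSpace ℝ (Fin d)) 1, WB d κ y =
      (∫⁻ y in Metric.closedBall 0 1, ENNReal.ofReal (WB d κ y)).toReal :=
    integral_eq_lintegral_of_nonneg_ae
      ((ae_restrict_iff' hmeas).2 (Filter.Eventually.of_forall fun y hy => WB_nonneg κ hy))
      (measurable_WB κ).aestronglyMeasurable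
  have hW : 0 < ∫ y in Metric.closedBall (0 : EuclideanSpace ℝ (Fin d)) 1, WB d κ y := by
    rw [hWe]
    refine ENNReal.toReal_pos (fun h0 => ?_) hWt.ne
    obtain ⟨B, hB⟩ := hup 2
    have h2 := (hlow 2 le_rfl).trans hB
    have h3 := cesRate_pos (sigmaK d κ) δ le_rfl
    rw [h0, mul_zero, nonpos_iff_eq_zero, ENNReal.ofReal_eq_zero] at h2
    have : 0 < C * (c * cesRate (sigmaK d κ) δ 2) := by positivity
    linarith
  refine ⟨x, hx, (∫ y in Metric.closedBall (0 : EuclideanSpace ℝ (Fin d)) 1, WB d κ y)⁻¹ * (C * c),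
    by positivity, fun n hn => ?_⟩
  have hR := cesRate_pos (sigmaK d κ) δ hn
  rw [mul_assoc, mul_assoc]
  refine mul_le_mul_of_nonneg_left ?_ (by positivity)
  rw [integral_eq_lintegral_of_nonneg_ae ((ae_restrict_iff' hmeas).2
      (Filter.Eventually.of_forall fun y hy => mul_nonneg (abs_nonneg _) (WB_nonneg κ hy)))
      ((measurable_ballK hκ δ n x).abs.mul (measurable_WB κ)).aestronglyMeasurable]
  obtain ⟨B, hB⟩ := hup n
  have e : ∫⁻ y in Metric.closedBall 0 1, ENNReal.ofReal (|ballK d κ δ n x y| * WB d κ y) =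
      ∫⁻ y in Metric.closedBall 0 1, ‖ballK d κ δ n x y‖ₑ * ENNReal.ofReal (WB d κ y) :=
    lintegral_congr fun y => by
      rw [ENNReal.ofReal_mul (abs_nonneg _), ← Real.norm_eq_abs, ofReal_norm]
  rw [e, ← ENNReal.ofReal_le_iff_le_toReal
    (hB.trans_lt (ENNReal.mul_lt_top ENNReal.ofReal_lt_top hWt)).ne]
  exact hlow n hn

/-- Theorem 2.4, Cesàro norms on the ball: for `δ > -1` and `n ≥ 2`,
`Λ_n^{B,δ} ∼ 1` if `δ > σ_κ`, `Λ_n^{B,δ} ∼ log n` if `δ = σ_κ`, and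
`Λ_n^{B,δ} ∼ n^{σ_κ-δ}` if `-1 < δ < σ_κ`. -/
theorem cesaro_norm_ball (d : ℕ) (hd : 1 ≤ d) (κ : Fin (d + 1) → ℝ)
    (hκ : ∀ i, 0 < κ i) (δ : ℝ) (hδ : -1 < δ) :
    ∃ c₁ c₂ : ℝ, 0 < c₁ ∧ 0 < c₂ ∧ ∀ n : ℕ, 2 ≤ n →
      (δ > sigmaK d κ →
        c₁ ≤ cesaroNormB d κ δ n ∧ cesaroNormB d κ δ n ≤ c₂) ∧
      (δ = sigmaK d κ →
        c₁ * Real.log n ≤ cesaroNormB d κ δ n ∧ cesaroNormB d κ δ n ≤ c₂ * Real.log n) ∧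
      (δ < sigmaK d κ →
        c₁ * (n : ℝ) ^ (sigmaK d κ - δ) ≤ cesaroNormB d κ δ n ∧
          cesaroNormB d κ δ n ≤ c₂ * (n : ℝ) ^ (sigmaK d κ - δ)) := by
  obtain ⟨c₂, hc₂, h₂⟩ := exists_cesaro_le hd hκ hδ
  obtain ⟨x, hx, c₁, hc₁, h₁⟩ := exists_le_cesaro hd hκ hδ
  have hlow : ∀ n : ℕ, 2 ≤ n → c₁ * cesRate (sigmaK d κ) δ n ≤ cesaroNormB d κ δ n :=
    fun n hn => le_ciSup_of_le ⟨_, Set.forall_mem_range.2 fun z => h₂ n hn z.1 z.2⟩ ⟨x,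
        hx⟩ (h₁ n hn)
  have hup : ∀ n : ℕ, 2 ≤ n → cesaroNormB d κ δ n ≤ c₂ * cesRate (sigmaK d κ) δ n :=
    fun n hn => by
      have : Nonempty (Metric.closedBall (0 : EuclideanSpace ℝ (Fin d)) 1) := ⟨⟨x, hx⟩⟩
      exact ciSup_le fun z => h₂ n hn z.1 z.2
  refine ⟨c₁, c₂, hc₁, hc₂, fun n hn => ⟨fun h => ?_, fun h => ?_, fun h => ?_⟩⟩
  · have e : cesRate (sigmaK d κ) δ n = 1 := if_pos h
    have := hlow n hn
    have := hup n hn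
    simp_all
  · have e : cesRate (sigmaK d κ) δ n = Real.log n := by
      rw [cesRate, if_neg h.not_gt, if_pos h]
    rw [← e]
    exact ⟨hlow n hn, hup n hn⟩
  · have e : cesRate (sigmaK d κ) δ n = (n : ℝ) ^ (sigmaK d κ - δ) := by
      rw [cesRate, if_neg h.not_gt, if_neg h.ne]
    rw [← e]
    exact ⟨hlow n hn, hup n hn⟩
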